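/- arXiv:math/0109175 — 3 statements merged into one kernel-verified Lean document; each statement's English description precedes it below -/
import Mathlib

section
/- Let B be a set of infinite subsets of ℕ. If the set {X ∈ (ω)^ω : Min(X) \ {0} ∈ B} has the dual Ramsey property, then B is Ramsey, i.e. there is an infinite x ⊆ ℕ such that either every infinite subset of x belongs to B or no infinite subset of x belongs to B. -/
namespace DualRamsey

/-- A partition: a set of pairwise disjoint nonempty blocks (subsets of ℕ). -/
def IsPartition (P : Set (Set ℕ)) : Prop :=
  (∀ b ∈ P, b.Nonempty) ∧ ∀ b ∈ P, ∀ c ∈ P, b ≠ c → Disjoint b c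

/-- The domain of a partition: the union of its blocks. -/
def pdom (P : Set (Set ℕ)) : Set ℕ := ⋃₀ P

/-- Membership in (ω)^ω : an infinite partition of ℕ. -/
def InfPart (X : Set (Set ℕ)) : Prop :=
  IsPartition X ∧ pdom X = Set.univ ∧ X.Infinite

/-- Membership in (ℕ) : a partition whose domain is {0, …, n−1} for some n. -/
def FinPart (s : Set (Set ℕ)) : Prop :=
  IsPartition s ∧ ∃ n : ℕ, pdom s = Set.Iio n

/-- `Coarser P Q` means P ⊑ Q : P is coarser than Q, i.e. every block p of P satisfies
that p ∩ dom(Q) is a union of sets of the form q ∩ dom(P) with q a block of Q. -/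
def Coarser (P Q : Set (Set ℕ)) : Prop :=
  ∀ p ∈ P, ∃ S ⊆ Q, p ∩ pdom Q = ⋃ q ∈ S, q ∩ pdom P

/-- `Segment s X` means s ⪯ X : for every block p of s there is a block q of X
with p = q ∩ dom(s). -/
def Segment (s X : Set (Set ℕ)) : Prop :=
  ∀ p ∈ s, ∃ q ∈ X, p = q ∩ pdom s

/-- For s ∈ (ℕ) with dom(s) = {0,…,n−1}, this is the number n. -/
noncomputable def finBound (s : Set (Set ℕ)) : ℕ := sInf {n | pdom s = Set.Iio n}

/-- s* := s ∪ {{n}} where dom(s) = {0,…,n−1}. -/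
noncomputable def sStar (s : Set (Set ℕ)) : Set (Set ℕ) := insert {finBound s} s

/-- The dual Ellentuck neighbourhood (s,X) := {Y ∈ (ω)^ω : s ⪯ Y and Y ⊑ X}. -/
def EllNbhd (s X : Set (Set ℕ)) : Set (Set (Set ℕ)) :=
  {Y | InfPart Y ∧ Segment s Y ∧ Coarser Y X}

/-- (s,X)^n := {u ∈ (ℕ) : |u| = n, s ⪯ u, u* ⊑ X}. -/
def nseg (s X : Set (Set ℕ)) (n : ℕ) : Set (Set (Set ℕ)) :=
  {u | FinPart u ∧ u.ncard = n ∧ Segment s u ∧ Coarser (sStar u) X}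

/-- (s,ω)^n := {u ∈ (ℕ) : |u| = n, s ⪯ u} (ω viewed as the partition into singletons). -/
def nsegOmega (s : Set (Set ℕ)) (n : ℕ) : Set (Set (Set ℕ)) :=
  {u | FinPart u ∧ u.ncard = n ∧ Segment s u}

/-- a and b lie in a common block of P. -/
def sameBlock (P : Set (Set ℕ)) (a b : ℕ) : Prop := ∃ p ∈ P, a ∈ p ∧ b ∈ p

/-- P ⊓ Q : the finest partition coarser than both P and Q, with
dom(P ⊓ Q) = dom(P) ∪ dom(Q); its blocks are the classes of the equivalence
relation generated by "lying in a common block of P or of Q". -/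
def pmeet (P Q : Set (Set ℕ)) : Set (Set ℕ) :=
  {b | ∃ a ∈ pdom P ∪ pdom Q,
    b = {c | Relation.EqvGen (fun u v => sameBlock P u v ∨ sameBlock Q u v) a c}}

/-- P ⊑* Q : P is almost coarser than Q, i.e. there is a partition R with finite
domain such that R ⊓ P ⊑ Q. -/
def AlmostCoarser (P Q : Set (Set ℕ)) : Prop :=
  ∃ R, IsPartition R ∧ (pdom R).Finite ∧ Coarser (pmeet R P) Q

/-- A filter on (ω)^ω. -/
structure IsPFilter (F : Set (Set (Set ℕ))) : Prop where
  mem_infPart : ∀ X ∈ F, InfPart X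
  empty_not_mem : ∅ ∉ F
  upward : ∀ X ∈ F, ∀ Y, InfPart Y → Coarser X Y → Y ∈ F
  meet_infPart : ∀ X ∈ F, ∀ Y ∈ F, InfPart (pmeet X Y)
  meet_mem : ∀ X ∈ F, ∀ Y ∈ F, pmeet X Y ∈ F

/-- An ultrafilter on (ω)^ω : a filter not properly contained in any other filter. -/
def IsPUltrafilter (F : Set (Set (Set ℕ))) : Prop :=
  IsPFilter F ∧ ∀ G, IsPFilter G → F ⊆ G → F = G

/-- The segment colouring property. -/
def HasSCP (F : Set (Set (Set ℕ))) : Prop :=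
  ∀ s, FinPart s → ∀ X ∈ F, Coarser s X → ∀ k r : ℕ, 1 ≤ s.ncard + k → 1 ≤ r →
    ∀ π : Set (Set ℕ) → ℕ, (∀ u ∈ nseg s X (s.ncard + k), π u < r) →
      ∃ Y ∈ EllNbhd s X, Y ∈ F ∧
        ∀ u ∈ nseg s Y (s.ncard + k), ∀ v ∈ nseg s Y (s.ncard + k), π u = π v

/-- `IsLCondWith E p s Xw` : p is an L*_E-condition with stem s and witness family Xw. -/
def IsLCondWith (E : Set (Set (Set ℕ))) (p : Set (Set (Set ℕ))) (s : Set (Set ℕ))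
    (Xw : Set (Set ℕ) → Set (Set ℕ)) : Prop :=
  (∀ t ∈ p, FinPart t) ∧
  s ∈ p ∧ (∀ t ∈ p, Segment s t) ∧
  (∀ t ∈ p, Xw t ∈ E) ∧
  (∀ t ∈ p, Coarser (sStar t) (Xw t)) ∧
  (∀ t ∈ p, {u | u ∈ p ∧ Segment t u ∧ u.ncard = t.ncard + 1}
      = nseg (sStar t) (Xw t) (t.ncard + 1)) ∧
  (∀ t ∈ p, ∀ u ∈ p, Segment t u → EllNbhd u (Xw u) ⊆ EllNbhd t (Xw t)) ∧
  (∀ t ∈ p, ∀ u ∈ p, pdom t = pdom u → Coarser t u → Xw t = Xw u)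

/-- X is a branch of the condition p with stem s. -/
def IsBranch (p : Set (Set (Set ℕ))) (s : Set (Set ℕ)) (X : Set (Set ℕ)) : Prop :=
  ∀ t, FinPart t → Segment s t → Coarser (sStar t) X → t ∈ p

/-- F is diagonalizable: every L*_F-condition has a branch in F. -/
def Diagonalizable (F : Set (Set (Set ℕ))) : Prop :=
  ∀ p s Xw, IsLCondWith F p s Xw → ∃ X ∈ F, IsBranch p s X

/-- A Ramsey* ultrafilter: a diagonalizable scp-filter. -/
def RamseyStar (F : Set (Set (Set ℕ))) : Prop :=
  IsPFilter F ∧ HasSCP F ∧ Diagonalizable F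

/-- O is F-open: a union of nonempty dual Ellentuck neighbourhoods (s,X) with X ∈ F. -/
def FOpen (F O : Set (Set (Set ℕ))) : Prop :=
  ∃ I : Set ((Set (Set ℕ)) × (Set (Set ℕ))),
    (∀ q ∈ I, FinPart q.1 ∧ q.2 ∈ F ∧ (EllNbhd q.1 q.2).Nonempty) ∧
    O = ⋃ q ∈ I, EllNbhd q.1 q.2

/-- (s,X) is good with respect to the F-open set O. -/
def FGood (F O : Set (Set (Set ℕ))) (s X : Set (Set ℕ)) : Prop :=
  ∃ Y ∈ EllNbhd s X, Y ∈ F ∧ EllNbhd s Y ⊆ O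

/-- (s,X) is ugly with respect to O: (t*,X) is bad for every t ∈ (ℕ) with
s ⪯ t*, t* ⊑ X and |t| = |s|. -/
def FUgly (F O : Set (Set (Set ℕ))) (s X : Set (Set ℕ)) : Prop :=
  ∀ t, FinPart t → Segment s (sStar t) → Coarser (sStar t) X → t.ncard = s.ncard →
    ¬ FGood F O (sStar t) X

/-- p is uniform with uniformity witness X (X = cu(p)). -/
def UniformWith (F : Set (Set (Set ℕ))) (p : Set (Set (Set ℕ)))
    (Xw : Set (Set ℕ) → Set (Set ℕ)) (X : Set (Set ℕ)) : Prop :=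
  X ∈ F ∧ ∀ t ∈ p, EllNbhd t X = EllNbhd t (Xw t)

/-- (X) := {Y ∈ (ω)^ω : Y ⊑ X}. -/
def coarsenings (X : Set (Set ℕ)) : Set (Set (Set ℕ)) :=
  {Y | InfPart Y ∧ Coarser Y X}

/-- A ⊆ (ω)^ω has the dual Ramsey property. -/
def IsDualRamsey (A : Set (Set (Set ℕ))) : Prop :=
  ∃ X, InfPart X ∧ (coarsenings X ⊆ A ∨ coarsenings X ∩ A = ∅)

/-- A ⊆ (ω)^ω is completely dual Ramsey. -/
def CompletelyDualRamsey (A : Set (Set (Set ℕ))) : Prop :=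
  ∀ s X, FinPart s → InfPart X → (EllNbhd s X).Nonempty →
    ∃ Y ∈ EllNbhd s X, (EllNbhd s Y ⊆ A ∨ EllNbhd s Y ∩ A = ∅)

/- ### Coding between reals and partitions -/

/-- The hypotheses on the fixed pairing function ♭ : it is (induced by) a bijection
between two-element subsets of ℕ and ℕ. -/
def FlatBijection (flat : ℕ → ℕ → ℕ) : Prop :=
  (∀ m n, flat m n = flat n m) ∧
  (∀ a b c d, a ≠ b → c ≠ d → flat a b = flat c d → ({a, b} : Set ℕ) = {c, d}) ∧
  (∀ k, ∃ a b, a ≠ b ∧ flat a b = k)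

/-- trans(x): the codes ♭({a,b}) of pairs {a,b} connected by a finite chain through x. -/
def ptrans (flat : ℕ → ℕ → ℕ) (x : Set ℕ) : Set ℕ :=
  {k | ∃ m : ℕ, ∃ f : ℕ → ℕ, 1 ≤ m ∧ f 0 ≠ f m ∧ k = flat (f 0) (f m) ∧
    ∀ i < m, flat (f i) (f (i + 1)) ∈ x}

/-- The equivalence relation n ∼ m iff n = m or ♭({n,m}) ∈ trans(x). -/
def cpRel (flat : ℕ → ℕ → ℕ) (x : Set ℕ) (n m : ℕ) : Prop :=
  n = m ∨ flat n m ∈ ptrans flat x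

/-- cp(x): the partition of ℕ whose blocks are the classes of cpRel. -/
def cp (flat : ℕ → ℕ → ℕ) (x : Set ℕ) : Set (Set ℕ) :=
  {b | ∃ n : ℕ, b = {m | cpRel flat x n m}}

/-- pc(X): the partition code of X. -/
def pcode (flat : ℕ → ℕ → ℕ) (X : Set (Set ℕ)) : Set ℕ :=
  {k | ∃ n m, n ≠ m ∧ sameBlock X n m ∧ k = flat n m}

/- ### The game G_F -/

/-- A move of player I: a pair ⟨t, Y⟩. -/
abbrev MoveI := (Set (Set ℕ)) × (Set (Set ℕ))

/-- The play (t, Y, X) follows the strategy σ of player I (σ reads off the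
previous moves of player II). -/
def Follows (σ : List (Set (Set ℕ)) → MoveI) (t Y X : ℕ → Set (Set ℕ)) : Prop :=
  ∀ n, σ (List.ofFn fun i : Fin n => X i) = (t n, Y n)

/-- Player I's n-th move in the play (t,Y,X) is legal. -/
def LegalI (F : Set (Set (Set ℕ))) (t Y X : ℕ → Set (Set ℕ)) (n : ℕ) : Prop :=
  FinPart (t n) ∧ Y n ∈ F ∧ (EllNbhd (sStar (t n)) (Y n)).Nonempty ∧
  ∀ m, n = m + 1 →
    Segment (sStar (t m)) (sStar (t n)) ∧ Coarser (sStar (t n)) (X m) ∧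
    (t n).ncard = (t m).ncard + 1

/-- Player II's n-th move in the play (t,Y,X) is legal. -/
def LegalII (F : Set (Set (Set ℕ))) (t Y X : ℕ → Set (Set ℕ)) (n : ℕ) : Prop :=
  X n ∈ F ∧ X n ∈ EllNbhd (sStar (t n)) (Y n)

/-- σ is a winning strategy for player I in G_F: against legal play of II it always
produces legal moves, and in every legal play following σ player I wins, i.e. any
Y ∈ (ω)^ω with t_n ⪯ Y for all n is not in F. -/
def WinningStratI (F : Set (Set (Set ℕ))) (σ : List (Set (Set ℕ)) → MoveI) : Prop :=
  ∀ t Y X, Follows σ t Y X →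
    (∀ n, (∀ m < n, LegalII F t Y X m) → LegalI F t Y X n) ∧
    ((∀ n, LegalII F t Y X n) →
      ∀ Z, InfPart Z → (∀ n, Segment (t n) Z) → Z ∉ F)

/-- A game filter: an ultrafilter such that player I has no winning strategy in G_F. -/
def GameFilter (F : Set (Set (Set ℕ))) : Prop :=
  IsPUltrafilter F ∧ ∀ σ, ¬ WinningStratI F σ

/- ### Density notions for the appendix -/

/-- (t)^0_s := {u ∈ (ℕ) : dom(u) = dom(t), s ⪯ u, u ⊑ t, |u| = |s|}. -/
def iseg0 (s t : Set (Set ℕ)) : Set (Set (Set ℕ)) :=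
  {u | FinPart u ∧ pdom u = pdom t ∧ Segment s u ∧ Coarser u t ∧ u.ncard = s.ncard}

/-- K ⊆ (ℕ) is dense in (t,X): for every Y ∈ (t,X) ∩ F there is u ∈ K with
t ⪯ u* and u* ⊑ Y. -/
def DenseIn (F : Set (Set (Set ℕ))) (K : Set (Set (Set ℕ))) (t X : Set (Set ℕ)) : Prop :=
  ∀ Y ∈ EllNbhd t X, Y ∈ F → ∃ u ∈ K, Segment t (sStar u) ∧ Coarser (sStar u) Y

/-- D is 0-dense in (X)^{0*}_s: for every Y ∈ (s,X) ∩ F there is u ∈ D with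
s ⪯ u* and u* ⊑ Y. -/
def ZeroDense (F : Set (Set (Set ℕ))) (D : Set (Set (Set ℕ))) (s X : Set (Set ℕ)) : Prop :=
  ∀ Y ∈ EllNbhd s X, Y ∈ F → ∃ u ∈ D, Segment s (sStar u) ∧ Coarser (sStar u) Y

/-- (t,X)^{k*}_s := {u ∈ (ℕ) : t ⪯ u*, u* ⊑ X, |u| = |s| + k}. -/
def tseg (s t X : Set (Set ℕ)) (k : ℕ) : Set (Set (Set ℕ)) :=
  {u | FinPart u ∧ Segment t (sStar u) ∧ Coarser (sStar u) X ∧ u.ncard = s.ncard + k}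

/-- E is k-dense in (t,X)^{k*}_s: for every Y ∈ (t,X) ∩ F, (t,Y)^{k*}_s ∩ E ≠ ∅. -/
def KDense (F : Set (Set (Set ℕ))) (E : Set (Set (Set ℕ))) (s t X : Set (Set ℕ))
    (k : ℕ) : Prop :=
  ∀ Y ∈ EllNbhd t X, Y ∈ F → (tseg s t Y k ∩ E).Nonempty

/-- The least element of a block determines the block. -/
theorem InfPart.injOn_sInf {X : Set (Set ℕ)} (hX : InfPart X) : Set.InjOn sInf X := by
  obtain ⟨⟨hne, hdis⟩, -, -⟩ := hX
  intro b hb c hc hbc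
  by_contra hne'
  refine Set.disjoint_left.1 (hdis b hb c hc hne') (Nat.sInf_mem (hne b hb)) ?_
  rw [hbc]
  exact Nat.sInf_mem (hne c hc)

/-- The set of nonzero minima of the blocks of an infinite partition is infinite. -/
theorem InfPart.infinite_minima {X : Set (Set ℕ)} (hX : InfPart X) :
    ((sInf '' X) \ {0}).Infinite :=
  (hX.2.2.image hX.injOn_sInf).sdiff (Set.finite_singleton 0)

/-- Every infinite set of nonzero minima of blocks of `X` is the set of nonzero minima of some
coarsening of `X`: merge all blocks whose minimum is not in the given set into the block of `0`. -/
theorem InfPart.exists_coarsening_minima_eq {X : Set (Set ℕ)} (hX : InfPart X) {y : Set ℕ}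
    (hyX : y ⊆ (sInf '' X) \ {0}) (hy : y.Infinite) :
    ∃ Y ∈ coarsenings X, (sInf '' Y) \ {0} = y := by
  classical
  obtain ⟨⟨hne, hdis⟩, hdom, -⟩ := hX
  have hblock : ∀ n, ∃ b ∈ X, n ∈ b := fun n => by
    have hn : n ∈ pdom X := hdom ▸ Set.mem_univ n
    exact hn
  choose block hblockX hmem using hblock
  have hblock_eq : ∀ b ∈ X, ∀ n ∈ b, block n = b := fun b hb n hn => by
    by_contra hne'
    exact Set.disjoint_left.1 (hdis _ (hblockX n) b hb hne') (hmem n) hn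
  have h0y : 0 ∉ y := fun h0 => (hyX h0).2 rfl
  -- `g n` is the minimum of the merged block containing `n`
  let g : ℕ → ℕ := fun n => if sInf (block n) ∈ y then sInf (block n) else 0
  have hg_le : ∀ n, g n ≤ n := fun n => by
    have := Nat.sInf_le (hmem n)
    simp only [g]; split_ifs <;> omega
  have hg_range : ∀ n, g n ∈ insert 0 y := fun n => by
    simp only [g]; split_ifs with h <;> simp [h]
  have hg_self : ∀ k ∈ insert 0 y, g k = k := by
    rintro k (rfl | hk)
    · exact Nat.le_zero.1 (hg_le 0)
    · obtain ⟨⟨b, hb, rfl⟩, -⟩ := hyX hk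
      simp [g, hblock_eq b hb _ (Nat.sInf_mem (hne b hb)), hk]
  have hmin : ∀ k ∈ insert 0 y, sInf (g ⁻¹' {k}) = k := fun k hk => by
    refine le_antisymm (Nat.sInf_le (hg_self k hk)) ?_
    refine le_csInf ⟨k, hg_self k hk⟩ fun n hn => ?_
    rw [← (hn : g n = k)]
    exact hg_le n
  let Y : Set (Set ℕ) := (fun k => g ⁻¹' {k}) '' insert 0 y
  have hminY : sInf '' Y = insert 0 y := by
    rw [Set.image_image, Set.image_congr hmin, Set.image_id']
  have hYdom : pdom Y = Set.univ :=
    Set.eq_univ_of_forall fun n => ⟨g ⁻¹' {g n}, ⟨g n, hg_range n, rfl⟩, rfl⟩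
  refine ⟨Y, ⟨⟨⟨?_, ?_⟩, hYdom, ?_⟩, ?_⟩, ?_⟩
  · rintro _ ⟨k, hk, rfl⟩
    exact ⟨k, hg_self k hk⟩
  · rintro _ ⟨k, -, rfl⟩ _ ⟨l, -, rfl⟩ hkl
    refine Set.disjoint_left.2 fun n hn hn' => hkl ?_
    rw [← (hn : g n = k), ← (hn' : g n = l)]
  · refine Set.Infinite.of_image sInf ?_
    rw [hminY]
    exact hy.mono (Set.subset_insert 0 y)
  · rintro _ ⟨k, -, rfl⟩
    refine ⟨{b ∈ X | b ⊆ g ⁻¹' {k}}, Set.sep_subset _ _, ?_⟩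
    rw [hdom, hYdom]
    ext n
    simp only [Set.inter_univ, Set.mem_iUnion, exists_prop]
    refine ⟨fun hn => ⟨block n, ⟨hblockX n, fun m hm => ?_⟩, hmem n⟩,
      fun ⟨b, hb, hn⟩ => hb.2 hn⟩
    have hmn := hblock_eq _ (hblockX n) m hm
    change g m = k
    rw [← (hn : g n = k)]
    simp only [g, hmn]
  · rw [hminY, Set.insert_sdiff_of_mem _ (Set.mem_singleton 0), Set.sdiff_singleton_eq_self h0y]

/-- If {X ∈ (ω)^ω : Min(X) \ {0} ∈ B} is dual Ramsey, then B is Ramsey. -/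
theorem min_dual_ramsey_implies_ramsey (B : Set (Set ℕ))
    (hB : ∀ b ∈ B, b.Infinite)
    (h : IsDualRamsey {X | InfPart X ∧ ((sInf '' X) \ {0}) ∈ B}) :
    ∃ x : Set ℕ, x.Infinite ∧
      ((∀ y ⊆ x, y.Infinite → y ∈ B) ∨ (∀ y ⊆ x, y.Infinite → y ∉ B)) := by
  obtain ⟨X, hX, hsub | hdisj⟩ := h
  · refine ⟨_, hX.infinite_minima, Or.inl fun y hyX hy => ?_⟩
    obtain ⟨Y, hY, rfl⟩ := hX.exists_coarsening_minima_eq hyX hy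
    exact (hsub hY).2
  · refine ⟨_, hX.infinite_minima, Or.inr fun y hyX hy hyB => ?_⟩
    obtain ⟨Y, hY, rfl⟩ := hX.exists_coarsening_minima_eq hyX hy
    exact Set.notMem_empty Y (hdisj ▸ ⟨hY, hY.1, hyB⟩)

end DualRamsey
end

section
/- Let A ⊆ (ω)^ω and suppose that the set of partition codes {pc(X) : X ∈ A}, regarded as a subset of the Cantor space of all subsets of ℕ, is an analytic set (a continuous image of a Polish space). Then A is completely dual Ramsey. -/
namespace DualRamsey

open Classical in
/-- The partition code of X as a point of Cantor space. -/
noncomputable def pcBool (flat : ℕ → ℕ → ℕ) (X : Set (Set ℕ)) : ℕ → Bool :=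
  fun n => decide (n ∈ pcode flat X)

/-- Rigid surjections of `ℕ`: surjections whose values first appear in increasing order.
They encode partitions of `ℕ` into infinitely many blocks, `f i` being the index of the block
of `i` when the blocks are ordered by their minima. -/
def Rigid (f : ℕ → ℕ) : Prop :=
  Function.Surjective f ∧ ∀ i, ∀ v < f i, ∃ j < i, f j = v

/-- Rigid surjections fixing every `i < k`. -/
def RigidFix (k : ℕ) (f : ℕ → ℕ) : Prop :=
  Rigid f ∧ ∀ i < k, f i = i

theorem Rigid.le {f : ℕ → ℕ} (hf : Rigid f) (i : ℕ) : f i ≤ i := by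
  induction i using Nat.strong_induction_on with
  | _ i ih =>
    by_contra! h
    obtain ⟨j, hj, hji⟩ := hf.2 i i h
    have := ih j hj
    omega

theorem Rigid.zero {f : ℕ → ℕ} (hf : Rigid f) : f 0 = 0 := by
  have := hf.le 0
  omega

theorem Rigid.id : Rigid (fun i => i) :=
  ⟨Function.surjective_id, fun _ v hv => ⟨v, hv, rfl⟩⟩

theorem Rigid.comp {f g : ℕ → ℕ} (hg : Rigid g) (hf : Rigid f) : Rigid (g ∘ f) := by
  refine ⟨hg.1.comp hf.1, fun i v hv => ?_⟩
  obtain ⟨j, hj, hjv⟩ := hg.2 _ v hv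
  obtain ⟨i', hi', hij⟩ := hf.2 _ j hj
  exact ⟨i', hi', by simp [hij, hjv]⟩

theorem RigidFix.id (k : ℕ) : RigidFix k (fun i => i) := ⟨Rigid.id, fun _ _ => rfl⟩

theorem RigidFix.comp {k : ℕ} {f g : ℕ → ℕ} (hg : RigidFix k g) (hf : RigidFix k f) :
    RigidFix k (g ∘ f) :=
  ⟨hg.1.comp hf.1, fun i hi => by simp [hf.2 i hi, hg.2 i hi]⟩

theorem RigidFix.mono {k l : ℕ} {f : ℕ → ℕ} (h : k ≤ l) (hf : RigidFix l f) : RigidFix k f :=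
  ⟨hf.1, fun i hi => hf.2 i (hi.trans_le h)⟩

/-- A rigid surjection factors through another one as soon as its kernel is coarser. -/
theorem Rigid.exists_factor {f h : ℕ → ℕ} {m : ℕ} (hf : Rigid f) (hh : Rigid h)
    (hker : ∀ i j, f i = f j → h i = h j) (hfix : ∀ i, f i < m → h i = f i) :
    ∃ g, RigidFix m g ∧ h = g ∘ f := by
  choose s hs using hf.1
  have hg : ∀ i, h (s (f i)) = h i := fun i => hker _ _ (hs _)
  refine ⟨fun v => h (s v), ⟨⟨fun v => ?_, fun w v hv => ?_⟩, fun v hv => ?_⟩, ?_⟩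
  · obtain ⟨i, rfl⟩ := hh.1 v
    exact ⟨f i, hg i⟩
  · have hex : ∃ i, f i = w := hf.1 w
    classical
    have hi : f (Nat.find hex) = w := Nat.find_spec hex
    have hmin := fun j => Nat.find_min (H := hex) (m := j)
    set i := Nat.find hex
    have hv' : v < h i := by rw [← hg i, hi]; exact hv
    obtain ⟨j, hj, hjv⟩ := hh.2 i v hv'
    refine ⟨f j, ?_, by rw [← hjv]; exact hg j⟩
    by_contra! hle
    rcases hle.lt_or_eq with hlt | heq
    · obtain ⟨j', hj', h'⟩ := hf.2 j w hlt
      exact hmin j' (hj'.trans hj) h'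
    · exact hmin j hj heq.symm
  · have := hfix (s v) (by rw [hs]; exact hv)
    rw [hs] at this
    exact this
  · funext i
    exact (hg i).symm

/-- `u` maps `[0, m)` onto `[0, k)`. -/
def IsStem (m k : ℕ) (u : ℕ → ℕ) : Prop :=
  (∀ i < m, u i < k) ∧ ∀ v < k, ∃ i < m, u i = v

/-- Follow `u` on `[0, m)`, then continue with the fresh values `k, k + 1, …`. -/
def stemExt (m k : ℕ) (u : ℕ → ℕ) (i : ℕ) : ℕ :=
  if i < m then u i else k + (i - m)

theorem stemExt_lt {m k i : ℕ} (u : ℕ → ℕ) (h : i < m) : stemExt m k u i = u i := if_pos h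

theorem stemExt_ge {m k i : ℕ} (u : ℕ → ℕ) (h : m ≤ i) : stemExt m k u i = k + (i - m) :=
  if_neg (by omega)

theorem IsStem.congr {m k : ℕ} {u v : ℕ → ℕ} (hu : IsStem m k u) (h : ∀ i < m, u i = v i) :
    IsStem m k v :=
  ⟨fun i hi => h i hi ▸ hu.1 i hi, fun w hw => by
    obtain ⟨i, hi, hiw⟩ := hu.2 w hw
    exact ⟨i, hi, by rw [← h i hi, hiw]⟩⟩

theorem IsStem.rigid_stemExt {m k : ℕ} {u : ℕ → ℕ} (hs : IsStem m k u)
    (hu : ∀ i < m, ∀ v < u i, ∃ j < i, u j = v) : Rigid (stemExt m k u) := by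
  refine ⟨fun v => ?_, fun i v hv => ?_⟩
  · by_cases h : v < k
    · obtain ⟨i, hi, rfl⟩ := hs.2 v h
      exact ⟨i, stemExt_lt u hi⟩
    · exact ⟨m + (v - k), by rw [stemExt_ge u (by omega)]; omega⟩
  · by_cases h : i < m
    · rw [stemExt_lt u h] at hv
      obtain ⟨j, hj, hjv⟩ := hu i h v hv
      exact ⟨j, hj, by rw [stemExt_lt u (by omega), hjv]⟩
    · push Not at h
      rw [stemExt_ge u h] at hv
      by_cases h' : v < k
      · obtain ⟨j, hj, rfl⟩ := hs.2 v h'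
        exact ⟨j, by omega, stemExt_lt u hj⟩
      · exact ⟨m + (v - k), by omega, by rw [stemExt_ge u (by omega)]; omega⟩

theorem IsStem.factor {m k : ℕ} {u : ℕ → ℕ} (hs : IsStem m k u) (hu : Rigid u) :
    ∃ v, RigidFix k v ∧ u = v ∘ stemExt m k u := by
  refine Rigid.exists_factor (hs.rigid_stemExt fun i _ => hu.2 i) hu (fun i j hij => ?_)
    (fun i hi => ?_)
  · by_cases hi : i < m <;> by_cases hj : j < m
    · rwa [stemExt_lt u hi, stemExt_lt u hj] at hij
    · have := hs.1 i hi
      rw [stemExt_lt u hi, stemExt_ge u (by omega)] at hij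
      omega
    · have := hs.1 j hj
      rw [stemExt_lt u hj, stemExt_ge u (by omega)] at hij
      omega
    · rw [stemExt_ge u (by omega), stemExt_ge u (by omega)] at hij
      congr 1
      omega
  · by_cases h : i < m
    · rw [stemExt_lt u h]
    · rw [stemExt_ge u (by omega)] at hi
      omega

theorem IsStem.comp_right {m k : ℕ} {u v : ℕ → ℕ} (hs : IsStem m k u)
    (hr : Rigid (stemExt m k u)) (hv : RigidFix m v) :
    ∃ v', RigidFix k v' ∧ stemExt m k u ∘ v = v' ∘ stemExt m k u := by
  have hagree : ∀ i < m, u i = (stemExt m k u ∘ v) i := fun i hi => by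
    simp [hv.2 i hi, stemExt_lt u hi]
  obtain ⟨v', hv', h⟩ := (hs.congr hagree).factor (hr.comp hv.1)
  refine ⟨v', hv', ?_⟩
  have : stemExt m k (stemExt m k u ∘ v) = stemExt m k u := by
    funext i
    by_cases hi : i < m
    · rw [stemExt_lt _ hi, ← hagree i hi, stemExt_lt _ hi]
    · rw [stemExt_ge _ (by omega), stemExt_ge _ (by omega)]
  rw [this] at h
  exact h

theorem IsStem.comp_left {m k : ℕ} {u g : ℕ → ℕ} (hs : IsStem m k u) (hg : RigidFix k g) :
    ∃ g', RigidFix m g' ∧ stemExt m k u ∘ g' = g ∘ stemExt m k u := by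
  choose! s hsm hsv using hs.2
  let e := stemExt m k u
  let g' : ℕ → ℕ := fun i =>
    if i < m then i else if g (e i) < k then s (g (e i)) else m + (g (e i) - k)
  have g'_lt : ∀ i < m, g' i = i := fun i hi => if_pos hi
  have e_ge : ∀ i, m ≤ i → e i = k + (i - m) := fun i hi => stemExt_ge u hi
  have g_ge : ∀ w v, k ≤ v → g w = v → k ≤ w := fun w v hv hw => by
    by_contra! h
    rw [hg.2 w h] at hw
    omega
  have g'_ge : ∀ i, m ≤ i → k ≤ g (e i) → g' i = m + (g (e i) - k) := fun i hi h => by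
    simp only [g']
    rw [if_neg (by omega), if_neg (by omega)]
  refine ⟨g', ⟨⟨fun v => ?_, fun i v hv => ?_⟩, g'_lt⟩, funext fun i => ?_⟩
  · by_cases h : v < m
    · exact ⟨v, g'_lt v h⟩
    · obtain ⟨w, hw⟩ := hg.1.1 (k + (v - m))
      have hkw := g_ge w _ (by omega) hw
      have he : e (m + (w - k)) = w := by rw [e_ge _ (by omega)]; omega
      exact ⟨m + (w - k), by rw [g'_ge _ (by omega) (by rw [he, hw]; omega), he, hw]; omega⟩
  · by_cases hi : i < m
    · rw [g'_lt i hi] at hv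
      exact ⟨v, hv, g'_lt v (by omega)⟩
    · by_cases hvm : v < m
      · exact ⟨v, by omega, g'_lt v hvm⟩
      · have hk : k ≤ g (e i) := by
          by_contra! h
          have : g' i = s (g (e i)) := by
            simp only [g']
            rw [if_neg hi, if_pos h]
          have := hsm _ h
          omega
        rw [g'_ge i (by omega) hk] at hv
        obtain ⟨w, hw, hwv⟩ := hg.1.2 (e i) (k + (v - m)) (by omega)
        have hkw := g_ge w _ (by omega) hwv
        have he : e (m + (w - k)) = w := by rw [e_ge _ (by omega)]; omega
        have hei := e_ge i (by omega)
        exact ⟨m + (w - k), by omega,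
          by rw [g'_ge _ (by omega) (by rw [he, hwv]; omega), he, hwv]; omega⟩
  · change e (g' i) = g (e i)
    by_cases hi : i < m
    · have : e i = u i := stemExt_lt u hi
      rw [g'_lt i hi, this, hg.2 _ (hs.1 i hi)]
    · by_cases h : g (e i) < k
      · have h1 : g' i = s (g (e i)) := by
          simp only [g']
          rw [if_neg hi, if_pos h]
        rw [h1]
        exact (stemExt_lt u (hsm _ h)).trans (hsv _ h)
      · rw [g'_ge i (by omega) (by omega), e_ge _ (by omega)]
        omega

/-- Every rigid surjection has a stem with `k` values. -/
theorem Rigid.exists_isStem {u : ℕ → ℕ} (hu : Rigid u) {k : ℕ} (hk : 1 ≤ k) :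
    ∃ m, k ≤ m ∧ IsStem m k u := by
  classical
  have hex : ∃ i, u i = k - 1 := hu.1 _
  have hi : u (Nat.find hex) = k - 1 := Nat.find_spec hex
  have hmin := fun j => Nat.find_min (H := hex) (m := j)
  set i := Nat.find hex
  have := hu.le i
  refine ⟨i + 1, by omega, fun j hj => ?_, fun v hv => ?_⟩
  · by_contra! h
    obtain ⟨j', hj', h'⟩ := hu.2 j (k - 1) (by omega)
    exact hmin j' (by omega) h'
  · by_cases h : v = k - 1
    · exact ⟨i, by omega, by omega⟩
    · obtain ⟨j, hj, hjv⟩ := hu.2 i v (by omega)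
      exact ⟨j, by omega, hjv⟩

/-- A property which persists under composition with elements of `RigidFix k`. -/
def Persists (k : ℕ) (P : (ℕ → ℕ) → Prop) : Prop :=
  ∀ f g, RigidFix k g → P f → P (g ∘ f)

/-- A property which can be forced below every element of `RigidFix k₀` by an
element of `RigidFix k`. -/
def DenseBelow (k₀ k : ℕ) (P : (ℕ → ℕ) → Prop) : Prop :=
  ∀ f, RigidFix k₀ f → ∃ g, RigidFix k g ∧ P (g ∘ f)

theorem DenseBelow.forall_finite {ι : Type*} [Finite ι] {k₀ k : ℕ} (hk : k₀ ≤ k)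
    {P : ι → (ℕ → ℕ) → Prop} (hP : ∀ i, Persists k (P i)) (hD : ∀ i, DenseBelow k₀ k (P i)) :
    DenseBelow k₀ k (fun f => ∀ i, P i f) := by
  classical
  cases nonempty_fintype ι
  suffices H : ∀ S : Finset ι, DenseBelow k₀ k (fun f => ∀ i ∈ S, P i f) by
    intro f hf
    obtain ⟨g, hg, h⟩ := H Finset.univ f hf
    exact ⟨g, hg, fun i => h i (Finset.mem_univ i)⟩
  intro S
  induction S using Finset.induction_on with
  | empty => exact fun f _ => ⟨_, RigidFix.id k, by simp⟩
  | insert a S _ ih =>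
    intro f hf
    obtain ⟨g, hg, h⟩ := ih f hf
    obtain ⟨g', hg', h'⟩ := hD a (g ∘ f) ((hg.mono hk).comp hf)
    refine ⟨g' ∘ g, hg'.comp hg, fun i hi => ?_⟩
    rcases Finset.mem_insert.1 hi with rfl | hi
    · exact h'
    · exact hP i (g ∘ f) g' hg' (h i hi)

theorem denseBelow_stems {P : ℕ → (ℕ → ℕ) → Prop} {k₀ m : ℕ} (hm : k₀ ≤ m)
    (hP : ∀ k, k₀ ≤ k → Persists k (P k)) (hD : ∀ k, k₀ ≤ k → DenseBelow k₀ k (P k)) :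
    DenseBelow k₀ m (fun f => ∀ k u, k₀ ≤ k → k ≤ m → RigidFix k₀ u → IsStem m k u →
      P k (stemExt m k u ∘ f)) := by
  have hpers : ∀ k u, k₀ ≤ k → RigidFix k₀ u → IsStem m k u →
      Persists m (fun f => P k (stemExt m k u ∘ f)) := by
    intro k u hk hu hs f g hg hf
    obtain ⟨v, hv, h⟩ := hs.comp_right (hs.rigid_stemExt fun i _ => hu.1.2 i) hg
    rw [← Function.comp_assoc, h, Function.comp_assoc]
    exact hP k hk _ _ hv hf
  have key := DenseBelow.forall_finite (ι := Fin (m + 1) × (Fin m → Fin (m + 1))) (k₀ := k₀)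
    (k := m) hm (P := fun p f => ∀ u, (∀ i (hi : i < m), u i = (p.2 ⟨i, hi⟩ : ℕ)) → k₀ ≤ p.1 →
      RigidFix k₀ u → IsStem m p.1 u → P p.1 (stemExt m p.1 u ∘ f)) ?_ ?_
  · intro f hf
    obtain ⟨g, hg, h⟩ := key f hf
    refine ⟨g, hg, fun k u hk hkm hu hs => ?_⟩
    exact h (⟨k, by omega⟩, fun i => ⟨u i, by have := hs.1 i i.2; omega⟩) u (fun _ _ => rfl)
      hk hu hs
  · intro p f g hg hf u hup hk hu hs
    exact hpers _ u hk hu hs f g hg (hf u hup hk hu hs)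
  · rintro ⟨k, τ⟩ f hf
    by_cases hex : ∃ u : ℕ → ℕ, (∀ i (hi : i < m), u i = (τ ⟨i, hi⟩ : ℕ)) ∧ k₀ ≤ k ∧
        RigidFix k₀ u ∧ IsStem m k u
    · obtain ⟨u, huτ, hk, hu, hs⟩ := hex
      have hr : RigidFix k₀ (stemExt m k u) :=
        ⟨hs.rigid_stemExt fun i _ => hu.1.2 i, fun i hi => by
          rw [stemExt_lt u (by omega), hu.2 i hi]⟩
      obtain ⟨g, hg, hPg⟩ := hD k hk (stemExt m k u ∘ f) (hr.comp hf)
      obtain ⟨g', hg', h⟩ := hs.comp_left hg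
      refine ⟨g', hg', fun u' hu'τ _ _ _ => ?_⟩
      have : stemExt m k u' = stemExt m k u := by
        funext i
        by_cases hi : i < m
        · rw [stemExt_lt _ hi, stemExt_lt _ hi, huτ i hi, hu'τ i hi]
        · rw [stemExt_ge _ (by omega), stemExt_ge _ (by omega)]
      simp only
      rw [this, ← Function.comp_assoc, h]
      exact hPg
    · exact ⟨_, RigidFix.id m, fun u h1 h2 h3 h4 => (hex ⟨u, h1, h2, h3, h4⟩).elim⟩

/-- Fusion: properties `P k` that are persistent and dense hold simultaneously at all levels
below a single element. -/
theorem fusion {P : ℕ → (ℕ → ℕ) → Prop} {k₀ : ℕ} (hk₀ : 1 ≤ k₀)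
    (hP : ∀ k, k₀ ≤ k → Persists k (P k)) (hD : ∀ k, k₀ ≤ k → DenseBelow k₀ k (P k)) :
    ∃ h, RigidFix k₀ h ∧ ∀ k, k₀ ≤ k → ∀ u, RigidFix k₀ u → P k (u ∘ h) := by
  have hstep : ∀ n (f : {f // RigidFix k₀ f}), ∃ g, RigidFix (k₀ + n) g ∧
      ∀ k u, k₀ ≤ k → k ≤ k₀ + n → RigidFix k₀ u → IsStem (k₀ + n) k u →
        P k (stemExt (k₀ + n) k u ∘ g ∘ f) := fun n f =>
    denseBelow_stems (Nat.le_add_right k₀ n) hP hD f.1 f.2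
  choose G hG hGP using hstep
  let F : ℕ → {f // RigidFix k₀ f} := fun n => Nat.rec ⟨fun i => i, RigidFix.id k₀⟩
    (fun n f => ⟨G n f ∘ f.1, ((hG n f).mono (Nat.le_add_right _ _)).comp f.2⟩) n
  have F_succ : ∀ n i, (F (n + 1)).1 i = G n (F n) ((F n).1 i) := fun n i => rfl
  have F_fix : ∀ n i d, (F n).1 i < k₀ + n → (F (n + d)).1 i = (F n).1 i := by
    intro n i d hi
    induction d with
    | zero => rfl
    | succ d ih =>
      rw [← add_assoc, F_succ, (hG _ _).2 _ (by omega), ih]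
  have F_ker : ∀ n i j d, (F n).1 i = (F n).1 j → (F (n + d)).1 i = (F (n + d)).1 j := by
    intro n i j d hij
    induction d with
    | zero => exact hij
    | succ d ih => rw [← add_assoc, F_succ, F_succ, ih]
  let h : ℕ → ℕ := fun i => (F i).1 i
  have h_eq : ∀ n i, i ≤ n → h i = (F n).1 i := by
    intro n i hin
    obtain ⟨d, rfl⟩ := Nat.exists_eq_add_of_le hin
    have := (F i).2.1.le i
    exact (F_fix i i d (by omega)).symm
  have h_rigid : Rigid h := by
    refine ⟨fun v => ?_, fun i v hv => ?_⟩
    · obtain ⟨i, hi⟩ := (F v).2.1.1 v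
      refine ⟨i, ?_⟩
      rw [h_eq (v + i) i (by omega), F_fix v i i (by omega), hi]
    · obtain ⟨j, hj, hjv⟩ := (F i).2.1.2 i v hv
      exact ⟨j, hj, by rw [h_eq i j hj.le, hjv]⟩
  have h_factor : ∀ n, ∃ H, RigidFix (k₀ + n) H ∧ h = H ∘ (F n).1 := by
    intro n
    refine Rigid.exists_factor (F n).2.1 h_rigid (fun i j hij => ?_) (fun i hi => ?_)
    · rw [h_eq (n + (i + j)) i (by omega), h_eq (n + (i + j)) j (by omega)]
      exact F_ker n i j _ hij
    · rw [h_eq (n + i) i (by omega), F_fix n i i hi]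
  refine ⟨h, ⟨h_rigid, fun i hi => ?_⟩, fun k hk u hu => ?_⟩
  · obtain ⟨H, hH, he⟩ := h_factor 0
    rw [he]
    exact hH.2 i hi
  · obtain ⟨m, hkm, hs⟩ := hu.1.exists_isStem (hk₀.trans hk)
    obtain ⟨n, rfl⟩ := Nat.exists_eq_add_of_le (hk.trans hkm)
    obtain ⟨v, hv, hveq⟩ := hs.factor hu.1
    obtain ⟨H, hH, hHeq⟩ := h_factor (n + 1)
    have hP1 : P k (stemExt (k₀ + n) k u ∘ (F (n + 1)).1) := hGP n (F n) k u hk hkm hu hs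
    obtain ⟨H', hH', hH'eq⟩ := hs.comp_right (hs.rigid_stemExt fun i _ => hu.1.2 i)
      (hH.mono (by omega : k₀ + n ≤ k₀ + (n + 1)))
    have : u ∘ h = v ∘ H' ∘ (stemExt (k₀ + n) k u ∘ (F (n + 1)).1) := by
      conv_lhs => rw [hveq, hHeq]
      rw [← Function.comp_assoc H', ← hH'eq]
      rfl
    rw [this]
    exact hP k hk _ _ hv (hP k hk _ _ hH' hP1)

section Words

open Filter

variable {α : Type}

/-- Substitute the letter `a` for the variable `none`. -/
def subst (a : α) (x : List (Option α)) : List α := x.map fun o => o.getD a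

theorem subst_append (a : α) (x y : List (Option α)) :
    subst a (x ++ y) = subst a x ++ subst a y := List.map_append

attribute [local instance] Ultrafilter.semigroup Ultrafilter.mul

/-- Ultrafilters on variable words all of whose substitutions agree. -/
def coherentUltrafilters (α : Type) : Set (Ultrafilter (FreeMonoid (Option α))) :=
  {U | (∀ᶠ x in (U : Filter (FreeMonoid (Option α))), none ∈ FreeMonoid.toList x) ∧
    ∀ (p : List α → Prop) (a b : α), (∀ᶠ x in ↑U, p (subst a (FreeMonoid.toList x))) →
      ∀ᶠ x in ↑U, p (subst b (FreeMonoid.toList x))}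

theorem isClosed_coherentUltrafilters : IsClosed (coherentUltrafilters α) := by
  have h : coherentUltrafilters α = {U | {x | none ∈ FreeMonoid.toList x} ∈ U} ∩
      ⋂ (p : List α → Prop) (a : α) (b : α),
        ({U : Ultrafilter (FreeMonoid (Option α)) | {x | p (subst a x.toList)}ᶜ ∈ U} ∪
          {U | {x | p (subst b x.toList)} ∈ U}) := by
    ext U
    simp only [coherentUltrafilters, Set.mem_ofPred_eq, Set.mem_inter_iff, Set.mem_iInter,
      Set.mem_union, Ultrafilter.compl_mem_iff_notMem, ← imp_iff_not_or]
    rfl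
  rw [h]
  exact (ultrafilter_isClosed_basic _).inter (isClosed_iInter fun p => isClosed_iInter fun a =>
    isClosed_iInter fun b => (ultrafilter_isClosed_basic _).union (ultrafilter_isClosed_basic _))

theorem mul_mem_coherentUltrafilters {U V : Ultrafilter (FreeMonoid (Option α))}
    (hU : U ∈ coherentUltrafilters α) (hV : V ∈ coherentUltrafilters α) :
    U * V ∈ coherentUltrafilters α := by
  refine ⟨?_, fun p a b h => ?_⟩
  · rw [Ultrafilter.eventually_mul]
    filter_upwards [hU.1] with x hx
    filter_upwards with y
    simp [hx]
  · rw [Ultrafilter.eventually_mul] at h ⊢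
    simp only [FreeMonoid.toList_mul, subst_append] at h ⊢
    refine hU.2 (fun w => ∀ᶠ y in (V : Filter (FreeMonoid (Option α))),
      p (w ++ subst b y.toList)) a b ?_
    filter_upwards [h] with x hx
    exact hV.2 (fun w => p (subst a x.toList ++ w)) a b hx

theorem coherentUltrafilters_nonempty [Finite α] [Nonempty α] :
    (coherentUltrafilters α).Nonempty := by
  let K : (List α → Prop) → Set (FreeMonoid (Option α)) := fun p =>
    {x | none ∈ x.toList ∧ ∀ a b, p (subst a x.toList) → p (subst b x.toList)}
  have hne : (generate (Set.range K)).NeBot := by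
    rw [generate_neBot_iff]
    intro t ht htfin
    have ht' : ∀ S : t, ∃ p, K p = S := fun S => ht S.2
    choose P hP using ht'
    have : Finite t := htfin
    obtain ⟨ι, _, hι⟩ := Combinatorics.Line.exists_mono_in_high_dimension α (t → Prop)
    let word : (ι → α) → List α := fun y => Finset.univ.toList.map y
    obtain ⟨l, e, hl⟩ := hι fun y S => P S (word y)
    refine ⟨FreeMonoid.ofList (Finset.univ.toList.map l.idxFun), fun S hS => ?_⟩
    have hsub : ∀ a, subst a (Finset.univ.toList.map l.idxFun) = word (l a) := fun a => by
      simp [subst, word, Combinatorics.Line.apply_def, Function.comp_def]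
    refine (hP ⟨S, hS⟩).subset ⟨?_, fun a b hab => ?_⟩
    · obtain ⟨i, hi⟩ := l.proper
      exact List.mem_map.2 ⟨i, by simp, hi⟩
    · simp only [FreeMonoid.toList_ofList, hsub] at hab ⊢
      have h1 := congrFun (hl a) ⟨S, hS⟩
      have h2 := congrFun (hl b) ⟨S, hS⟩
      simp only at h1 h2
      rw [h2, ← h1]
      exact hab
  obtain ⟨U, hU⟩ := (generate (Set.range K)).exists_ultrafilter_le
  have hK : ∀ p, K p ∈ U := fun p => hU (mem_generate_of_mem ⟨p, rfl⟩)
  refine ⟨U, mem_of_superset (hK fun _ => True) fun x hx => hx.1, fun p a b h => ?_⟩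
  filter_upwards [h, hK p] with x hx hxK
  exact hxK.2 a b hx

/-- The constant part of a variable word preceding the first occurrence of the variable. -/
def constInit : List (Option α) → List α
  | [] => []
  | none :: _ => []
  | some a :: x => a :: constInit x

theorem exists_constInit {x : List (Option α)} (hx : none ∈ x) :
    ∃ q, x = (constInit x).map some ++ none :: q := by
  induction x with
  | nil => simp at hx
  | cons o x ih =>
    cases o with
    | none => exact ⟨x, rfl⟩
    | some a =>
      obtain ⟨q, hq⟩ := ih (by simpa using hx)
      exact ⟨q, by simpa [constInit] using hq⟩

theorem exists_idempotent_ultrafilter [Finite α] [Nonempty α] :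
    ∃ U : Ultrafilter (List (Option α)), (∀ᶠ x in (U : Filter (List (Option α))), none ∈ x) ∧
      (∀ (p : List α → Prop) (a b : α),
        (∀ᶠ x in ↑U, p (subst a x)) → ∀ᶠ x in ↑U, p (subst b x)) ∧
      ∀ p : List (Option α) → Prop, (∀ᶠ x in ↑U, p x) → ∀ᶠ x in ↑U, ∀ᶠ y in ↑U, p (x ++ y) := by
  obtain ⟨U, hU, hidem⟩ := exists_idempotent_in_compact_subsemigroup
    (Ultrafilter.continuous_mul_left (M := FreeMonoid (Option α))) (coherentUltrafilters α)
    coherentUltrafilters_nonempty isClosed_coherentUltrafilters.isCompact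
    (fun _ hU _ hV => mul_mem_coherentUltrafilters hU hV)
  refine ⟨U, hU.1, hU.2, fun p hp => ?_⟩
  have hp' : ∀ᶠ x in (U : Filter (FreeMonoid (Option α))), p x.toList := hp
  rw [← hidem] at hp'
  exact (Ultrafilter.eventually_mul U U _).1 hp'

/-- The inductive step in the construction of a homogeneous sequence of variable words. -/
theorem exists_homogeneous_step [Finite α] [Nonempty α] (c : List α → Prop) :
    ∃ (A B : List α → Prop), ((∀ w, A w → c w) ∨ ∀ w, A w → ¬ c w) ∧ (∃ w, B w) ∧
      ∀ F : Set (List α), F.Finite → (∀ w ∈ F, B w) →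
        ∃ (p : List α) (q : List (Option α)), ∀ w ∈ F, A (w ++ p) ∧
          ∀ a, B (w ++ (p ++ a :: subst a q)) := by
  obtain ⟨U, hvar, hcoh, hidem⟩ := exists_idempotent_ultrafilter (α := α)
  obtain ⟨a₀⟩ := ‹Nonempty α›
  obtain ⟨A, hAc, hA⟩ : ∃ A : List α → Prop, ((∀ w, A w → c w) ∨ ∀ w, A w → ¬ c w) ∧
      ∀ᶠ y in ↑U, ∀ᶠ x in ↑U, A (subst a₀ y ++ constInit x) := by
    by_cases h : ∀ᶠ y in ↑U, ∀ᶠ x in ↑U, c (subst a₀ y ++ constInit x)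
    · exact ⟨c, Or.inl fun _ => id, h⟩
    · rw [← Ultrafilter.eventually_not] at h
      simp only [← Ultrafilter.eventually_not] at h
      exact ⟨fun w => ¬ c w, Or.inr fun _ => id, h⟩
  let D : List α → Prop := fun w => ∀ᶠ x in ↑U, A (w ++ constInit x)
  refine ⟨A, fun w => D w ∧ ∀ᶠ y in ↑U, D (w ++ subst a₀ y), hAc, ?_, fun F hF hFB => ?_⟩
  · have h2 := hidem (fun y => D (subst a₀ y)) hA
    obtain ⟨y, hy, hy2⟩ := (hA.and h2).exists
    exact ⟨subst a₀ y, hy, by simpa only [subst_append] using hy2⟩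
  · have hev : ∀ᶠ x in ↑U, ∀ w ∈ F, A (w ++ constInit x) ∧ ∀ a, D (w ++ subst a x) ∧
        ∀ᶠ y in ↑U, D (w ++ subst a x ++ subst a₀ y) := by
      rw [eventually_all_finite hF]
      intro w hw
      obtain ⟨h1, h2⟩ := hFB w hw
      refine h1.and (eventually_all.2 fun a => ?_)
      refine (hcoh (fun z => D (w ++ z)) a₀ a h2).and
        (hcoh (fun z => ∀ᶠ y in ↑U, D (w ++ z ++ subst a₀ y)) a₀ a ?_)
      simpa only [subst_append, List.append_assoc] using hidem (fun y => D (w ++ subst a₀ y)) h2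
    obtain ⟨x, hx, hxv⟩ := (hev.and hvar).exists
    obtain ⟨q, hq⟩ := exists_constInit hxv
    refine ⟨constInit x, q, fun w hw => ⟨(hx w hw).1, fun a => ?_⟩⟩
    have hs : subst a x = constInit x ++ a :: subst a q := by
      conv_lhs => rw [hq]
      simp [subst, Function.comp_def]
    rw [← hs]
    exact (hx w hw).2 a

end Words

/-- The rigid surjection with initial word `0, …, k - 1` followed by `w`, and then the fresh
values `k, k + 1, …`. -/
def wordExt (k : ℕ) (w : List (Fin k)) : ℕ → ℕ :=
  stemExt (k + w.length) k fun i => (List.range k ++ w.map Fin.val).getD i 0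

theorem getD_range_append_lt {k i : ℕ} (l : List ℕ) (hi : i < k) :
    (List.range k ++ l).getD i 0 = i := by
  rw [List.getD_append _ _ _ _ (by simpa using hi)]
  simp [hi]

theorem rigidFix_wordExt (k : ℕ) (w : List (Fin k)) : RigidFix k (wordExt k w) := by
  have hlt : ∀ i < k + w.length, (List.range k ++ w.map Fin.val).getD i 0 < k := by
    intro i hi
    have hi' : i < (List.range k ++ w.map Fin.val).length := by simpa using hi
    rw [List.getD_eq_getElem _ _ hi']
    have := List.getElem_mem hi'
    simp only [List.mem_append, List.mem_range, List.mem_map] at this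
    rcases this with h | ⟨a, -, ha⟩
    · exact h
    · rw [← ha]; exact a.2
  have hs : IsStem (k + w.length) k fun i => (List.range k ++ w.map Fin.val).getD i 0 :=
    ⟨hlt, fun v hv => ⟨v, by omega, getD_range_append_lt _ hv⟩⟩
  refine ⟨hs.rigid_stemExt fun i hi v hv => ?_, fun i hi => ?_⟩
  · by_cases h : i < k
    · rw [getD_range_append_lt _ h] at hv
      exact ⟨v, hv, getD_range_append_lt _ (by omega)⟩
    · have := hlt i hi
      exact ⟨v, by omega, getD_range_append_lt _ (by omega)⟩
  · rw [wordExt, stemExt_lt _ (by omega)]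
    exact getD_range_append_lt _ hi

theorem wordExt_factor {k : ℕ} {w : List (Fin k)} {y : ℕ → ℕ} (hy : RigidFix k y)
    (hw : ∀ i < k + w.length, y i = (List.range k ++ w.map Fin.val).getD i 0)
    (hk : y (k + w.length) = k) : ∃ v, RigidFix (k + 1) v ∧ y = v ∘ wordExt k w := by
  have heq : stemExt (k + w.length + 1) (k + 1) y = wordExt k w := by
    funext i
    unfold wordExt
    rcases lt_trichotomy i (k + w.length) with h | rfl | h
    · rw [stemExt_lt _ (by omega), stemExt_lt _ h, hw i h]
    · rw [stemExt_lt _ (by omega), stemExt_ge _ le_rfl, hk]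
      omega
    · rw [stemExt_ge _ (by omega), stemExt_ge _ (by omega)]
      omega
  have hs : IsStem (k + w.length + 1) (k + 1) y := by
    refine ⟨fun i hi => ?_, fun v hv => ?_⟩
    · rcases Nat.lt_succ_iff_lt_or_eq.1 hi with h | rfl
      · by_contra! hle
        obtain ⟨j, hj, hjk⟩ := hy.1.2 i k (by omega)
        have h1 := hw j (by omega)
        have hj' : j < (List.range k ++ w.map Fin.val).length := by simp; omega
        rw [List.getD_eq_getElem _ _ hj'] at h1
        have := List.getElem_mem hj'
        rw [← h1, hjk] at this
        simp only [List.mem_append, List.mem_range, List.mem_map] at this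
        rcases this with h | ⟨a, -, ha⟩
        · omega
        · have := a.2
          omega
      · omega
    · by_cases h : v < k
      · exact ⟨v, by omega, hy.2 v h⟩
      · exact ⟨k + w.length, by omega, by omega⟩
  rw [← heq]
  exact hs.factor hy.1

/-- The word obtained by writing `n` for the variable in `p ⌢ none ⌢ q`. -/
def varBlock {k : ℕ} (n : ℕ) (p : List (Fin k)) (q : List (Option (Fin k))) : List ℕ :=
  p.map Fin.val ++ n :: q.map fun o => o.elim n Fin.val

/-- The Carlson–Simpson lemma: a colouring of finite words over `k` letters is constant
on the words that are read off before the first occurrence of a new letter, below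
a suitable element. -/
theorem pigeonhole {k : ℕ} (hk : 1 ≤ k) {C : (ℕ → ℕ) → Prop}
    (hC : ∀ u, RigidFix k u → ∀ w, RigidFix (k + 1) w → (C (w ∘ u) ↔ C u)) :
    ∃ h, RigidFix k h ∧
      ((∀ u, RigidFix k u → C (u ∘ h)) ∨ ∀ u, RigidFix k u → ¬ C (u ∘ h)) := by
  have : Nonempty (Fin k) := ⟨⟨0, hk⟩⟩
  obtain ⟨A, B, hAc, ⟨w₀, hw₀⟩, hstep⟩ := exists_homogeneous_step fun w => C (wordExt k w)
  let Inv : ℕ → List ℕ → Prop := fun n M => (∀ i ∈ M, i < k + n) ∧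
    ∀ ρ : ℕ → Fin k, (∀ a : Fin k, ρ a = a) → B (M.map ρ)
  have hnext : ∀ n M, Inv n M → ∃ (p : List (Fin k)) (q : List (Option (Fin k))),
      (∀ ρ : ℕ → Fin k, (∀ a : Fin k, ρ a = a) → A (M.map ρ ++ p)) ∧
        Inv (n + 1) (M ++ varBlock (k + n) p q) := by
    rintro n M ⟨hM, hB⟩
    have hfin : {w : List (Fin k) | ∃ ρ : ℕ → Fin k, (∀ a : Fin k, ρ a = a) ∧
        w = M.map ρ}.Finite := by
      refine (List.finite_length_eq (Fin k) M.length).subset ?_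
      rintro w ⟨ρ, -, rfl⟩
      simp
    obtain ⟨p, q, hpq⟩ := hstep _ hfin (by rintro w ⟨ρ, hρ, rfl⟩; exact hB ρ hρ)
    refine ⟨p, q, fun ρ hρ => (hpq _ ⟨ρ, hρ, rfl⟩).1, fun i hi => ?_, fun ρ hρ => ?_⟩
    · simp only [varBlock, List.mem_append, List.mem_map, List.mem_cons] at hi
      rcases hi with hi | ⟨a, -, rfl⟩ | rfl | ⟨o, -, rfl⟩
      · have := hM i hi
        omega
      · have := a.2
        omega
      · omega
      · cases o with
        | none => simp
        | some a => have := a.2; simp; omega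
    · have h1 : (p.map Fin.val).map ρ = p := by
        rw [List.map_map]
        exact (List.map_congr_left fun a _ => hρ a).trans (List.map_id p)
      have h2 : (q.map fun o => o.elim (k + n) Fin.val).map ρ = subst (ρ (k + n)) q := by
        rw [List.map_map]
        refine List.map_congr_left fun o _ => ?_
        cases o with
        | none => rfl
        | some a => exact hρ a
      rw [varBlock, List.map_append, List.map_append, List.map_cons, h1, h2]
      exact (hpq _ ⟨ρ, hρ, rfl⟩).2 _
  choose! p q hA hI using hnext
  let M : ℕ → List ℕ := fun n => Nat.rec (w₀.map Fin.val)
    (fun n M => M ++ varBlock (k + n) (p n M) (q n M)) n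
  have M_inv : ∀ n, Inv n (M n) := by
    intro n
    induction n with
    | zero =>
      refine ⟨fun i hi => ?_, fun ρ hρ => ?_⟩
      · obtain ⟨a, -, rfl⟩ := List.mem_map.1 hi
        exact a.2
      · have : (M 0).map ρ = w₀ := by
          change (w₀.map Fin.val).map ρ = w₀
          rw [List.map_map]
          exact (List.map_congr_left fun a _ => hρ a).trans (List.map_id w₀)
        rw [this]
        exact hw₀
    | succ n ih => exact hI n (M n) ih
  let P : ℕ → List ℕ := fun n => List.range k ++ M n ++ (p n (M n)).map Fin.val
  have L_succ : ∀ n, ∃ r, List.range k ++ M (n + 1) = P n ++ (k + n) :: r := fun n =>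
    ⟨_, by simp only [M, P, varBlock, List.append_assoc]; rfl⟩
  have L_mono : ∀ n d, (List.range k ++ M n) <+: (List.range k ++ M (n + d)) := by
    intro n d
    induction d with
    | zero => exact List.prefix_rfl
    | succ d ih =>
      obtain ⟨r, hr⟩ := L_succ (n + d)
      refine ih.trans ?_
      rw [← add_assoc, hr]
      exact ⟨(p (n + d) (M (n + d))).map Fin.val ++ (k + (n + d)) :: r,
        by simp only [P, List.append_assoc]⟩
  have L_len : ∀ n, k + n ≤ (List.range k ++ M n).length := by
    intro n
    induction n with
    | zero => simp
    | succ n ih =>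
      obtain ⟨r, hr⟩ := L_succ n
      rw [hr]
      simp only [P, List.length_append, List.length_cons] at ih ⊢
      omega
  let h : ℕ → ℕ := fun i => (List.range k ++ M (i + 1)).getD i 0
  have h_eq : ∀ n i, i < (List.range k ++ M n).length →
      h i = (List.range k ++ M n).getD i 0 := by
    intro n i hi
    have hi' : i < (List.range k ++ M (i + 1)).length := by have := L_len (i + 1); omega
    obtain ⟨r, hr⟩ := L_mono n (i + 1)
    obtain ⟨r', hr'⟩ := L_mono (i + 1) n
    have e1 := List.getD_append _ r 0 i hi
    have e2 := List.getD_append _ r' 0 i hi'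
    rw [hr] at e1
    rw [hr', add_comm] at e2
    exact e2.symm.trans e1
  have h_P : ∀ n i, i < (P n).length → h i = (P n).getD i 0 := by
    intro n i hi
    obtain ⟨r, hr⟩ := L_succ n
    rw [h_eq (n + 1) i (by rw [hr, List.length_append]; omega), hr, List.getD_append _ _ _ _ hi]
  have h_new : ∀ n, h (P n).length = k + n := by
    intro n
    obtain ⟨r, hr⟩ := L_succ n
    have hlen : (P n ++ (k + n) :: r).length = (P n).length + (r.length + 1) := by
      rw [List.length_append, List.length_cons]
    rw [h_eq (n + 1) _ (by rw [hr, hlen]; omega), hr,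
      List.getD_append_right _ _ _ _ le_rfl]
    simp
  have h_lt : ∀ n i, i < (P n).length → h i < k + n := by
    intro n i hi
    rw [h_P n i hi, List.getD_eq_getElem _ _ hi]
    have := List.getElem_mem hi
    simp only [P, List.mem_append, List.mem_range, List.mem_map] at this
    rcases this with (h | h) | ⟨a, -, h⟩
    · simp only [P] at *
      omega
    · exact (M_inv n).1 _ h
    · simp only [P]
      rw [← h]
      have := a.2
      omega
  have h_fix : ∀ i < k, h i = i := fun i hi => getD_range_append_lt _ hi
  have h_rigid : RigidFix k h := by
    refine ⟨⟨fun v => ?_, fun i v hv => ?_⟩, h_fix⟩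
    · by_cases hvk : v < k
      · exact ⟨v, h_fix v hvk⟩
      · exact ⟨_, (h_new (v - k)).trans (by omega)⟩
    · by_cases hvk : v < k
      · refine ⟨v, ?_, h_fix v hvk⟩
        by_contra! hle
        rw [h_fix i (by omega)] at hv
        omega
      · refine ⟨(P (v - k)).length, ?_, (h_new (v - k)).trans (by omega)⟩
        by_contra! hle
        rcases hle.lt_or_eq with hlt | heq
        · have := h_lt (v - k) i hlt
          omega
        · have := h_new (v - k)
          rw [← heq] at this
          omega
  have key : ∀ u, RigidFix k u → ∃ w, A w ∧ (C (u ∘ h) ↔ C (wordExt k w)) := by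
    intro u hu
    classical
    have hex : ∃ j, u j = k := hu.1.1 k
    have hN : u (Nat.find hex) = k := Nat.find_spec hex
    have hmin := fun j => Nat.find_min (H := hex) (m := j)
    set N := Nat.find hex
    have hlt : ∀ i < N, u i < k := by
      intro i hi
      by_contra! hle
      rcases hle.lt_or_eq with hlt | heq
      · obtain ⟨j, hj, hjk⟩ := hu.1.2 i k hlt
        exact hmin j (hj.trans hi) hjk
      · exact hmin i hi heq.symm
    have hkN : k ≤ N := by
      by_contra! h'
      rw [hu.2 N h'] at hN
      omega
    obtain ⟨n, hn⟩ := Nat.exists_eq_add_of_le hkN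
    let ρ : ℕ → Fin k := fun i => if hi : u i < k then ⟨u i, hi⟩ else ⟨0, hk⟩
    have hρval : ∀ i, u i < k → (ρ i : ℕ) = u i := fun i hi => by simp [ρ, hi]
    have hρ : ∀ a : Fin k, ρ a = a := fun a => by
      have := hu.2 a a.2
      exact Fin.ext ((hρval a (by rw [this]; exact a.2)).trans this)
    let w := (M n).map ρ ++ p n (M n)
    have hPw : (P n).map u = List.range k ++ w.map Fin.val := by
      simp only [P, w, List.map_append, List.map_map, List.append_assoc]
      congr 1
      · exact (List.map_congr_left fun i hi => hu.2 i (List.mem_range.1 hi)).trans (List.map_id _)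
      congr 1
      · refine List.map_congr_left fun i hi => (hρval i (hlt i ?_)).symm
        rw [hn]
        exact (M_inv n).1 i hi
      · exact List.map_congr_left fun a _ => hu.2 a a.2
    have hlen : k + w.length = (P n).length := by
      have := congrArg List.length hPw
      simpa using this.symm
    obtain ⟨v, hv, hveq⟩ := wordExt_factor (w := w) (hu.comp h_rigid)
      (fun i hi => by
        rw [← hPw, Function.comp_apply, h_P n i (by omega)]
        conv_rhs => rw [show (0 : ℕ) = u 0 from (hu.1.zero).symm]
        rw [List.getD_map])
      (by rw [hlen, Function.comp_apply, h_new, ← hn, hN])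
    refine ⟨w, hA n (M n) (M_inv n) ρ hρ, ?_⟩
    rw [hveq]
    exact hC _ (rigidFix_wordExt k w) v hv
  refine ⟨h, h_rigid, hAc.imp (fun H u hu => ?_) (fun H u hu => ?_)⟩
  · obtain ⟨w, hw, hiff⟩ := key u hu
    exact hiff.2 (H w hw)
  · obtain ⟨w, hw, hiff⟩ := key u hu
    exact fun hc => H w hw (hiff.1 hc)

/-- Every property can be decided in a persistent way. -/
theorem decides {k₀ k : ℕ} {Q : (ℕ → ℕ) → Prop} (hQ : Persists k Q) :
    Persists k (fun f => Q f ∨ ∀ g, RigidFix k g → ¬ Q (g ∘ f)) ∧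
    DenseBelow k₀ k (fun f => Q f ∨ ∀ g, RigidFix k g → ¬ Q (g ∘ f)) := by
  constructor
  · rintro f g hg (h | h)
    · exact Or.inl (hQ f g hg h)
    · exact Or.inr fun g' hg' => h (g' ∘ g) (hg'.comp hg)
  · intro f _
    by_cases hex : ∃ g, RigidFix k g ∧ Q (g ∘ f)
    · obtain ⟨g, hg, h⟩ := hex
      exact ⟨g, hg, Or.inl h⟩
    · exact ⟨_, RigidFix.id k, Or.inr fun g hg h => hex ⟨g, hg, h⟩⟩

theorem decided_iff {k : ℕ} {Q : (ℕ → ℕ) → Prop} (hQ : Persists k Q) {f : ℕ → ℕ}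
    (hf : Q f ∨ ∀ g, RigidFix k g → ¬ Q (g ∘ f)) {g : ℕ → ℕ} (hg : RigidFix k g) :
    Q (g ∘ f) ↔ Q f :=
  ⟨fun h => hf.resolve_right fun h' => h' g hg h, hQ f g hg⟩

/-- The dual Ramsey theorem for sets that are open, in a form which
presents the open set by the set `T` of its stems. -/
theorem open_dichotomy {k₀ : ℕ} (hk₀ : 1 ≤ k₀) {T : ℕ → (ℕ → ℕ) → Prop}
    (hT : ∀ k, k₀ ≤ k → ∀ u, RigidFix k₀ u → ∀ v, RigidFix k v → (T k (v ∘ u) ↔ T k u)) :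
    ∃ h, RigidFix k₀ h ∧ ((∀ u, RigidFix k₀ u → ∃ k, k₀ ≤ k ∧ T k (u ∘ h)) ∨
      ∀ u, RigidFix k₀ u → ∀ k, k₀ ≤ k → ¬ T k (u ∘ h)) := by
  let Good : ℕ → (ℕ → ℕ) → Prop := fun k f =>
    ∀ g, RigidFix k g → ∃ l, k₀ ≤ l ∧ T l (g ∘ f)
  have hGood : ∀ k, Persists k (Good k) := fun k f g hg h g' hg' => h (g' ∘ g) (hg'.comp hg)
  obtain ⟨f, hf, hdec⟩ := fusion hk₀ (fun k _ => (decides (k₀ := k₀) (hGood k)).1)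
    (fun k _ => (decides (k₀ := k₀) (hGood k)).2)
  have hiff : ∀ k, k₀ ≤ k → ∀ u, RigidFix k₀ u → ∀ v, RigidFix k v →
      (Good k (v ∘ u ∘ f) ↔ Good k (u ∘ f)) := fun k hk u hu v hv =>
    decided_iff (hGood k) (hdec k hk u hu) hv
  by_cases h0 : Good k₀ f
  · exact ⟨f, hf, Or.inl h0⟩
  have hPers : ∀ k, k₀ ≤ k → Persists k (fun u => Good k (u ∘ f) ∨
      ∀ v, RigidFix k v → ¬ Good (k + 1) (v ∘ u ∘ f)) := by
    rintro k hk u g hg (h | h)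
    · exact Or.inl (hGood k (u ∘ f) g hg h)
    · exact Or.inr fun v hv => h (v ∘ g) (hv.comp hg)
  have hDense : ∀ k, k₀ ≤ k → DenseBelow k₀ k (fun u => Good k (u ∘ f) ∨
      ∀ v, RigidFix k v → ¬ Good (k + 1) (v ∘ u ∘ f)) := by
    intro k hk u hu
    obtain ⟨h, hh, h1 | h1⟩ := pigeonhole (hk₀.trans hk)
      (C := fun v => Good (k + 1) (v ∘ u ∘ f)) (fun v hv w hw =>
        hiff (k + 1) (by omega) (v ∘ u) ((hv.mono hk).comp hu) w hw)
    · exact ⟨h, hh, Or.inl fun g hg => h1 g hg _ (RigidFix.id _)⟩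
    · exact ⟨h, hh, Or.inr h1⟩
  obtain ⟨h, hh, hbad⟩ := fusion hk₀ hPers hDense
  have key : ∀ k, k₀ ≤ k → ∀ u, RigidFix k₀ u → ¬ Good k (u ∘ h ∘ f) := by
    intro k hk
    induction k, hk using Nat.le_induction with
    | base =>
      intro u hu hg
      exact h0 ((hiff k₀ le_rfl _ (RigidFix.id k₀) (u ∘ h) (hu.comp hh)).1 hg)
    | succ k hk ih =>
      intro u hu hg
      exact ((hbad k hk u hu).resolve_left (ih u hu)) _ (RigidFix.id k) hg
  refine ⟨h ∘ f, hh.comp hf, Or.inr fun u hu k hk hTk => key k hk u hu fun g hg => ?_⟩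
  exact ⟨k, hk, (hT k hk _ (hu.comp (hh.comp hf)) g hg).2 hTk⟩

/-- The dual Ramsey theorem for the result of the Souslin operation: below some `h`, either
`C []` is avoided, or every element is a limit of elements of `C` along some branch. -/
theorem souslin_dichotomy {k₀ : ℕ} (hk₀ : 1 ≤ k₀) {C : List ℕ → Set (ℕ → ℕ)}
    (hC : ∀ σ, ∀ y ∈ C σ, ∃ i, y ∈ C (σ ++ [i])) :
    ∃ h, RigidFix k₀ h ∧ ((∀ u, RigidFix k₀ u → u ∘ h ∉ C []) ∨
      ∀ u, RigidFix k₀ u → ∃ x : ℕ → ℕ, ∀ n, ∃ g, RigidFix n g ∧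
        g ∘ u ∘ h ∈ C ((List.range n).map x)) := by
  let Null : List ℕ → ℕ → (ℕ → ℕ) → Prop := fun σ k f => ∀ g, RigidFix k g → g ∘ f ∉ C σ
  have hNull : ∀ σ k, Persists k (Null σ k) := fun σ k f g hg h g' hg' =>
    h (g' ∘ g) (hg'.comp hg)
  have hfin : ∀ k : ℕ, Finite {σ : List ℕ // Encodable.encode σ ≤ k} := fun k =>
    Set.Finite.to_subtype ((Set.finite_Iic k).preimage Encodable.encode_injective.injOn)
  obtain ⟨f, hf, hdec⟩ := fusion hk₀ (P := fun k f =>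
      ∀ σ : {σ : List ℕ // Encodable.encode σ ≤ k},
        Null σ k f ∨ ∀ g, RigidFix k g → ¬ Null σ k (g ∘ f))
    (fun k _ f g hg h σ => (decides (k₀ := k₀) (hNull σ k)).1 f g hg (h σ))
    (fun k hk => DenseBelow.forall_finite hk (fun σ => (decides (k₀ := k₀) (hNull σ k)).1)
      (fun σ => (decides (hNull σ k)).2))
  have hiff : ∀ σ k, k₀ ≤ k → Encodable.encode σ ≤ k → ∀ u, RigidFix k₀ u → ∀ v, RigidFix k v →
      (Null σ k (v ∘ u ∘ f) ↔ Null σ k (u ∘ f)) := fun σ k hk hσ u hu v hv =>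
    decided_iff (hNull σ k) (hdec k hk u hu ⟨σ, hσ⟩) hv
  by_cases h0 : Null [] k₀ f
  · exact ⟨f, hf, Or.inl h0⟩
  let Splits : List ℕ → ℕ → (ℕ → ℕ) → Prop := fun σ k u =>
    ∃ l, k < l ∧ ∃ i, Encodable.encode (σ ++ [i]) ≤ l ∧ ¬ Null (σ ++ [i]) l (u ∘ f)
  have hPers : ∀ σ k, Persists k (fun u => Null σ k (u ∘ f) ∨
      ∀ v, RigidFix k v → Splits σ k (v ∘ u)) := by
    rintro σ k u g hg (h | h)
    · exact Or.inl (hNull σ k (u ∘ f) g hg h)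
    · exact Or.inr fun v hv => h (v ∘ g) (hv.comp hg)
  have hDense : ∀ σ k, k₀ ≤ k → DenseBelow k₀ k (fun u => Null σ k (u ∘ f) ∨
      ∀ v, RigidFix k v → Splits σ k (v ∘ u)) := by
    intro σ k hk u hu
    obtain ⟨h, hh, h1 | h1⟩ := open_dichotomy (hk₀.trans hk) (T := fun l v => k < l ∧
        ∃ i, Encodable.encode (σ ++ [i]) ≤ l ∧ ¬ Null (σ ++ [i]) l (v ∘ u ∘ f)) (by
      intro l hl v hv w hw
      refine and_congr_right fun _ => exists_congr fun i => and_congr_right fun hi => not_congr ?_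
      exact hiff _ l (hk.trans hl) hi (v ∘ u) ((hv.mono hk).comp hu) w hw)
    · refine ⟨h, hh, Or.inr fun v hv => ?_⟩
      obtain ⟨l, _, hl⟩ := h1 v hv
      exact ⟨l, hl⟩
    · refine ⟨h, hh, Or.inl fun v hv hmem => ?_⟩
      obtain ⟨i, hi⟩ := hC σ _ hmem
      refine h1 v hv (k + 1 + Encodable.encode (σ ++ [i])) (by omega)
        ⟨by omega, i, by omega, fun hn => hn _ (RigidFix.id _) hi⟩
  obtain ⟨h, hh, hsplit⟩ := fusion hk₀ (P := fun k u =>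
      ∀ σ : {σ : List ℕ // Encodable.encode σ ≤ k}, Null σ k (u ∘ f) ∨
        ∀ v, RigidFix k v → Splits σ k (v ∘ u))
    (fun k _ f g hg h σ => hPers σ k f g hg (h σ))
    (fun k hk => DenseBelow.forall_finite hk (fun σ => hPers σ k) (fun σ => hDense σ k hk))
  refine ⟨h ∘ f, hh.comp hf, Or.inr fun u hu => ?_⟩
  let State := {p : List ℕ × ℕ // k₀ ≤ p.2 ∧ Encodable.encode p.1 ≤ p.2 ∧
    ¬ Null p.1 p.2 (u ∘ h ∘ f)}
  have hnext : ∀ p : State, ∃ i : ℕ, ∃ q : State, q.1.1 = p.1.1 ++ [i] ∧ p.1.2 < q.1.2 := by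
    rintro ⟨⟨σ, k⟩, hk, hσ, hn⟩
    obtain ⟨l, hkl, i, hi, hl⟩ :=
      ((hsplit k hk u hu ⟨σ, hσ⟩).resolve_left hn) _ (RigidFix.id k)
    exact ⟨i, ⟨(σ ++ [i], l), (hk.trans hkl.le), hi, hl⟩, rfl, hkl⟩
  choose I N hN hlt using hnext
  have hstart : ¬ Null [] k₀ (u ∘ h ∘ f) := fun hn => h0
    ((hiff [] k₀ le_rfl (by simp) _ (RigidFix.id k₀) (u ∘ h) (hu.comp hh)).1 hn)
  let S : ℕ → State := fun n => N^[n] ⟨([], k₀), le_rfl, by simp, hstart⟩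
  have S_succ : ∀ n, S (n + 1) = N (S n) := fun n => Function.iterate_succ_apply' N n _
  have S_fst : ∀ n, (S n).1.1 = (List.range n).map fun i => I (S i) := by
    intro n
    induction n with
    | zero => rfl
    | succ n ih => rw [S_succ, hN, ih, List.range_succ, List.map_append]; rfl
  have S_snd : ∀ n, n ≤ (S n).1.2 := by
    intro n
    induction n with
    | zero => exact Nat.zero_le _
    | succ n ih => rw [S_succ]; exact Nat.lt_of_le_of_lt ih (hlt _)
  refine ⟨fun i => I (S i), fun n => ?_⟩
  have := (S n).2.2.2
  simp only [Null, not_forall, not_not] at this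
  obtain ⟨g, hg, hmem⟩ := this
  exact ⟨g, hg.mono (S_snd n), by rw [← S_fst]; exact hmem⟩

/-- The partition of `ℕ` into the fibres of `f`. -/
def fibres (f : ℕ → ℕ) : Set (Set ℕ) :=
  Set.range fun v => f ⁻¹' {v}

theorem sameBlock_fibres {f : ℕ → ℕ} {i j : ℕ} : sameBlock (fibres f) i j ↔ f i = f j := by
  constructor
  · rintro ⟨_, ⟨v, rfl⟩, hi, hj⟩
    exact Eq.trans hi (Eq.symm hj)
  · intro h
    exact ⟨_, ⟨f j, rfl⟩, h, rfl⟩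

theorem Rigid.infPart_fibres {f : ℕ → ℕ} (hf : Rigid f) : InfPart (fibres f) := by
  refine ⟨⟨?_, ?_⟩, ?_, ?_⟩
  · rintro _ ⟨v, rfl⟩
    exact hf.1 v
  · rintro _ ⟨v, rfl⟩ _ ⟨w, rfl⟩ hne
    rw [Set.disjoint_left]
    intro i hi hi'
    obtain rfl : f i = v := hi
    obtain rfl : f i = w := hi'
    exact hne rfl
  · exact Set.eq_univ_of_forall fun i => ⟨_, ⟨f i, rfl⟩, rfl⟩
  · exact Set.infinite_range_of_injective
      ((Set.preimage_injective.2 hf.1).comp Set.singleton_injective)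

theorem IsPartition.eq_of_mem {X : Set (Set ℕ)} (hX : IsPartition X) {p q : Set ℕ} {i : ℕ}
    (hp : p ∈ X) (hq : q ∈ X) (hip : i ∈ p) (hiq : i ∈ q) : p = q := by
  by_contra hne
  exact Set.disjoint_left.1 (hX.2 p hp q hq hne) hip hiq

/-- Every partition of `ℕ` into infinitely many blocks is the partition into the fibres of
a rigid surjection. -/
theorem InfPart.exists_rigid {X : Set (Set ℕ)} (hX : InfPart X) :
    ∃ f, Rigid f ∧ X = fibres f := by
  classical
  obtain ⟨hpart, hdom, hinf⟩ := hX
  have hcov : ∀ i, ∃ b ∈ X, i ∈ b := fun i => by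
    have : i ∈ pdom X := hdom ▸ Set.mem_univ i
    exact this
  choose b hbX hib using hcov
  have hb : ∀ {p i}, p ∈ X → i ∈ p → b i = p := fun hp hi =>
    hpart.eq_of_mem (hbX _) hp (hib _) hi
  let m : ℕ → ℕ := fun i => sInf (b i)
  have hm_mem : ∀ i, m i ∈ b i := fun i => Nat.sInf_mem ⟨i, hib i⟩
  have hbm : ∀ i, b (m i) = b i := fun i => hb (hbX i) (hm_mem i)
  have hmm : ∀ i, m (m i) = m i := fun i => congrArg sInf (hbm i)
  have hm_le : ∀ i, m i ≤ i := fun i => Nat.sInf_le (hib i)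
  let p : ℕ → Prop := fun i => m i = i
  have hp_inf : (Set.ofPred p).Infinite := by
    intro hfin
    refine hinf ((hfin.image b).subset fun q hq => ?_)
    obtain ⟨i, hi⟩ := hpart.1 q hq
    exact ⟨m i, hmm i, (hbm i).trans (hb hq hi)⟩
  let f : ℕ → ℕ := fun i => Nat.count p (m i)
  have hf : ∀ i j, f i = f j ↔ b i = b j := by
    intro i j
    refine ⟨fun h => ?_, fun h => by simp only [f, m, h]⟩
    rw [← hbm i, ← hbm j, Nat.count_injective (p := p) (hmm i) (hmm j) h]
  have hfn : ∀ v, f (Nat.nth p v) = v := fun v => by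
    have h1 : m (Nat.nth p v) = Nat.nth p v := Nat.nth_mem_of_infinite hp_inf v
    simp only [f, h1]
    exact Nat.count_nth_of_infinite hp_inf v
  refine ⟨f, ⟨fun v => ⟨_, hfn v⟩, fun i v hv => ⟨_, ?_, hfn v⟩⟩, ?_⟩
  · exact (Nat.nth_lt_of_lt_count hv).trans_le (hm_le i)
  · ext q
    constructor
    · intro hq
      obtain ⟨i, hi⟩ := hpart.1 q hq
      refine ⟨f i, ?_⟩
      ext j
      change f j = f i ↔ j ∈ q
      rw [hf, hb hq hi]
      exact ⟨fun h => h ▸ hib j, fun h => hb hq h⟩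
    · rintro ⟨v, rfl⟩
      have : f ⁻¹' {v} = b (Nat.nth p v) := by
        ext j
        change f j = v ↔ _
        conv_lhs => rw [← hfn v]
        rw [hf]
        exact ⟨fun h => h ▸ hib j, fun h => hb (hbX _) h⟩
      simp only [this]
      exact hbX _

theorem coarser_iff {Y X : Set (Set ℕ)} (hY : InfPart Y) (hX : InfPart X) :
    Coarser Y X ↔ ∀ i j, sameBlock X i j → sameBlock Y i j := by
  constructor
  · rintro h i j ⟨q, hq, hi, hj⟩
    have hiY : i ∈ pdom Y := hY.2.1 ▸ Set.mem_univ i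
    obtain ⟨p, hp, hip⟩ := hiY
    obtain ⟨S, hS, hpS⟩ := h p hp
    rw [hX.2.1, hY.2.1, Set.inter_univ] at hpS
    simp only [Set.inter_univ] at hpS
    have hip' := hip
    rw [hpS] at hip'
    obtain ⟨q', hq', hiq'⟩ := Set.mem_iUnion₂.1 hip'
    obtain rfl := hX.1.eq_of_mem (hS hq') hq hiq' hi
    refine ⟨p, hp, hip, ?_⟩
    rw [hpS]
    exact Set.mem_iUnion₂.2 ⟨q', hq', hj⟩
  · intro h p hp
    refine ⟨{q ∈ X | q ⊆ p}, fun q hq => hq.1, ?_⟩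
    rw [hX.2.1, hY.2.1, Set.inter_univ]
    simp only [Set.inter_univ]
    refine Set.Subset.antisymm (fun i hi => ?_) (Set.iUnion₂_subset fun q hq => hq.2)
    have hiX : i ∈ pdom X := hX.2.1 ▸ Set.mem_univ i
    obtain ⟨q, hq, hiq⟩ := hiX
    refine Set.mem_iUnion₂.2 ⟨q, ⟨hq, fun j hj => ?_⟩, hiq⟩
    obtain ⟨p', hp', hip', hjp'⟩ := h i j ⟨q, hq, hiq, hj⟩
    rwa [hY.1.eq_of_mem hp hp' hi hip']

/-- Rigid surjections with the same kernel on an initial segment agree there. -/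
theorem Rigid.eq_of_kernel {f z : ℕ → ℕ} (hf : Rigid f) (hz : Rigid z) {n : ℕ}
    (h : ∀ i < n, ∀ j < n, f i = f j ↔ z i = z j) : ∀ i < n, z i = f i := by
  intro i
  induction i using Nat.strong_induction_on with
  | _ i ih =>
    intro hi
    rcases lt_trichotomy (z i) (f i) with hlt | heq | hlt
    · obtain ⟨j, hj, hjz⟩ := hf.2 i _ hlt
      have hji := ih j hj (hj.trans hi)
      have := (h j (hj.trans hi) i hi).2 (hji.trans hjz)
      omega
    · exact heq
    · obtain ⟨j, hj, hjz⟩ := hz.2 i _ hlt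
      have hji := ih j hj (hj.trans hi)
      have := (h j (hj.trans hi) i hi).1 (hji.symm.trans hjz)
      omega

theorem segment_fibres_iff {s : Set (Set ℕ)} {n : ℕ} (hn : pdom s = Set.Iio n) {f z : ℕ → ℕ}
    (hf : Rigid f) (hz : Rigid z) (hsf : Segment s (fibres f)) :
    Segment s (fibres z) ↔ ∀ i < n, z i = f i := by
  have kernel : ∀ {f z : ℕ → ℕ}, Segment s (fibres f) → Segment s (fibres z) →
      ∀ i < n, ∀ j < n, f i = f j → z i = z j := by
    intro f z hf hz i hi j hj hij
    have his : i ∈ pdom s := hn ▸ hi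
    have hjs : j ∈ pdom s := hn ▸ hj
    obtain ⟨p, hp, hip⟩ := his
    obtain ⟨_, ⟨v, rfl⟩, hv⟩ := hf p hp
    obtain ⟨_, ⟨w, rfl⟩, hw⟩ := hz p hp
    have hjp : j ∈ p := by
      rw [hv] at hip ⊢
      exact ⟨hij.symm.trans hip.1, hjs⟩
    rw [hw] at hip hjp
    exact Eq.trans hip.1 (Eq.symm hjp.1)
  constructor
  · intro hsz
    exact hf.eq_of_kernel hz fun i hi j hj =>
      ⟨kernel hsf hsz i hi j hj, kernel hsz hsf i hi j hj⟩
  · intro h p hp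
    obtain ⟨_, ⟨v, rfl⟩, hv⟩ := hsf p hp
    refine ⟨_, ⟨v, rfl⟩, hv.trans ?_⟩
    ext i
    rw [hn]
    simp only [Set.mem_inter_iff, Set.mem_preimage, Set.mem_singleton_iff, Set.mem_Iio]
    exact and_congr_left fun hi => by rw [h i hi]

theorem Rigid.exists_initial_image {f : ℕ → ℕ} (hf : Rigid f) {n : ℕ} (hn : 1 ≤ n) :
    ∃ k, 1 ≤ k ∧ (∀ i < n, f i < k) ∧ ∀ v < k, ∃ i < n, f i = v := by
  obtain ⟨i, hi, hmax⟩ := Finset.exists_max_image (Finset.range n) f ⟨0, Finset.mem_range.2 hn⟩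
  rw [Finset.mem_range] at hi
  refine ⟨f i + 1, by omega, fun j hj => Nat.lt_succ_of_le (hmax j (Finset.mem_range.2 hj)), ?_⟩
  intro v hv
  rcases Nat.lt_succ_iff_lt_or_eq.1 hv with h | rfl
  · obtain ⟨j, hj, hjv⟩ := hf.2 i v h
    exact ⟨j, hj.trans hi, hjv⟩
  · exact ⟨i, hi, rfl⟩

/-- Dual Ellentuck neighbourhoods in terms of rigid surjections. -/
theorem exists_ellNbhd_param {s X : Set (Set ℕ)} (hs : FinPart s) (hX : InfPart X)
    (hne : (EllNbhd s X).Nonempty) :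
    ∃ (f : ℕ → ℕ) (k : ℕ), Rigid f ∧ 1 ≤ k ∧ ∀ g, RigidFix k g →
      fibres (g ∘ f) ∈ EllNbhd s X ∧
        ∀ Z ∈ EllNbhd s (fibres (g ∘ f)), ∃ u, RigidFix k u ∧ Z = fibres (u ∘ g ∘ f) := by
  obtain ⟨Y, hY, hsY, hYX⟩ := hne
  obtain ⟨f, hf, rfl⟩ := hY.exists_rigid
  obtain ⟨-, n, hn⟩ := hs
  obtain ⟨k, hk, hlt, himg⟩ := hf.exists_initial_image (n := max n 1) (by omega)
  refine ⟨f, k, hf, hk, fun g hg => ?_⟩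
  have hgf := hg.1.comp hf
  have hfix : ∀ i < max n 1, (g ∘ f) i = f i := fun i hi => hg.2 _ (hlt i hi)
  refine ⟨⟨hgf.infPart_fibres, (segment_fibres_iff hn hf hgf hsY).2 fun i hi =>
    hfix i (by omega), ?_⟩, ?_⟩
  · rw [coarser_iff hgf.infPart_fibres hX]
    intro i j hij
    have := (coarser_iff hf.infPart_fibres hX).1 hYX i j hij
    rw [sameBlock_fibres] at this ⊢
    exact congrArg g this
  · rintro Z ⟨hZ, hsZ, hZY⟩
    obtain ⟨z, hz, rfl⟩ := hZ.exists_rigid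
    have hker : ∀ i j, (g ∘ f) i = (g ∘ f) j → z i = z j := fun i j hij =>
      sameBlock_fibres.1 ((coarser_iff hz.infPart_fibres hgf.infPart_fibres).1 hZY i j
        (sameBlock_fibres.2 hij))
    have hzf : ∀ i < max n 1, z i = f i := by
      intro i hi
      rcases lt_or_ge i n with h | h
      · exact (segment_fibres_iff hn hf hz hsY).1 hsZ i h
      · obtain rfl : i = 0 := by omega
        rw [hz.zero, hf.zero]
    obtain ⟨u, hu, rfl⟩ := hgf.exists_factor (m := k) hz hker fun i hi => by
      obtain ⟨j, hj, hji⟩ := himg _ hi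
      rw [hker i j ((hfix j hj).trans hji).symm, hzf j hj, hji]
    exact ⟨u, hu, rfl⟩

theorem FlatBijection.pcBool_eq_true {flat : ℕ → ℕ → ℕ} (hflat : FlatBijection flat)
    {f : ℕ → ℕ} {a b : ℕ} (hab : a ≠ b) :
    pcBool flat (fibres f) (flat a b) = true ↔ f a = f b := by
  simp only [pcBool, decide_eq_true_eq]
  constructor
  · rintro ⟨c, d, hcd, hs, h⟩
    rw [sameBlock_fibres] at hs
    have := hflat.2.1 a b c d hab hcd h
    rcases Set.pair_eq_pair_iff.1 this with ⟨rfl, rfl⟩ | ⟨rfl, rfl⟩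
    · exact hs
    · exact hs.symm
  · intro h
    exact ⟨a, b, hab, sameBlock_fibres.2 h, rfl⟩

theorem FlatBijection.pcBool_injOn {flat : ℕ → ℕ → ℕ} (hflat : FlatBijection flat)
    {X Y : Set (Set ℕ)} (hX : InfPart X) (hY : InfPart Y)
    (h : pcBool flat X = pcBool flat Y) : X = Y := by
  obtain ⟨f, hf, rfl⟩ := hX.exists_rigid
  obtain ⟨g, hg, rfl⟩ := hY.exists_rigid
  have hker : ∀ i j, f i = f j ↔ g i = g j := by
    intro i j
    rcases eq_or_ne i j with rfl | hij
    · simp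
    · rw [← hflat.pcBool_eq_true hij, h, hflat.pcBool_eq_true hij]
  have : g = f := funext fun i =>
    hf.eq_of_kernel hg (n := i + 1) (fun i _ j _ => hker i j) i (Nat.lt_succ_self i)
  rw [this]

open Filter Topology

theorem FlatBijection.tendsto_pcBool {flat : ℕ → ℕ → ℕ} (hflat : FlatBijection flat)
    {y : ℕ → ℕ} (hy : Rigid y) {g : ℕ → ℕ → ℕ} (hg : ∀ n, RigidFix n (g n)) :
    Tendsto (fun n => pcBool flat (fibres (g n ∘ y))) atTop (𝓝 (pcBool flat (fibres y))) := by
  rw [tendsto_pi_nhds]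
  intro c
  obtain ⟨a, b, hab, rfl⟩ := hflat.2.2 c
  refine tendsto_const_nhds.congr' ?_
  filter_upwards [eventually_gt_atTop (max a b)] with n hn
  have ha := (hg n).2 (y a) ((hy.le a).trans_lt (by omega))
  have hb := (hg n).2 (y b) ((hy.le b).trans_lt (by omega))
  rw [Bool.eq_iff_iff, hflat.pcBool_eq_true hab, hflat.pcBool_eq_true hab,
    Function.comp_apply, Function.comp_apply, ha, hb]

/-- If the set of partition codes of A ⊆ (ω)^ω is analytic in Cantor
space, then A is completely dual Ramsey. -/
theorem analytic_completely_dual_ramsey (flat : ℕ → ℕ → ℕ)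
    (hflat : FlatBijection flat) (A : Set (Set (Set ℕ)))
    (hA : ∀ X ∈ A, InfPart X)
    (han : MeasureTheory.AnalyticSet {y : ℕ → Bool | ∃ X ∈ A, y = pcBool flat X}) :
    CompletelyDualRamsey A := by
  intro s X hs hX hne
  rw [MeasureTheory.AnalyticSet] at han
  rcases han with hempty | ⟨F, hF, hrange⟩
  · obtain ⟨Y, hY⟩ := hne
    refine ⟨Y, hY, Or.inr (Set.eq_empty_of_forall_notMem fun Z hZ => ?_)⟩
    exact Set.eq_empty_iff_forall_notMem.1 hempty (pcBool flat Z) ⟨Z, hZ.2, rfl⟩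
  obtain ⟨f, k, hf, hk, hparam⟩ := exists_ellNbhd_param hs hX hne
  obtain ⟨h, hh, hdich⟩ := souslin_dichotomy (k₀ := k) hk
    (C := fun σ => {y | ∃ x : ℕ → ℕ, (List.range σ.length).map x = σ ∧
      F x = pcBool flat (fibres (y ∘ f))}) (by
    rintro σ y ⟨x, hxσ, hx⟩
    refine ⟨x σ.length, x, ?_, hx⟩
    rw [List.length_append, List.length_singleton, List.range_succ, List.map_append, hxσ,
      List.map_singleton])
  refine ⟨fibres (h ∘ f), (hparam h hh).1, hdich.symm.imp (fun H Z hZ => ?_) fun H => ?_⟩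
  · obtain ⟨u, hu, rfl⟩ := (hparam h hh).2 Z hZ
    obtain ⟨x, hx⟩ := H u hu
    choose g hg x' hx' hFx using hx
    have hy : Rigid (u ∘ h ∘ f) := hu.1.comp (hh.1.comp hf)
    have hlim : Tendsto x' atTop (𝓝 x) := by
      rw [tendsto_pi_nhds]
      intro i
      refine tendsto_const_nhds.congr' ?_
      filter_upwards [eventually_gt_atTop i] with n hn
      have := hx' n
      rw [List.length_map, List.length_range] at this
      exact (List.map_inj_left.1 this i (List.mem_range.2 hn)).symm
    have hFlim : Tendsto (fun n => F (x' n)) atTop (𝓝 (F x)) := (hF.tendsto x).comp hlim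
    have heq : F x = pcBool flat (fibres (u ∘ h ∘ f)) := by
      refine tendsto_nhds_unique hFlim ?_
      simp only [hFx]
      exact hflat.tendsto_pcBool hy hg
    have hmem : F x ∈ {y : ℕ → Bool | ∃ X ∈ A, y = pcBool flat X} := hrange ▸ ⟨x, rfl⟩
    obtain ⟨Z, hZA, hZ⟩ := hmem
    rwa [hflat.pcBool_injOn hy.infPart_fibres (hA Z hZA) (heq.symm.trans hZ)]
  · refine Set.eq_empty_of_forall_notMem ?_
    rintro Z ⟨hZ, hZA⟩
    obtain ⟨u, hu, rfl⟩ := (hparam h hh).2 Z hZ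
    have hmem : pcBool flat (fibres (u ∘ h ∘ f)) ∈
        {y : ℕ → Bool | ∃ X ∈ A, y = pcBool flat X} := ⟨_, hZA, rfl⟩
    rw [← hrange] at hmem
    obtain ⟨x, hx⟩ := hmem
    exact H u hu ⟨x, rfl, hx⟩

end DualRamsey
end

section
/- (Preliminary Lemma / Carlson's Lemma for game filters) Let F ⊆ (ω)^ω be a game filter, s ∈ (ℕ), X ∈ F with s ⪯ X, and let l ≥ 1 and π : (X)^{0*}_s → {0,…,l−1} be a colouring. Then there exists Y ∈ (s,X) ∩ F such that π is constant on (Y)^{0*}_s. -/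
namespace DualRamsey

/-- Substitute the letter `a` for the variable `none` of a variable word. -/
def substWord {A : Type*} (a : A) (w : List (Option A)) : List A := w.map fun o => o.getD a

theorem substWord_append {A : Type*} (a : A) (v w : List (Option A)) :
    substWord a (v ++ w) = substWord a v ++ substWord a w := by simp [substWord]

theorem substWord_map_some {A : Type*} (a : A) (w : List A) :
    substWord a (w.map some) = w := by simp [substWord, Function.comp_def]

/-- Hales–Jewett for lists: words of a suitable fixed length contain a monochromatic line,
written as `p ++ none :: q` with a constant part `p` in front of the first variable. -/
theorem exists_mono_variable_word (A κ : Type) [Finite A] [Finite κ] :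
    ∃ L : ℕ, ∀ c : {w : List A // w.length = L} → κ,
      ∃ (p : List A) (q : List (Option A)) (k : κ),
        ∀ a, ∃ h : (p ++ substWord a (none :: q)).length = L, c ⟨_, h⟩ = k := by
  obtain ⟨ι, _, hι⟩ := Combinatorics.Line.exists_mono_in_high_dimension A κ
  let e := Fintype.equivFin ι
  refine ⟨Fintype.card ι, fun c => ?_⟩
  obtain ⟨l, k, hk⟩ := hι fun x => c ⟨List.ofFn fun i => x (e.symm i), by simp⟩
  obtain ⟨i, hi⟩ := l.proper
  have hmem : none ∈ List.ofFn fun j => l.idxFun (e.symm j) := by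
    rw [List.mem_ofFn]
    exact ⟨e i, by simpa using hi⟩
  obtain ⟨p', q, hpq, hp'⟩ := List.eq_append_cons_of_mem hmem
  have hp : ∃ p : List A, p' = p.map some := by
    clear hpq
    induction p' with
    | nil => exact ⟨[], rfl⟩
    | cons o t ih =>
      simp only [List.mem_cons, not_or] at hp'
      obtain ⟨p, rfl⟩ := ih hp'.2
      cases o with
      | none => exact absurd rfl hp'.1
      | some a => exact ⟨a :: p, rfl⟩
  obtain ⟨p, rfl⟩ := hp
  refine ⟨p, q, k, fun a => ?_⟩
  have key : p ++ substWord a (none :: q) = List.ofFn fun j => l a (e.symm j) := by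
    have := congrArg (substWord a) hpq
    rw [substWord_append, substWord_map_some] at this
    rw [← this, substWord, List.map_ofFn]
    rfl
  refine ⟨by rw [key]; simp, ?_⟩
  rw [← hk a]
  congr 1
  exact Subtype.ext key

/-- A finite colouring of words admits finite sequences of variable words along which the
colour only depends on the number of variable words used. -/
theorem exists_variable_words_color_eq (A : Type) [Finite A] (m : ℕ) :
    ∀ (κ : Type) [Finite κ] (c : List A → κ),
      ∃ (p : List A) (U : ℕ → List (Option A)) (g : ℕ → κ),
        ∀ a : ℕ → A, ∀ j ≤ m,
          c (p ++ (List.range j).flatMap fun i => substWord (a i) (none :: U i)) = g j := by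
  induction m with
  | zero =>
    intro κ _ c
    refine ⟨[], fun _ => [], fun _ => c [], fun a j hj => ?_⟩
    obtain rfl : j = 0 := by omega
    simp
  | succ m ih =>
    intro κ _ c
    obtain ⟨L, hL⟩ := exists_mono_variable_word A (Fin (m + 1) → κ)
    have : Finite {w : List A // w.length = L} := List.finite_length_eq A L
    obtain ⟨p, U, g, hg⟩ := ih ({w : List A // w.length = L} → κ) fun w z => c (z.1 ++ w)
    obtain ⟨p', q, k, hk⟩ := hL fun z j => g j z
    refine ⟨p', fun i => i.casesOn (q ++ p.map some) U,
      fun j => j.casesOn (c p') fun j => if h : j < m + 1 then k ⟨j, h⟩ else c p', ?_⟩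
    rintro a (_ | j) hj
    · simp
    · obtain ⟨h, hh⟩ := hk (a 0)
      have h1 := congrFun hh ⟨j, by omega⟩
      have h2 := congrFun (hg (fun i => a (i + 1)) j (by omega)) ⟨_, h⟩
      have hj' : j < m + 1 := by omega
      simp only [hj', dif_pos]
      rw [← h1, ← h2, List.range_succ_eq_map]
      congr 1
      simp [List.flatMap_map, substWord, Function.comp_def]

/-- In every finite colouring of words, some word `p` and all instances of some variable word
starting with `p` followed by the variable get the same colour. -/
theorem exists_word_and_line_mono (A κ : Type) [Finite A] [Nonempty A] [Finite κ]
    (c : List A → κ) :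
    ∃ (p : List A) (q : List (Option A)), ∀ a, c (p ++ substWord a (none :: q)) = c p := by
  have := Fintype.ofFinite κ
  obtain ⟨p, U, g, hg⟩ := exists_variable_words_color_eq A (Fintype.card κ) κ c
  obtain ⟨i, j, hij, hgij⟩ : ∃ i j : Fin (Fintype.card κ + 1), i < j ∧ g i = g j := by
    obtain ⟨i, j, hne, h⟩ := Fintype.exists_ne_map_eq_of_card_lt
      (fun i : Fin (Fintype.card κ + 1) => g i) (by simp)
    rcases lt_or_gt_of_ne hne with h' | h'
    · exact ⟨i, j, h', h⟩
    · exact ⟨j, i, h', h.symm⟩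
  obtain ⟨d, hd⟩ : ∃ d, (j : ℕ) = i + (d + 1) := ⟨j - i - 1, by have : (i : ℕ) < j := hij; omega⟩
  let a₀ : A := Classical.arbitrary A
  refine ⟨p ++ (List.range i).flatMap fun l => substWord a₀ (none :: U l),
    U i ++ (List.range d).flatMap fun l => none :: U (i + (l + 1)), fun a => ?_⟩
  rw [hg (fun _ => a₀) i (by omega), hgij, ← hg (fun l => if l < i then a₀ else a) j (by omega)]
  congr 1
  rw [hd, List.range_add, List.flatMap_append, List.append_assoc]
  congr 2
  · refine List.flatMap_congr fun l hl => ?_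
    simp [List.mem_range.1 hl]
  · simp [List.range_succ_eq_map, List.flatMap_map, substWord, List.map_flatMap]

/-- `n` is the least element of its class. -/
def IsMinRep (R : Setoid ℕ) (n : ℕ) : Prop := ∀ a < n, ¬ R a n

/-- `R` and `Q` coincide on `{0, …, n - 1}`. -/
def Agree (n : ℕ) (R Q : Setoid ℕ) : Prop := ∀ a < n, ∀ b < n, R a b ↔ Q a b

/-- `R` is contained in `Q` on `{0, …, n - 1}`. -/
def LeBelow (n : ℕ) (R Q : Setoid ℕ) : Prop := ∀ a < n, ∀ b < n, R a b → Q a b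

/-- Every class meeting `{0, …, n - 1}` already meets `{0, …, m - 1}`. -/
def Reduces (m n : ℕ) (R : Setoid ℕ) : Prop := m ≤ n ∧ ∀ a < n, ∃ b < m, R a b

theorem Agree.symm {n : ℕ} {R Q : Setoid ℕ} (h : Agree n R Q) : Agree n Q R :=
  fun a ha b hb => (h a ha b hb).symm

theorem Agree.trans {n : ℕ} {R Q S : Setoid ℕ} (h : Agree n R Q) (h' : Agree n Q S) :
    Agree n R S :=
  fun a ha b hb => (h a ha b hb).trans (h' a ha b hb)

theorem Agree.mono {m n : ℕ} {R Q : Setoid ℕ} (h : Agree n R Q) (hmn : m ≤ n) : Agree m R Q :=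
  fun a ha b hb => h a (ha.trans_le hmn) b (hb.trans_le hmn)

theorem Agree.succ {n : ℕ} {R Q : Setoid ℕ} (h : Agree n R Q) (hR : IsMinRep R n)
    (hQ : IsMinRep Q n) : Agree (n + 1) R Q := by
  intro a ha b hb
  rcases Nat.lt_succ_iff_lt_or_eq.1 ha with ha | rfl <;>
    rcases Nat.lt_succ_iff_lt_or_eq.1 hb with hb | rfl
  · exact h a ha b hb
  · exact ⟨fun h => absurd h (hR a ha), fun h => absurd h (hQ a ha)⟩
  · exact ⟨fun h => absurd (R.symm h) (hR b hb), fun h => absurd (Q.symm h) (hQ b hb)⟩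
  · exact ⟨fun _ => Q.refl _, fun _ => R.refl _⟩

theorem Agree.isMinRep {n a : ℕ} {R Q : Setoid ℕ} (h : Agree n R Q) (ha : a < n)
    (hR : IsMinRep R a) : IsMinRep Q a :=
  fun b hb hQ => hR b hb ((h b (hb.trans ha) a ha).2 hQ)

theorem IsMinRep.anti {n : ℕ} {R Q : Setoid ℕ} (hQ : IsMinRep Q n) (h : R ≤ Q) :
    IsMinRep R n :=
  fun a ha hR => hQ a ha (h hR)

theorem Reduces.mono {m n : ℕ} {R Q : Setoid ℕ} (hR : Reduces m n R) (h : LeBelow n R Q) :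
    Reduces m n Q :=
  ⟨hR.1, fun a ha => let ⟨b, hb, hab⟩ := hR.2 a ha; ⟨b, hb, h a ha b (hb.trans_le hR.1) hab⟩⟩

theorem LeBelow.of_le {n : ℕ} {R Q : Setoid ℕ} (h : R ≤ Q) : LeBelow n R Q :=
  fun _ _ _ _ hab => h hab

/-- The least element of the class of `c`. -/
noncomputable def minRep (R : Setoid ℕ) (c : ℕ) : ℕ := sInf {b | R b c}

theorem minRep_rel (R : Setoid ℕ) (c : ℕ) : R (minRep R c) c :=
  Nat.sInf_mem (s := {b | R b c}) ⟨c, R.refl c⟩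

theorem minRep_le_of_rel {R : Setoid ℕ} {b c : ℕ} (h : R b c) : minRep R c ≤ b := Nat.sInf_le h

theorem minRep_le (R : Setoid ℕ) (c : ℕ) : minRep R c ≤ c := minRep_le_of_rel (R.refl c)

theorem minRep_eq_of_rel {R : Setoid ℕ} {b c : ℕ} (h : R b c) : minRep R b = minRep R c :=
  le_antisymm (minRep_le_of_rel (R.trans (minRep_rel R c) (R.symm h)))
    (minRep_le_of_rel (R.trans (minRep_rel R b) h))

theorem isMinRep_minRep (R : Setoid ℕ) (c : ℕ) : IsMinRep R (minRep R c) :=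
  fun _ ha h => absurd (minRep_le_of_rel (R.trans h (minRep_rel R c))) (by omega)

theorem IsMinRep.minRep_eq {R : Setoid ℕ} {n : ℕ} (h : IsMinRep R n) : minRep R n = n := by
  by_contra hne
  exact h _ (lt_of_le_of_ne (minRep_le R n) hne) (minRep_rel R n)

/-- The quotient has infinitely many classes. -/
def InfClasses (R : Setoid ℕ) : Prop := ∀ N, ∃ n ≥ N, IsMinRep R n

theorem exists_isMinRep_reduces {R : Setoid ℕ} (hR : InfClasses R) (k : ℕ) :
    ∃ n, IsMinRep R n ∧ Reduces k n R := by
  classical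
  obtain ⟨hk, hmin⟩ := Nat.find_spec (hR k)
  refine ⟨_, hmin, hk, fun a ha => ⟨minRep R a, ?_, R.symm (minRep_rel R a)⟩⟩
  by_contra hlt
  exact Nat.find_min (hR k) ((minRep_le R a).trans_lt ha) ⟨not_lt.1 hlt, isMinRep_minRep R a⟩

/-- The abstract properties of a game filter, in terms of equivalence relations. -/
structure IsGameFamily (𝓕 : Set (Setoid ℕ)) : Prop where
  inf : ∀ R ∈ 𝓕, InfClasses R
  finer : ∀ R ∈ 𝓕, ∀ Q, Q ≤ R → Q ∈ 𝓕
  merge : ∀ Y ∈ 𝓕, ∀ (n : ℕ) (R : Setoid ℕ),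
    (∀ c d, R c d → Y c d ∨ (∃ a < n, Y a c) ∧ ∃ b < n, Y b d) → R ∈ 𝓕
  fusion : ∀ (Inv : ℕ → Setoid ℕ → Prop) (n₀ : ℕ) (Y₀ : Setoid ℕ),
    Inv n₀ Y₀ → Y₀ ∈ 𝓕 → IsMinRep Y₀ n₀ →
    (∀ n Y, Inv n Y → ∀ X ∈ 𝓕, Y ≤ X → Agree n Y X → IsMinRep X n →
      ∃ n' Y', Y' ∈ 𝓕 ∧ X ≤ Y' ∧ Agree (n + 1) X Y' ∧ IsMinRep Y' n' ∧
        Reduces (n + 1) n' Y' ∧ Inv n' Y') →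
    ∃ Z ∈ 𝓕, ∃ (n : ℕ → ℕ) (Y : ℕ → Setoid ℕ), n 0 = n₀ ∧ Y 0 = Y₀ ∧
      ∀ i, Inv (n i) (Y i) ∧ Y i ≤ Z ∧ Agree (n i) (Y i) Z ∧ IsMinRep Z (n i) ∧
        Reduces (n i + 1) (n (i + 1)) Z

/-- Fusion, with the conclusion phrased for all minima of the resulting partition. -/
theorem IsGameFamily.exists_fusion {𝓕 : Set (Setoid ℕ)} (h𝓕 : IsGameFamily 𝓕)
    (Inv : ℕ → Setoid ℕ → Prop) (n₀ : ℕ) (Y₀ : Setoid ℕ)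
    (h0 : Inv n₀ Y₀) (hY₀ : Y₀ ∈ 𝓕) (hmin : IsMinRep Y₀ n₀)
    (step : ∀ n Y, Inv n Y → ∀ X ∈ 𝓕, Y ≤ X → Agree n Y X → IsMinRep X n →
      ∃ n' Y', Y' ∈ 𝓕 ∧ X ≤ Y' ∧ Agree (n + 1) X Y' ∧ IsMinRep Y' n' ∧
        Reduces (n + 1) n' Y' ∧ Inv n' Y') :
    ∃ Z ∈ 𝓕, Y₀ ≤ Z ∧ Agree n₀ Y₀ Z ∧
      ∀ n ≥ n₀, IsMinRep Z n → ∃ Y, Inv n Y ∧ Y ≤ Z ∧ Agree n Y Z := by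
  obtain ⟨Z, hZ, n, Y, rfl, rfl, h⟩ := h𝓕.fusion Inv n₀ Y₀ h0 hY₀ hmin step
  refine ⟨Z, hZ, (h 0).2.1, (h 0).2.2.1, fun k hk hkmin => ?_⟩
  have hlt : ∀ i, n i < n (i + 1) := fun i => (h i).2.2.2.2.1
  have hmono : StrictMono n := strictMono_nat_of_lt_succ hlt
  obtain ⟨i, hi, hi'⟩ : ∃ i, n i ≤ k ∧ k < n (i + 1) := by
    have hex : ∃ i, k < n (i + 1) := ⟨k, hmono.le_apply⟩
    classical
    refine ⟨Nat.find hex, ?_, Nat.find_spec hex⟩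
    rcases hi : Nat.find hex with _ | i
    · exact hk
    · exact not_lt.1 (Nat.find_min hex (m := i) (by omega))
  obtain ⟨b, hb, hkb⟩ := (h i).2.2.2.2.2 k hi'
  have : ¬ b < k := fun hbk => hkmin b hbk (Z.symm hkb)
  obtain rfl : k = n i := by omega
  exact ⟨Y i, (h i).1, (h i).2.1, (h i).2.2.1⟩

/-- Merge the classes of `Y` meeting `{0, …, n - 1}` according to `U`. -/
def glue (n : ℕ) (U Y : Setoid ℕ) (h : LeBelow n Y U) : Setoid ℕ where
  r c d := Y c d ∨ ∃ a < n, ∃ b < n, Y c a ∧ U a b ∧ Y b d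
  iseqv := by
    refine ⟨fun c => Or.inl (Y.refl c), ?_, ?_⟩
    · rintro c d (hcd | ⟨a, ha, b, hb, hca, hab, hbd⟩)
      · exact Or.inl (Y.symm hcd)
      · exact Or.inr ⟨b, hb, a, ha, Y.symm hbd, U.symm hab, Y.symm hca⟩
    · rintro c d e (hcd | ⟨a, ha, b, hb, hca, hab, hbd⟩) (hde | ⟨a', ha', b', hb', hda, hab', hbe⟩)
      · exact Or.inl (Y.trans hcd hde)
      · exact Or.inr ⟨a', ha', b', hb', Y.trans hcd hda, hab', hbe⟩
      · exact Or.inr ⟨a, ha, b, hb, hca, hab, Y.trans hbd hde⟩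
      · exact Or.inr ⟨a, ha, b', hb', hca,
          U.trans hab (U.trans (h b hb a' ha' (Y.trans hbd hda)) hab'), hbe⟩

theorem glue_rel {n : ℕ} {U Y : Setoid ℕ} {h : LeBelow n Y U} {c d : ℕ} :
    glue n U Y h c d ↔ Y c d ∨ ∃ a < n, ∃ b < n, Y c a ∧ U a b ∧ Y b d := Iff.rfl

theorem le_glue {n : ℕ} {U Y : Setoid ℕ} (h : LeBelow n Y U) : Y ≤ glue n U Y h :=
  fun _ _ hcd => Or.inl hcd

theorem agree_glue {n : ℕ} {U Y : Setoid ℕ} (h : LeBelow n Y U) : Agree n U (glue n U Y h) := by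
  refine fun a ha b hb => ⟨fun hab => Or.inr ⟨a, ha, b, hb, Y.refl _, hab, Y.refl _⟩, ?_⟩
  rintro (hab | ⟨a', ha', b', hb', h1, h2, h3⟩)
  · exact h a ha b hb hab
  · exact U.trans (h a ha a' ha' h1) (U.trans h2 (h b' hb' b hb h3))

theorem isMinRep_glue {n k : ℕ} {U Y : Setoid ℕ} (h : LeBelow n Y U) (hnk : n ≤ k)
    (hk : IsMinRep Y k) : IsMinRep (glue n U Y h) k := by
  rintro a ha (hak | ⟨_, _, b, hb, _, _, hbk⟩)
  · exact hk a ha hak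
  · exact hk b (hb.trans_le hnk) hbk

theorem IsGameFamily.glue_mem {𝓕 : Set (Setoid ℕ)} (h𝓕 : IsGameFamily 𝓕) {n : ℕ}
    {U Y : Setoid ℕ} (hY : Y ∈ 𝓕) (h : LeBelow n Y U) : glue n U Y h ∈ 𝓕 := by
  refine h𝓕.merge Y hY n _ ?_
  rintro c d (hcd | ⟨a, ha, b, hb, hca, _, hbd⟩)
  · exact Or.inl hcd
  · exact Or.inr ⟨⟨a, ha, Y.symm hca⟩, b, hb, hbd⟩

/-- Undo a merging of classes: a coarsening `Z'` of `Y` has a refinement `Z` coarser than `Y`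
which agrees with `Y` below `n`, such that `Z'` is recovered from `Z` by merging classes that
meet `{0, …, n - 1}`. -/
theorem exists_unglue {n : ℕ} {Y Z' : Setoid ℕ} (h : Y ≤ Z') :
    ∃ Z, Y ≤ Z ∧ Z ≤ Z' ∧ Agree n Y Z ∧
      ∀ a b, Z' a b → Z a b ∨ (∃ k < n, Z k a) ∧ ∃ k < n, Z k b := by
  classical
  let label : ℕ → ℕ := fun a =>
    if minRep Y a < n then minRep Y a else if minRep Z' a < n then minRep Z' a else n
  let Z : Setoid ℕ := Z' ⊓ Setoid.ker label
  have hZ : ∀ a b, Z a b ↔ Z' a b ∧ label a = label b := fun a b => Iff.rfl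
  have hYZ : Y ≤ Z := fun {a b} hab => by
    rw [hZ]
    refine ⟨h hab, ?_⟩
    simp only [label, minRep_eq_of_rel hab, minRep_eq_of_rel (h hab)]
  have hhit : ∀ a, minRep Z' a < n → ∃ k < n, Z k a := by
    intro a ha
    by_cases hY : minRep Y a < n
    · exact ⟨_, hY, hYZ (minRep_rel Y a)⟩
    · refine ⟨_, ha, (hZ _ _).2 ⟨minRep_rel Z' a, ?_⟩⟩
      have h1 : IsMinRep Y (minRep Z' a) := (isMinRep_minRep Z' a).anti h
      simp [label, hY, ha, h1.minRep_eq]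
  refine ⟨Z, hYZ, inf_le_left, fun a ha b hb => ⟨fun hab => hYZ hab, fun hab => ?_⟩,
    fun a b hab => ?_⟩
  · have ha' : minRep Y a < n := (minRep_le Y a).trans_lt ha
    have hb' : minRep Y b < n := (minRep_le Y b).trans_lt hb
    have hl := ((hZ a b).1 hab).2
    simp only [label, ha', hb', if_true] at hl
    exact Y.trans (Y.symm (minRep_rel Y a)) (hl ▸ minRep_rel Y b)
  · have heq := minRep_eq_of_rel hab
    by_cases ha : minRep Z' a < n
    · exact Or.inr ⟨hhit a ha, hhit b (heq ▸ ha)⟩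
    · left
      have hb : ¬ minRep Z' b < n := heq ▸ ha
      have ha' : ¬ minRep Y a < n := fun h1 => ha
        ((minRep_le_of_rel (h (minRep_rel Y a))).trans_lt h1)
      have hb' : ¬ minRep Y b < n := fun h1 => hb
        ((minRep_le_of_rel (h (minRep_rel Y b))).trans_lt h1)
      exact (hZ a b).2 ⟨hab, by simp [label, ha, hb, ha', hb']⟩

open Classical in
/-- Merge the class of `x` with the class of `a`. -/
noncomputable def joinClass (R : Setoid ℕ) (x a : ℕ) : Setoid ℕ :=
  R.comap fun c => if R c x then a else c

theorem joinClass_leBelow {R Q : Setoid ℕ} {n x a : ℕ} (h : LeBelow n R Q) (hx : x < n)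
    (ha : a < n) (hxa : Q x a) : LeBelow n (joinClass R x a) Q := by
  classical
  intro c hc d hd hcd
  have key : ∀ c < n, Q c (if R c x then a else c) := by
    intro c hc
    split_ifs with h1
    · exact Q.trans (h c hc x hx h1) hxa
    · exact Q.refl c
  have lt : ∀ c < n, (if R c x then a else c) < n := by
    intro c hc
    split_ifs <;> assumption
  have hcd' : R (if R c x then a else c) (if R d x then a else d) := hcd
  exact Q.trans (key c hc) (Q.trans (h _ (lt c hc) _ (lt d hd) hcd') (Q.symm (key d hd)))

/-- No word extending the word `U` of length `n` followed by a variable has all its instances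
in `D`. -/
def Kills (D : ℕ → Setoid ℕ → Prop) (m n : ℕ) (U Z : Setoid ℕ) : Prop :=
  ∀ n' R, IsMinRep Z n' → LeBelow n' Z R → Agree n U R → IsMinRep R n →
    Reduces (n + 1) n' R → ¬ ∀ a < m, D n' (joinClass R n a)

theorem Kills.mono {D : ℕ → Setoid ℕ → Prop} {m n : ℕ} {U Z Z' : Setoid ℕ}
    (h : Kills D m n U Z) (hZ : Z ≤ Z') : Kills D m n U Z' :=
  fun n' R h1 h2 => h n' R (h1.anti hZ) fun a ha b hb hab => h2 a ha b hb (hZ hab)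

/-- `D` only depends on the restriction of the equivalence relation. -/
def RestrInvariant (D : ℕ → Setoid ℕ → Prop) : Prop :=
  ∀ n R Q, Agree n R Q → D n R → D n Q

/-- `U` is a word over the classes of `X` below `m`, of length `n`, obtained by coarsening `Y`. -/
def IsRed (m n : ℕ) (Y U : Setoid ℕ) : Prop :=
  LeBelow n Y U ∧ Agree m Y U ∧ Reduces m n U

/-- Every neighbourhood of `X` below `m` contains a word in `D`. -/
def Dense (𝓕 : Set (Setoid ℕ)) (D : ℕ → Setoid ℕ → Prop) (m : ℕ) (X : Setoid ℕ) : Prop :=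
  ∀ Y ∈ 𝓕, X ≤ Y → Agree m X Y → ∃ n R, IsMinRep Y n ∧ IsRed m n Y R ∧ D n R

section OneStep

variable {𝓕 : Set (Setoid ℕ)} {D : ℕ → Setoid ℕ → Prop} {m : ℕ} {X : Setoid ℕ}

/-- No word in `D` can be extended in a dense way. -/
def NoDenseExtension (𝓕 : Set (Setoid ℕ)) (D : ℕ → Setoid ℕ → Prop) (m : ℕ) (X : Setoid ℕ) :
    Prop :=
  ∀ n, ∀ Y ∈ 𝓕, X ≤ Y → Agree m X Y → Reduces m n Y → IsMinRep Y n → D n Y →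
    ¬ ∀ Z ∈ 𝓕, Y ≤ Z → Agree n Y Z → IsMinRep Z n →
      ∃ n' R, IsMinRep Z n' ∧ IsRed (n + 1) n' Z R ∧ ∀ a < m, D n' (joinClass R n a)

theorem exists_kills (h𝓕 : IsGameFamily 𝓕) (hD : RestrInvariant D)
    (hno : NoDenseExtension 𝓕 D m X) {n : ℕ} {Y U : Setoid ℕ} (hY : Y ∈ 𝓕) (hXY : X ≤ Y)
    (hagr : Agree m X Y) (hmin : IsMinRep Y n) (hU : IsRed m n Y U) (hDU : D n U) :
    ∃ Z ∈ 𝓕, Y ≤ Z ∧ Agree n Y Z ∧ IsMinRep Z n ∧ Kills D m n U Z := by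
  obtain ⟨hle, hagU, hred⟩ := hU
  have hagG := agree_glue hle
  have h1 := hno n (glue n U Y hle) (h𝓕.glue_mem hY hle) (hXY.trans (le_glue hle))
    (hagr.trans (hagU.trans (hagG.mono hred.1)))
    (hred.mono fun a ha b hb => (hagG a ha b hb).1) (isMinRep_glue hle le_rfl hmin)
    (hD n U _ hagG hDU)
  push Not at h1
  obtain ⟨Z', hZ', hGZ', hagZ', hminZ', hZ'no⟩ := h1
  obtain ⟨Z, hYZ, hZZ', hagZ, hrec⟩ := exists_unglue (n := n) ((le_glue hle).trans hGZ')
  have hZn : IsMinRep Z n := hminZ'.anti hZZ'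
  refine ⟨Z, h𝓕.finer Z' hZ' Z hZZ', hYZ, hagZ, hZn, ?_⟩
  intro n' R hn' hZR hUR hRn hredR hall
  have hUZ' : Agree n U Z' := hagG.trans hagZ'
  have hnn' : n ≤ n' := (Nat.le_succ n).trans hredR.1
  have hmin' : IsMinRep Z' n' := by
    intro a ha hZ'a
    rcases hrec a n' hZ'a with h2 | ⟨_, k, hk, h2⟩
    · exact hn' a ha h2
    · exact hn' k (hk.trans_le hnn') h2
  have hle' : LeBelow n' Z' R := by
    intro a ha b hb hab
    rcases hrec a b hab with h2 | ⟨⟨k, hk, h2⟩, l, hl, h3⟩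
    · exact hZR a ha b hb h2
    · have hkl : Z' k l := Z'.trans (hZZ' h2) (Z'.trans hab (Z'.symm (hZZ' h3)))
      have hkl' : R k l := (hUR k hk l hl).1 ((hUZ' k hk l hl).2 hkl)
      exact R.trans (R.symm (hZR k (hk.trans_le hnn') a ha h2))
        (R.trans hkl' (hZR l (hl.trans_le hnn') b hb h3))
  obtain ⟨a, ha, hna⟩ := hZ'no n' R hmin'
    ⟨hle', (hUZ'.symm.trans hUR).succ hminZ' hRn, hredR⟩
  exact hna (hall a ha)

theorem exists_kills_all (h𝓕 : IsGameFamily 𝓕) (hD : RestrInvariant D)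
    (hno : NoDenseExtension 𝓕 D m X) {n : ℕ} {Y : Setoid ℕ} (hY : Y ∈ 𝓕) (hXY : X ≤ Y)
    (hmn : m ≤ n) (hagr : Agree m X Y) (hmin : IsMinRep Y n) :
    ∃ Z ∈ 𝓕, Y ≤ Z ∧ Agree n Y Z ∧ IsMinRep Z n ∧
      ∀ U, IsRed m n Z U → D n U → Kills D m n U Z := by
  classical
  let code : Setoid ℕ → Fin n → Fin n → Prop := fun U a b => U a b
  have hcode : ∀ U V, code U = code V → Agree n U V := fun U V h a ha b hb =>
    iff_of_eq (congrFun (congrFun h ⟨a, ha⟩) ⟨b, hb⟩)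
  have key : ∀ 𝒞 : Finset (Fin n → Fin n → Prop), ∃ Z ∈ 𝓕, Y ≤ Z ∧ Agree n Y Z ∧ IsMinRep Z n ∧
      ∀ U, code U ∈ 𝒞 → IsRed m n Z U → D n U → Kills D m n U Z := by
    intro 𝒞
    induction 𝒞 using Finset.induction_on with
    | empty => exact ⟨Y, hY, le_rfl, fun _ _ _ _ => Iff.rfl, hmin, by simp⟩
    | insert e 𝒞 _ ih =>
      obtain ⟨Z, hZ, hYZ, hagZ, hminZ, hk⟩ := ih
      have transfer : ∀ Z', Agree n Z Z' → ∀ U, IsRed m n Z' U → IsRed m n Z U :=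
        fun Z' h U hU => ⟨fun a ha b hb hab => hU.1 a ha b hb ((h a ha b hb).1 hab),
          (h.mono hmn).trans hU.2.1, hU.2.2⟩
      by_cases hex : ∃ U, code U = e ∧ IsRed m n Z U ∧ D n U
      · obtain ⟨U, rfl, hU, hDU⟩ := hex
        obtain ⟨Z', hZ', hZZ', hag', hmin', hk'⟩ := exists_kills h𝓕 hD hno hZ (hXY.trans hYZ)
          (hagr.trans (hagZ.mono hmn)) hminZ hU hDU
        refine ⟨Z', hZ', hYZ.trans hZZ', hagZ.trans hag', hmin', fun V hV hVr hDV => ?_⟩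
        rcases Finset.mem_insert.1 hV with hV | hV
        · exact fun n' R h1 h2 h3 => hk' n' R h1 h2 ((hcode _ _ hV).symm.trans h3)
        · exact (hk V hV (transfer Z' hag' V hVr) hDV).mono hZZ'
      · refine ⟨Z, hZ, hYZ, hagZ, hminZ, fun V hV hVr hDV => ?_⟩
        rcases Finset.mem_insert.1 hV with hV | hV
        · exact absurd ⟨V, hV, hVr, hDV⟩ hex
        · exact hk V hV hVr hDV
  obtain ⟨Z, hZ, h1, h2, h3, h4⟩ := key Finset.univ
  exact ⟨Z, hZ, h1, h2, h3, fun U => h4 U (Finset.mem_univ _)⟩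

theorem IsRed.congr {n : ℕ} {Y Z U : Setoid ℕ} (h : IsRed m n Y U) (hYZ : Agree n Y Z) :
    IsRed m n Z U :=
  ⟨fun a ha b hb hab => h.1 a ha b hb ((hYZ a ha b hb).2 hab),
    (hYZ.symm.mono h.2.2.1).trans h.2.1, h.2.2⟩

theorem exists_kills_uniform (h𝓕 : IsGameFamily 𝓕) (hD : RestrInvariant D)
    (hno : NoDenseExtension 𝓕 D m X) (hX : X ∈ 𝓕) :
    ∃ Z ∈ 𝓕, X ≤ Z ∧ Agree m X Z ∧
      ∀ n U, IsMinRep Z n → IsRed m n Z U → D n U → Kills D m n U Z := by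
  obtain ⟨n₀, hn₀, hred₀⟩ := exists_isMinRep_reduces (h𝓕.inf X hX) m
  obtain ⟨Y₀, hY₀, hXY₀, hag₀, hmin₀, hk₀⟩ := exists_kills_all h𝓕 hD hno hX le_rfl hred₀.1
    (fun _ _ _ _ => Iff.rfl) hn₀
  obtain ⟨Z, hZ, hYZ, hagZ, hall⟩ := h𝓕.exists_fusion
    (fun n Y => X ≤ Y ∧ Agree m X Y ∧ m ≤ n ∧ ∀ U, IsRed m n Y U → D n U → Kills D m n U Y)
    n₀ Y₀ ⟨hXY₀, hag₀.mono hred₀.1, hred₀.1, hk₀⟩ hY₀ hmin₀ (by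
      rintro n Y ⟨hXY, hagY, hmn, -⟩ X' hX' hYX' hag' hmin'
      obtain ⟨n', hn', hred'⟩ := exists_isMinRep_reduces (h𝓕.inf X' hX') (n + 1)
      have hmn' : m ≤ n' := hmn.trans ((Nat.le_succ n).trans hred'.1)
      obtain ⟨Y', hY', h1, h2, h3, h4⟩ := exists_kills_all h𝓕 hD hno hX' (hXY.trans hYX') hmn'
        (hagY.trans (hag'.mono hmn)) hn'
      exact ⟨n', Y', hY', h1, h2.mono hred'.1, h3, hred'.mono (.of_le h1),
        (hXY.trans hYX').trans h1, (hagY.trans (hag'.mono hmn)).trans (h2.mono hmn'), hmn', h4⟩)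
  have hXZ := hXY₀.trans hYZ
  refine ⟨Z, hZ, hXZ, (hag₀.trans hagZ).mono hred₀.1, fun n U hn hU hDU => ?_⟩
  have hn₀n : n₀ ≤ n := by
    by_contra hlt
    obtain ⟨b, hb, hnb⟩ := hred₀.2 n (not_le.1 hlt)
    exact hn b (hb.trans_le hU.2.2.1) (hXZ (X.symm hnb))
  obtain ⟨Y, ⟨_, _, _, hk⟩, hYZ', hagY⟩ := hall n hn₀n hn
  exact (hk U (hU.congr hagY.symm) hDU).mono hYZ'

/-- Density yields a stage from which on every continuation has an instance in `D`. -/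
theorem exists_unavoidable (h𝓕 : IsGameFamily 𝓕) (hX : X ∈ 𝓕) (hdense : Dense 𝓕 D m X) :
    ∃ X' ∈ 𝓕, X ≤ X' ∧ Agree m X X' ∧ ∃ k ≥ m, ∀ n, ∀ Y ∈ 𝓕, X' ≤ Y → Agree k X' Y →
      IsMinRep Y n → Reduces k n Y → ∃ U, IsRed m n Y U ∧ D n U := by
  by_contra hcon
  push Not at hcon
  obtain ⟨n₀, Y₀, hY₀, hXY₀, hag₀, hmin₀, hred₀, hav₀⟩ :=
    hcon X hX le_rfl (fun _ _ _ _ => Iff.rfl) m le_rfl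
  obtain ⟨Z, hZ, hYZ, hagZ, hall⟩ := h𝓕.exists_fusion
    (fun n Y => X ≤ Y ∧ Agree m X Y ∧ m ≤ n ∧ ∀ U, IsRed m n Y U → ¬ D n U)
    n₀ Y₀ ⟨hXY₀, hag₀, hred₀.1, hav₀⟩ hY₀ hmin₀ (by
      rintro n Y ⟨hXY, hagY, hmn, -⟩ X' hX' hYX' hag' hmin'
      obtain ⟨n', Y', hY', h1, h2, h3, h4, h5⟩ := hcon X' hX' (hXY.trans hYX')
        (hagY.trans (hag'.mono hmn)) (n + 1) (by omega)
      exact ⟨n', Y', hY', h1, h2, h3, h4, (hXY.trans hYX').trans h1,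
        (hagY.trans (hag'.mono hmn)).trans (h2.mono (by omega)), by have := h4.1; omega, h5⟩)
  obtain ⟨n, R, hn, hR, hDR⟩ :=
    hdense Z hZ (hXY₀.trans hYZ) (hag₀.trans (hagZ.mono hred₀.1))
  have hn₀n : n₀ ≤ n := by
    by_contra hlt
    obtain ⟨b, hb, hnb⟩ := hred₀.2 n (not_le.1 hlt)
    exact hn b (hb.trans_le hR.2.2.1) (hYZ (Y₀.symm hnb))
  obtain ⟨Y, ⟨_, _, _, hk⟩, _, hagY⟩ := hall n hn₀n hn
  exact hk R (hR.congr hagY.symm) hDR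

end OneStep

section Relabel

variable (X : Setoid ℕ) (k : ℕ)

/-- `n` is the minimum of a class and at least `k`. -/
def IsMinFrom (n : ℕ) : Prop := k ≤ n ∧ IsMinRep X n

/-- The `i`-th minimum of a class from `k` on. -/
noncomputable def position (i : ℕ) : ℕ := Nat.nth (IsMinFrom X k) i

open Classical in
/-- The index of the class of `c` among the classes with minimum at least `k`. -/
noncomputable def index (c : ℕ) : ℕ := Nat.count (IsMinFrom X k) (minRep X c)

open Classical in
/-- Send the `i`-th class with minimum at least `k` to `ν i`. -/
noncomputable def relabel (ν : ℕ → ℕ) (c : ℕ) : ℕ :=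
  if minRep X c < k then minRep X c else ν (index X k c)

/-- The targets of the positions determined by a word. -/
noncomputable def target {m : ℕ} (w : List (Fin m)) (i : ℕ) : ℕ :=
  w[i]?.elim (position X k i) fun a => a

/-- The targets of the positions determined by a variable word, `n` being the variable. -/
noncomputable def varTarget {m : ℕ} (n : ℕ) (w : List (Option (Fin m))) (i : ℕ) : ℕ :=
  w[i]?.elim (position X k i) fun o => o.elim n fun a => a

variable {X k}

theorem infinite_isMinFrom (hX : InfClasses X) : {n | IsMinFrom X k n}.Infinite := by
  rw [Set.infinite_iff_exists_gt]
  intro N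
  obtain ⟨n, hn, hmin⟩ := hX (max (N + 1) k)
  exact ⟨n, ⟨by omega, hmin⟩, by omega⟩

theorem isMinFrom_position (hX : InfClasses X) (i : ℕ) : IsMinFrom X k (position X k i) :=
  Nat.nth_mem_of_infinite (infinite_isMinFrom hX) i

theorem position_strictMono (hX : InfClasses X) : StrictMono (position X k) :=
  Nat.nth_strictMono (infinite_isMinFrom hX)

theorem index_position (hX : InfClasses X) (i : ℕ) : index X k (position X k i) = i := by
  classical
  rw [index, (isMinFrom_position hX i).2.minRep_eq]
  exact Nat.count_nth_of_infinite (infinite_isMinFrom hX) i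

theorem position_index {c : ℕ} (hc : k ≤ minRep X c) :
    position X k (index X k c) = minRep X c := by
  classical exact Nat.nth_count ⟨hc, isMinRep_minRep X c⟩

theorem index_lt (hX : InfClasses X) {c L : ℕ} (hc : k ≤ minRep X c) (hL : c < position X k L) :
    index X k c < L := by
  rw [← (position_strictMono hX).lt_iff_lt (a := index X k c) (b := L), position_index hc]
  exact (minRep_le X c).trans_lt hL

theorem relabel_of_rel (ν : ℕ → ℕ) {c d : ℕ} (h : X c d) :
    relabel X k ν c = relabel X k ν d := by
  simp only [relabel, index, minRep_eq_of_rel h]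

theorem relabel_of_minRep_lt (ν : ℕ → ℕ) {c : ℕ} (h : minRep X c < k) :
    relabel X k ν c = minRep X c := if_pos h

theorem relabel_of_le_minRep (ν : ℕ → ℕ) {c : ℕ} (h : k ≤ minRep X c) :
    relabel X k ν c = ν (index X k c) := if_neg (not_lt.2 h)

theorem relabel_of_lt (ν : ℕ → ℕ) {c : ℕ} (h : c < k) : relabel X k ν c = minRep X c :=
  if_pos ((minRep_le X c).trans_lt h)

theorem relabel_position (hX : InfClasses X) (ν : ℕ → ℕ) (i : ℕ) :
    relabel X k ν (position X k i) = ν i := by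
  rw [relabel_of_le_minRep, index_position hX]
  rw [(isMinFrom_position hX i).2.minRep_eq]
  exact (isMinFrom_position hX i).1

theorem target_of_lt {m : ℕ} {w : List (Fin m)} {i : ℕ} (h : i < w.length) :
    target X k w i = w[i] := by simp [target, h]

theorem target_of_le {m : ℕ} {w : List (Fin m)} {i : ℕ} (h : w.length ≤ i) :
    target X k w i = position X k i := by simp [target, h]

theorem relabel_target_lt (hX : InfClasses X) {m : ℕ} (hmk : m ≤ k) {w : List (Fin m)} {c : ℕ}
    (hc : c < position X k w.length) : relabel X k (target X k w) c < k := by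
  rcases lt_or_ge (minRep X c) k with h | h
  · rwa [relabel_of_minRep_lt _ h]
  · rw [relabel_of_le_minRep _ h, target_of_lt (index_lt hX h hc)]
    exact (Fin.is_lt _).trans_le hmk

/-- The coarsening of `X` along a word is in `𝓕`. -/
theorem IsGameFamily.comap_relabel_mem {𝓕 : Set (Setoid ℕ)} (h𝓕 : IsGameFamily 𝓕) (hX𝓕 : X ∈ 𝓕)
    {m : ℕ} (hmk : m ≤ k) (w : List (Fin m)) :
    X.comap (relabel X k (target X k w)) ∈ 𝓕 := by
  have hX := h𝓕.inf X hX𝓕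
  have hk : k ≤ position X k w.length := (isMinFrom_position hX _).1
  have key : ∀ c, minRep X c < position X k w.length ∨
      relabel X k (target X k w) c = minRep X c ∧ position X k w.length ≤ minRep X c := by
    intro c
    rcases lt_or_ge (minRep X c) (position X k w.length) with h | h
    · exact Or.inl h
    · refine Or.inr ⟨?_, h⟩
      have hkc := hk.trans h
      rw [relabel_of_le_minRep _ hkc, target_of_le, position_index hkc]
      rwa [← (position_strictMono hX (k := k)).le_iff_le, position_index hkc]
  have small : ∀ c, minRep X c < position X k w.length →
      relabel X k (target X k w) c < k := by
    intro c hc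
    rw [← relabel_of_rel _ (minRep_rel X c)]
    exact relabel_target_lt hX hmk hc
  have cross : ∀ c d, X (relabel X k (target X k w) c) (relabel X k (target X k w) d) →
      minRep X c < position X k w.length →
      relabel X k (target X k w) d = minRep X d → position X k w.length ≤ minRep X d → False := by
    intro c d hcd hc hd hd'
    rw [hd] at hcd
    exact isMinRep_minRep X d _ ((small c hc).trans_le (hk.trans hd')) hcd
  refine h𝓕.merge X hX𝓕 (position X k w.length) _ fun c d hcd => ?_
  have hcd : X (relabel X k (target X k w) c) (relabel X k (target X k w) d) := hcd
  rcases key c with hc | ⟨hc, hc'⟩ <;> rcases key d with hd | ⟨hd, hd'⟩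
  · exact Or.inr ⟨⟨_, hc, minRep_rel X c⟩, _, hd, minRep_rel X d⟩
  · exact (cross c d hcd hc hd hd').elim
  · exact (cross d c (X.symm hcd) hd hc hc').elim
  · rw [hc, hd] at hcd
    exact Or.inl (X.trans (X.symm (minRep_rel X c)) (X.trans hcd (minRep_rel X d)))

end Relabel

section OneStep

variable {𝓕 : Set (Setoid ℕ)} {D : ℕ → Setoid ℕ → Prop} {m : ℕ} {X : Setoid ℕ}

theorem not_kills_of_unavoidable (h𝓕 : IsGameFamily 𝓕) (hD : RestrInvariant D) (hm : 1 ≤ m)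
    (hX𝓕 : X ∈ 𝓕) {k : ℕ} (hmk : m ≤ k)
    (hun : ∀ n, ∀ Y ∈ 𝓕, X ≤ Y → Agree k X Y → IsMinRep Y n → Reduces k n Y →
      ∃ U, IsRed m n Y U ∧ D n U) :
    ∃ n U, IsMinRep X n ∧ IsRed m n X U ∧ D n U ∧ ¬ Kills D m n U X := by
  classical
  have hX := h𝓕.inf X hX𝓕
  have : Nonempty (Fin m) := ⟨⟨0, hm⟩⟩
  let p := position X k
  have hkp : ∀ i, k ≤ p i := fun i => (isMinFrom_position hX i).1
  have hpmin : ∀ i, IsMinRep X (p i) := fun i => (isMinFrom_position hX i).2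
  let f : List (Fin m) → ℕ → ℕ := fun w => relabel X k (target X k w)
  have hfsmall : ∀ (w : List (Fin m)), ∀ c < p w.length, f w c < k :=
    fun w c hc => relabel_target_lt hX hmk hc
  have hfk : ∀ (ν : ℕ → ℕ), ∀ c < k, X (relabel X k ν c) c := fun ν c hc => by
    rw [relabel_of_lt _ hc]
    exact minRep_rel X c
  have hagk : ∀ w, Agree k X (X.comap (f w)) := fun w a ha b hb =>
    ⟨fun h => X.trans (hfk _ a ha) (X.trans h (X.symm (hfk _ b hb))),
      fun h => X.trans (X.symm (hfk _ a ha)) (X.trans h (hfk _ b hb))⟩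
  have hcol : ∀ w : List (Fin m), ∃ (U : Setoid ℕ) (γ : Fin k → Fin m),
      IsRed m (p w.length) (X.comap (f w)) U ∧ D (p w.length) U ∧ ∀ b : Fin k, U b (γ b) := by
    intro w
    have hp : f w (p w.length) = p w.length := by
      simp only [f, p]
      rw [relabel_position hX, target_of_le le_rfl]
    obtain ⟨U, hU, hDU⟩ := hun (p w.length) (X.comap (f w))
      (h𝓕.comap_relabel_mem hX𝓕 hmk w)
      (fun {a b} hab => by
        change X (f w a) (f w b)
        rw [show f w a = f w b from relabel_of_rel _ hab])
      (hagk w)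
      (fun a ha h => by
        have h : X (f w a) (f w (p w.length)) := h
        rw [hp] at h
        exact hpmin _ _ ((hfsmall w a ha).trans_le (hkp _)) h)
      ⟨hkp _, fun a ha => ⟨f w a, hfsmall w a ha, X.symm (hfk _ _ (hfsmall w a ha))⟩⟩
    have hγ : ∀ b : Fin k, ∃ a : Fin m, U b a := fun b => by
      obtain ⟨a, ha, hba⟩ := hU.2.2.2 b (b.2.trans_le (hkp _))
      exact ⟨⟨a, ha⟩, hba⟩
    choose γ hγ using hγ
    exact ⟨U, γ, hU, hDU, hγ⟩
  choose Uw col hred hDw hcolrel using hcol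
  let ext : (Fin k → Fin m) → ℕ → ℕ := fun γ c => if h : c < k then γ ⟨c, h⟩ else c
  have hext_lt : ∀ γ, ∀ c < k, ext γ c < m := fun γ c hc => by simp [ext, hc]
  have hext_ge : ∀ γ c, k ≤ c → ext γ c = c := fun γ c hc => by simp [ext, not_lt.2 hc]
  have hUext : ∀ w, ∀ c < k, Uw w c (ext (col w) c) := fun w c hc => by
    simpa [ext, hc] using hcolrel w ⟨c, hc⟩
  have hext_rel : ∀ w, ∀ c < m, X (ext (col w) c) c := fun w c hc => by
    have h1 := hUext w c (hc.trans_le hmk)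
    have hlt := hext_lt (col w) c (hc.trans_le hmk)
    exact X.symm ((((hagk w).mono hmk).trans (hred w).2.1 c hc _ hlt).2 h1)
  have hDfinal : ∀ w, D (p w.length) (X.comap (ext (col w) ∘ f w)) := by
    intro w
    refine hD _ _ _ ?_ (hDw w)
    have hstep : ∀ c < p w.length, Uw w c (ext (col w) (f w c)) := fun c hc => by
      have hlt := hfsmall w c hc
      refine (Uw w).trans ((hred w).1 c hc _ (hlt.trans_le (hkp _)) ?_) (hUext w _ hlt)
      exact X.symm (hfk _ _ hlt)
    intro a ha b hb
    have h1 := hext_lt (col w) _ (hfsmall w a ha)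
    have h2 := hext_lt (col w) _ (hfsmall w b hb)
    refine Iff.trans ?_ (((hagk w).mono hmk).trans (hred w).2.1 _ h1 _ h2).symm
    exact ⟨fun h => (Uw w).trans ((Uw w).symm (hstep a ha)) ((Uw w).trans h (hstep b hb)),
      fun h => (Uw w).trans (hstep a ha) ((Uw w).trans h ((Uw w).symm (hstep b hb)))⟩
  obtain ⟨w₀, q, hmono⟩ := exists_word_and_line_mono (Fin m) (Fin k → Fin m) col
  let γ := ext (col w₀)
  have hγ_relabel : ∀ (ν : ℕ → ℕ), ∀ c < m, X (γ (relabel X k ν c)) c := fun ν c hc => by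
    rw [relabel_of_lt _ (hc.trans_le hmk)]
    exact X.trans (hext_rel w₀ _ ((minRep_le X c).trans_lt hc)) (minRep_rel X c)
  let n := p w₀.length
  let w : List (Option (Fin m)) := w₀.map some ++ none :: q
  let g : ℕ → ℕ := relabel X k (varTarget X k n w)
  have hw : ∀ a, w₀ ++ substWord a (none :: q) = substWord a w := fun a => by
    simp only [w, substWord_append, substWord_map_some]
  have hwlen : ∀ a, (substWord a w).length = w.length := fun a => by simp [substWord]
  have hlen : w₀.length < w.length := by simp [w]
  have hnn' : n < p w.length := position_strictMono hX hlen
  have hγn : γ n = n := hext_ge _ _ (hkp _)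
  have hgn : g n = n := by
    simp only [g, n, p]
    rw [relabel_position hX]
    simp [varTarget, w]
  have hγlt : ∀ c < k, γ c < n := fun c hc => (hext_lt _ c hc).trans_le (hmk.trans (hkp _))
  have hnotn : ∀ c < n, ¬ X c n := hpmin _
  have hcase : ∀ c < p w.length, (g c = n ∧ ∀ a, f (substWord a w) c = a) ∨
      (g c < k ∧ ∀ a, f (substWord a w) c = g c) := by
    intro c hc
    rcases lt_or_ge (minRep X c) k with h | h
    · right
      simp only [g, f, relabel_of_minRep_lt _ h]
      exact ⟨h, fun _ => trivial⟩
    · have hi := index_lt hX h hc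
      simp only [g, f, relabel_of_le_minRep _ h, target, varTarget, substWord, List.getElem?_map,
        List.getElem?_eq_getElem hi]
      rcases w[index X k c] with _ | b
      · left; simp
      · right
        simpa using b.2.trans_le hmk
  have hfg : ∀ c < n, f w₀ c = g c := by
    intro c hc
    rcases lt_or_ge (minRep X c) k with h | h
    · simp only [g, f, relabel_of_minRep_lt _ h]
    · have hi := index_lt hX h hc
      simp only [g, f, relabel_of_le_minRep _ h, target, varTarget, w]
      rw [List.getElem?_append_left (by simpa using hi)]
      simp [List.getElem?_eq_getElem hi]
  let U : Setoid ℕ := X.comap (γ ∘ f w₀)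
  let R : Setoid ℕ := X.comap (γ ∘ g)
  have hfw₀ : ∀ c < n, γ (f w₀ c) < m := fun c hc => hext_lt _ _ (hfsmall w₀ c hc)
  have hRn : ∀ c < p w.length, (R c n ↔ g c = n) := by
    intro c hc
    change X (γ (g c)) (γ (g n)) ↔ _
    rw [hgn, hγn]
    refine ⟨fun h => ?_, fun h => by rw [h, hγn]⟩
    rcases hcase c hc with h1 | h1
    · exact h1.1
    · exact absurd h (hnotn _ (hγlt _ h1.1))
  refine ⟨n, U, hpmin _, ⟨fun a ha b hb hab => ?_, fun a ha b hb => ?_, hmk.trans (hkp _),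
    fun a ha => ⟨γ (f w₀ a), hfw₀ a ha, X.symm (hγ_relabel _ _ (hfw₀ a ha))⟩⟩, hDfinal w₀, ?_⟩
  · change X (γ (f w₀ a)) (γ (f w₀ b))
    rw [show f w₀ a = f w₀ b from relabel_of_rel _ hab]
  · change _ ↔ X (γ (f w₀ a)) (γ (f w₀ b))
    exact ⟨fun h => X.trans (hγ_relabel _ a ha) (X.trans h (X.symm (hγ_relabel _ b hb))),
      fun h => X.trans (X.symm (hγ_relabel _ a ha)) (X.trans h (hγ_relabel _ b hb))⟩
  intro hkill
  refine hkill (p w.length) R (hpmin _) (fun a _ b _ hab => ?_) (fun a ha b hb => ?_)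
    (fun c hc hcn => ?_) ⟨hnn', fun c hc => ⟨γ (g c), ?_, ?_⟩⟩ (fun a ha => ?_)
  · change X (γ (g a)) (γ (g b))
    rw [show g a = g b from relabel_of_rel _ hab]
  · change X (γ (f w₀ a)) (γ (f w₀ b)) ↔ X (γ (g a)) (γ (g b))
    rw [hfg a ha, hfg b hb]
  · rw [hRn c (hc.trans hnn'), ← hfg c hc] at hcn
    exact absurd (hfsmall w₀ c hc) (by rw [hcn]; exact not_lt.2 (hkp _))
  · rcases hcase c hc with h1 | h1
    · rw [h1.1, hγn]; exact Nat.lt_succ_self n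
    · exact (hγlt _ h1.1).trans (Nat.lt_succ_self n)
  · change X (γ (g c)) (γ (g (γ (g c))))
    rcases hcase c hc with h1 | h1
    · rw [h1.1, hγn, hgn, hγn]
    · exact X.symm (hγ_relabel _ _ (hext_lt _ _ h1.1))
  · have hDa := hDfinal (substWord ⟨a, ha⟩ w)
    have hcola : col (substWord ⟨a, ha⟩ w) = col w₀ := by rw [← hw, hmono]
    rw [hwlen, hcola] at hDa
    refine hD _ _ _ ?_ hDa
    have key : ∀ c < p w.length,
        X (γ (f (substWord ⟨a, ha⟩ w) c)) (γ (g (if R c n then a else c))) := by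
      intro c hc
      rcases hcase c hc with h1 | h1
      · rw [if_pos ((hRn c hc).2 h1.1), h1.2]
        exact X.trans (hext_rel w₀ a ha) (X.symm (hγ_relabel _ a ha))
      · rw [if_neg (fun h => ?_), h1.2]
        rw [hRn c hc] at h
        exact absurd h1.1 (by rw [h]; exact not_lt.2 (hkp _))
    intro c hc d hd
    change X (γ (f (substWord ⟨a, ha⟩ w) c)) (γ (f (substWord ⟨a, ha⟩ w) d)) ↔
      X (γ (g (if R c n then a else c))) (γ (g (if R d n then a else d)))
    exact ⟨fun h => X.trans (X.symm (key c hc)) (X.trans h (key d hd)),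
      fun h => X.trans (key c hc) (X.trans h (X.symm (key d hd)))⟩

/-- If `D` is dense, some word in `D` has a dense set of extensions by a variable word all of
whose instances are in `D`. -/
theorem exists_dense_extension (h𝓕 : IsGameFamily 𝓕) (hD : RestrInvariant D) (hm : 1 ≤ m)
    (hX : X ∈ 𝓕) (hdense : Dense 𝓕 D m X) :
    ∃ n, ∃ Y ∈ 𝓕, X ≤ Y ∧ Agree m X Y ∧ Reduces m n Y ∧ IsMinRep Y n ∧ D n Y ∧
      ∀ Z ∈ 𝓕, Y ≤ Z → Agree n Y Z → IsMinRep Z n →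
        ∃ n' R, IsMinRep Z n' ∧ IsRed (n + 1) n' Z R ∧ ∀ a < m, D n' (joinClass R n a) := by
  by_contra hcon
  have hno : NoDenseExtension 𝓕 D m X := fun n Y hY h1 h2 h3 h4 h5 h6 =>
    hcon ⟨n, Y, hY, h1, h2, h3, h4, h5, h6⟩
  obtain ⟨Z, hZ, hXZ, hag, hkill⟩ := exists_kills_uniform h𝓕 hD hno hX
  obtain ⟨X', hX', hZX', hag', k, hk, hun⟩ := exists_unavoidable (D := D) (m := m) h𝓕 hZ
    fun Y hY hZY hagY => hdense Y hY (hXZ.trans hZY) (hag.trans hagY)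
  obtain ⟨n, U, hn, hU, hDU, hnk⟩ := not_kills_of_unavoidable h𝓕 hD hm hX' hk hun
  refine hnk ((hkill n U (hn.anti hZX') ?_ hDU).mono hZX')
  exact ⟨fun a ha b hb hab => hU.1 a ha b hb (hZX' hab), hag'.trans hU.2.1, hU.2.2⟩

end OneStep

/-- All words over `{0, …, m - 1}` coarsening `R` are in `D`. -/
def AllRed (D : ℕ → Setoid ℕ → Prop) (m n : ℕ) (R : Setoid ℕ) : Prop :=
  ∀ U, IsRed m n R U → D n U

theorem AllRed.restrInvariant (D : ℕ → Setoid ℕ → Prop) (m : ℕ) :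
    RestrInvariant (AllRed D m) :=
  fun _ _ _ hag h U hU => h U (hU.congr hag.symm)

theorem AllRed.of_joinClass {D : ℕ → Setoid ℕ → Prop} {m k n n' : ℕ} {R : Setoid ℕ}
    (hmk : m ≤ k) (hn : n < n')
    (h : ∀ a < k, AllRed D m n' (joinClass R n a)) : AllRed D m n' R := by
  intro U hU
  obtain ⟨b, hb, hnb⟩ := hU.2.2.2 n hn
  have hle := joinClass_leBelow hU.1 hn (hb.trans_le hU.2.2.1) hnb
  refine h b (hb.trans_le hmk) U ⟨hle, fun c hc d hd => ⟨fun hcd => ?_, fun hcd => ?_⟩, hU.2.2⟩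
  · exact hle c (hc.trans_le hU.2.2.1) d (hd.trans_le hU.2.2.1) hcd
  · have hcd : R c d := (hU.2.1 c hc d hd).2 hcd
    change R _ _
    dsimp only
    by_cases h1 : R c n
    · have h2 : R d n := R.trans (R.symm hcd) h1
      rw [if_pos h1, if_pos h2]
    · have h2 : ¬ R d n := fun h2 => h1 (R.trans hcd h2)
      rwa [if_neg h1, if_neg h2]

/-- A dense set of words contains all words coarsening some member of the family. -/
theorem exists_all_mem_of_dense {𝓕 : Set (Setoid ℕ)} (h𝓕 : IsGameFamily 𝓕)
    {D : ℕ → Setoid ℕ → Prop} (hD : RestrInvariant D) {m : ℕ} (hm : 1 ≤ m) {X : Setoid ℕ}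
    (hX : X ∈ 𝓕) (hdense : Dense 𝓕 D m X) :
    ∃ Z ∈ 𝓕, X ≤ Z ∧ Agree m X Z ∧ ∀ n U, IsMinRep Z n → IsRed m n Z U → D n U := by
  have hdense' : Dense 𝓕 (AllRed D m) m X := by
    intro Y hY hXY hag
    obtain ⟨n, R, hn, hR, hDR⟩ := hdense Y hY hXY hag
    refine ⟨n, R, hn, hR, fun U hU => hD n R U (fun a ha b hb => ⟨hU.1 a ha b hb, ?_⟩) hDR⟩
    intro hab
    obtain ⟨a', ha', haa'⟩ := hR.2.2.2 a ha
    obtain ⟨b', hb', hbb'⟩ := hR.2.2.2 b hb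
    have h1 : U a' b' := U.trans (U.symm (hU.1 a ha a' (ha'.trans_le hR.2.2.1) haa'))
      (U.trans hab (hU.1 b hb b' (hb'.trans_le hR.2.2.1) hbb'))
    exact R.trans haa' (R.trans ((hU.2.1 a' ha' b' hb').2 h1) (R.symm hbb'))
  have hinv := AllRed.restrInvariant D m
  obtain ⟨n₀, Y₀, hY₀, hXY₀, hag₀, hred₀, hmin₀, hD₀, hd₀⟩ :=
    exists_dense_extension h𝓕 hinv hm hX hdense'
  obtain ⟨Z, hZ, hYZ, hagZ, hall⟩ := h𝓕.exists_fusion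
    (fun n Y => m ≤ n ∧ AllRed D m n Y ∧ ∀ Z ∈ 𝓕, Y ≤ Z → Agree n Y Z → IsMinRep Z n →
      ∃ n' R, IsMinRep Z n' ∧ IsRed (n + 1) n' Z R ∧ AllRed D m n' R)
    n₀ Y₀ ⟨hred₀.1, hD₀, fun Z hZ h1 h2 h3 => by
      obtain ⟨n', R, h4, h5, h6⟩ := hd₀ Z hZ h1 h2 h3
      exact ⟨n', R, h4, h5, AllRed.of_joinClass le_rfl h5.2.2.1 h6⟩⟩ hY₀ hmin₀ (by
      rintro n Y ⟨hmn, -, hd⟩ X' hX' hYX' hag' hmin'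
      obtain ⟨n', Y', hY', h1, h2, h3, h4, h5, h6⟩ := exists_dense_extension (m := n + 1) h𝓕 hinv
        (by omega) hX' (by
          intro Z hZ hX'Z hagZ
          exact hd Z hZ (hYX'.trans hX'Z) (hag'.trans (hagZ.mono (by omega)))
            (hagZ.isMinRep (by omega) hmin'))
      have hmn' : m ≤ n' := by have := h3.1; omega
      refine ⟨n', Y', hY', h1, h2, h4, h3, hmn', h5, fun Z hZ k1 k2 k3 => ?_⟩
      obtain ⟨n'', R, k4, k5, k6⟩ := h6 Z hZ k1 k2 k3
      exact ⟨n'', R, k4, k5, AllRed.of_joinClass (by omega) k5.2.2.1 k6⟩)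
  refine ⟨Z, hZ, hXY₀.trans hYZ, hag₀.trans (hagZ.mono hred₀.1), fun n U hn hU => ?_⟩
  have hn₀n : n₀ ≤ n := by
    by_contra hlt
    obtain ⟨b, hb, hnb⟩ := hred₀.2 n (not_le.1 hlt)
    exact hn b (hb.trans_le hU.2.2.1) (hYZ (Y₀.symm hnb))
  obtain ⟨Y, ⟨_, hk, _⟩, _, hagY⟩ := hall n hn₀n hn
  exact hk U (hU.congr hagY.symm)

/-- Carlson's lemma for game families. -/
theorem exists_color_const {𝓕 : Set (Setoid ℕ)} (h𝓕 : IsGameFamily 𝓕) {m : ℕ} (hm : 1 ≤ m)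
    {X : Setoid ℕ} (hX : X ∈ 𝓕) (l : ℕ) (col : ℕ → Setoid ℕ → ℕ)
    (hcol : ∀ n R Q, Agree n R Q → col n R = col n Q)
    (hl : ∀ n U, IsMinRep X n → IsRed m n X U → col n U < l) :
    ∃ Z ∈ 𝓕, X ≤ Z ∧ Agree m X Z ∧
      ∃ i, ∀ n U, IsMinRep Z n → IsRed m n Z U → col n U = i := by
  by_contra hcon
  push Not at hcon
  have key : ∀ j, ∃ Z ∈ 𝓕, X ≤ Z ∧ Agree m X Z ∧
      ∀ n U, IsMinRep Z n → IsRed m n Z U → j ≤ col n U := by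
    intro j
    induction j with
    | zero => exact ⟨X, hX, le_rfl, fun _ _ _ _ => Iff.rfl, fun _ _ _ _ => Nat.zero_le _⟩
    | succ j ih =>
      obtain ⟨Z, hZ, hXZ, hag, hj⟩ := ih
      have hnd : ¬ Dense 𝓕 (fun n R => col n R = j) m Z := fun hd => by
        obtain ⟨Z', hZ', hZZ', hag', hall⟩ := exists_all_mem_of_dense h𝓕
          (fun n R Q h h' => (hcol n R Q h).symm.trans h') hm hZ hd
        obtain ⟨n, U, hn, hU, hne⟩ := hcon Z' hZ' (hXZ.trans hZZ') (hag.trans hag') j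
        exact hne (hall n U hn hU)
      unfold Dense at hnd
      push Not at hnd
      obtain ⟨Y, hY, hZY, hagY, hne⟩ := hnd
      refine ⟨Y, hY, hXZ.trans hZY, hag.trans hagY, fun n U hn hU => ?_⟩
      have h1 := hj n U (hn.anti hZY)
        ⟨fun a ha b hb hab => hU.1 a ha b hb (hZY hab), hagY.trans hU.2.1, hU.2.2⟩
      exact Nat.succ_le_of_lt (lt_of_le_of_ne h1 (Ne.symm (hne n U hn hU)))
  obtain ⟨Z, hZ, hXZ, hag, hj⟩ := key l
  obtain ⟨n, hn, hred⟩ := exists_isMinRep_reduces (h𝓕.inf Z hZ) m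
  have h1 := hj n Z hn ⟨fun _ _ _ _ h => h, fun _ _ _ _ => Iff.rfl, hred⟩
  have h2 := hl n Z (hn.anti hXZ) ⟨fun _ _ _ _ h => hXZ h, hag, hred⟩
  omega

/-! ### From partitions to equivalence relations -/

theorem IsPartition.eq_of_mem_s11 {P : Set (Set ℕ)} (hP : IsPartition P) {p q : Set ℕ} (hp : p ∈ P)
    (hq : q ∈ P) {a : ℕ} (hap : a ∈ p) (haq : a ∈ q) : p = q := by
  by_contra h
  exact Set.disjoint_left.1 (hP.2 p hp q hq h) hap haq

theorem IsPartition.coarser_iff {P Q : Set (Set ℕ)} (hP : IsPartition P) (hQ : IsPartition Q) :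
    Coarser P Q ↔ ∀ a ∈ pdom P, ∀ b ∈ pdom P, sameBlock Q a b → sameBlock P a b := by
  constructor
  · rintro h a ⟨p, hp, hap⟩ b hb ⟨q, hq, haq, hbq⟩
    obtain ⟨S, hS, hpS⟩ := h p hp
    have ha : a ∈ p ∩ pdom Q := ⟨hap, q, hq, haq⟩
    rw [hpS] at ha
    obtain ⟨q', hq', haq', -⟩ := Set.mem_iUnion₂.1 ha
    obtain rfl := hQ.eq_of_mem_s11 hq (hS hq') haq haq'
    have hb : b ∈ p ∩ pdom Q := by
      rw [hpS]
      exact Set.mem_iUnion₂.2 ⟨q, hq', hbq, hb⟩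
    exact ⟨p, hp, hap, hb.1⟩
  · intro h p hp
    refine ⟨{q | q ∈ Q ∧ (q ∩ p).Nonempty}, fun q hq => hq.1, Set.ext fun x => ?_⟩
    simp only [Set.mem_iUnion₂]
    constructor
    · rintro ⟨hxp, q, hq, hxq⟩
      exact ⟨q, ⟨hq, x, hxq, hxp⟩, hxq, p, hp, hxp⟩
    · rintro ⟨q, ⟨hq, a, haq, hap⟩, hxq, hx⟩
      obtain ⟨p', hp', hap', hxp'⟩ := h a ⟨p, hp, hap⟩ x hx ⟨q, hq, haq, hxq⟩
      obtain rfl := hP.eq_of_mem_s11 hp hp' hap hap'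
      exact ⟨hxp', q, hq, hxq⟩

theorem IsPartition.segment_iff {s X : Set (Set ℕ)} (hs : IsPartition s) (hX : IsPartition X) :
    Segment s X ↔ pdom s ⊆ pdom X ∧
      ∀ a ∈ pdom s, ∀ b ∈ pdom s, sameBlock s a b ↔ sameBlock X a b := by
  constructor
  · intro h
    refine ⟨?_, ?_⟩
    · rintro a ⟨p, hp, hap⟩
      obtain ⟨q, hq, rfl⟩ := h p hp
      exact ⟨q, hq, hap.1⟩
    · rintro a ⟨p, hp, hap⟩ b hb
      obtain ⟨q, hq, hpq⟩ := h p hp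
      constructor
      · rintro ⟨p', hp', hap', hbp'⟩
        obtain rfl := hs.eq_of_mem_s11 hp hp' hap hap'
        rw [hpq] at hap' hbp'
        exact ⟨q, hq, hap'.1, hbp'.1⟩
      · rintro ⟨q', hq', haq', hbq'⟩
        have haq : a ∈ q := (hpq ▸ hap : a ∈ q ∩ pdom s).1
        obtain rfl := hX.eq_of_mem_s11 hq hq' haq haq'
        exact ⟨p, hp, hap, hpq ▸ ⟨hbq', hb⟩⟩
  · rintro ⟨hsub, h⟩ p hp
    obtain ⟨a, hap⟩ := hs.1 p hp
    obtain ⟨q, hq, haq⟩ := hsub ⟨p, hp, hap⟩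
    refine ⟨q, hq, Set.ext fun x => ⟨fun hx => ?_, fun hx => ?_⟩⟩
    · obtain ⟨q', hq', haq', hxq'⟩ := (h a ⟨p, hp, hap⟩ x ⟨p, hp, hx⟩).1 ⟨p, hp, hap, hx⟩
      obtain rfl := hX.eq_of_mem_s11 hq hq' haq haq'
      exact ⟨hxq', p, hp, hx⟩
    · obtain ⟨p', hp', hap', hxp'⟩ := (h a ⟨p, hp, hap⟩ x hx.2).2 ⟨q, hq, haq, hx.1⟩
      obtain rfl := hs.eq_of_mem_s11 hp hp' hap hap'
      exact hxp'

theorem isPartition_classes (R : Setoid ℕ) : IsPartition R.classes := by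
  refine ⟨fun b hb => Setoid.nonempty_of_mem_partition (Setoid.isPartition_classes R) hb,
    fun b hb c hc hne => (Setoid.isPartition_classes R).pairwiseDisjoint hb hc hne⟩

theorem pdom_classes (R : Setoid ℕ) : pdom R.classes = Set.univ :=
  (Setoid.isPartition_classes R).sUnion_eq_univ

theorem sameBlock_classes {R : Setoid ℕ} {a b : ℕ} : sameBlock R.classes a b ↔ R a b :=
  (Setoid.rel_iff_exists_classes R).symm

theorem coarser_classes {R Q : Setoid ℕ} : Coarser R.classes Q.classes ↔ Q ≤ R := by
  rw [(isPartition_classes R).coarser_iff (isPartition_classes Q)]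
  simp only [pdom_classes, sameBlock_classes, Set.mem_univ, true_imp_iff]
  exact Iff.rfl

theorem classes_infinite_iff {R : Setoid ℕ} : R.classes.Infinite ↔ InfClasses R := by
  constructor
  · intro h
    by_contra hcon
    simp only [InfClasses, not_forall, not_exists, not_and] at hcon
    obtain ⟨N, hN⟩ := hcon
    refine h (((Set.finite_Iio N).image fun a => {x | R x a}).subset ?_)
    rintro _ ⟨c, rfl⟩
    refine ⟨minRep R c, ?_, ?_⟩
    · by_contra hlt
      exact hN _ (not_lt.1 hlt) (isMinRep_minRep R c)
    · ext x
      exact ⟨fun hx => R.trans hx (minRep_rel R c),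
        fun hx => R.trans hx (R.symm (minRep_rel R c))⟩
  · intro h
    have hinf : {n | IsMinRep R n}.Infinite := by
      rw [Set.infinite_iff_exists_gt]
      intro N
      obtain ⟨n, hn, hmin⟩ := h (N + 1)
      exact ⟨n, hmin, by omega⟩
    refine (hinf.image (f := fun a => {x | R x a}) ?_).mono ?_
    · intro a ha b hb hab
      have hRab : R a b := (Set.ext_iff.1 hab a).1 (R.refl a)
      rw [← IsMinRep.minRep_eq ha, ← IsMinRep.minRep_eq hb, minRep_eq_of_rel hRab]
    · rintro _ ⟨a, -, rfl⟩
      exact ⟨a, rfl⟩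

theorem infPart_classes {R : Setoid ℕ} : InfPart R.classes ↔ InfClasses R :=
  ⟨fun h => classes_infinite_iff.1 h.2.2,
    fun h => ⟨isPartition_classes R, pdom_classes R, classes_infinite_iff.2 h⟩⟩

theorem InfPart.exists_classes_eq {X : Set (Set ℕ)} (hX : InfPart X) :
    ∃ R : Setoid ℕ, R.classes = X := by
  have h : Setoid.IsPartition X := by
    refine ⟨fun h => Set.not_nonempty_empty (hX.1.1 _ h), fun a => ?_⟩
    obtain ⟨b, hb, hab⟩ : a ∈ pdom X := by rw [hX.2.1]; trivial
    exact ⟨b, ⟨hb, hab⟩, fun c hc => hX.1.eq_of_mem_s11 hc.1 hb hc.2 hab⟩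
  exact ⟨Setoid.mkClasses X h.2, Setoid.classes_mkClasses X h⟩

theorem pmeet_classes (R Q : Setoid ℕ) : pmeet R.classes Q.classes = (R ⊔ Q).classes := by
  have h : ∀ a c, Relation.EqvGen
      (fun u v => sameBlock R.classes u v ∨ sameBlock Q.classes u v) a c ↔ (R ⊔ Q) c a := by
    intro a c
    rw [Setoid.comm']
    simp only [sameBlock_classes]
    rw [Setoid.sup_eq_eqvGen]
    exact Iff.rfl
  ext b
  simp only [pmeet, pdom_classes, Set.univ_union, Set.mem_univ, true_and, h, Set.mem_ofPred_eq]
  exact Iff.rfl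

/-- The partition of `{0, …, n - 1}` into the traces of the classes of `R`. -/
def part (n : ℕ) (R : Setoid ℕ) : Set (Set ℕ) := {b | ∃ a < n, b = {c | c < n ∧ R c a}}

theorem isPartition_part (n : ℕ) (R : Setoid ℕ) : IsPartition (part n R) := by
  constructor
  · rintro _ ⟨a, ha, rfl⟩
    exact ⟨a, ha, R.refl a⟩
  · rintro _ ⟨a, ha, rfl⟩ _ ⟨b, hb, rfl⟩ hne
    refine Set.disjoint_left.2 fun c hc hc' => hne (Set.ext fun x => ?_)
    have hab : R a b := R.trans (R.symm hc.2) hc'.2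
    exact and_congr_right fun _ => ⟨fun h => R.trans h hab, fun h => R.trans h (R.symm hab)⟩

theorem pdom_part (n : ℕ) (R : Setoid ℕ) : pdom (part n R) = Set.Iio n := by
  ext c
  constructor
  · rintro ⟨_, ⟨a, ha, rfl⟩, hc⟩
    exact hc.1
  · exact fun hc => ⟨_, ⟨c, hc, rfl⟩, hc, R.refl c⟩

theorem finPart_part (n : ℕ) (R : Setoid ℕ) : FinPart (part n R) :=
  ⟨isPartition_part n R, n, pdom_part n R⟩

theorem sameBlock_part {n a b : ℕ} {R : Setoid ℕ} :
    sameBlock (part n R) a b ↔ a < n ∧ b < n ∧ R a b := by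
  constructor
  · rintro ⟨_, ⟨c, hc, rfl⟩, ha, hb⟩
    exact ⟨ha.1, hb.1, R.trans ha.2 (R.symm hb.2)⟩
  · rintro ⟨ha, hb, hab⟩
    exact ⟨_, ⟨b, hb, rfl⟩, ⟨ha, hab⟩, hb, R.refl b⟩

theorem FinPart.exists_part_eq {u : Set (Set ℕ)} (hu : FinPart u) :
    ∃ (n : ℕ) (R : Setoid ℕ), IsMinRep R n ∧ part n R = u := by
  obtain ⟨hu, n, hn⟩ := hu
  have hlt : ∀ p ∈ u, ∀ a ∈ p, a < n := fun p hp a ha => by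
    have : a ∈ pdom u := ⟨p, hp, ha⟩
    rwa [hn] at this
  let R : Setoid ℕ :=
    { r := fun a b => a = b ∨ sameBlock u a b
      iseqv := by
        refine ⟨fun a => Or.inl rfl, ?_, ?_⟩
        · rintro a b (rfl | ⟨p, hp, ha, hb⟩)
          · exact Or.inl rfl
          · exact Or.inr ⟨p, hp, hb, ha⟩
        · rintro a b c (rfl | ⟨p, hp, ha, hb⟩) (rfl | ⟨q, hq, hb', hc⟩)
          · exact Or.inl rfl
          · exact Or.inr ⟨q, hq, hb', hc⟩
          · exact Or.inr ⟨p, hp, ha, hb⟩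
          · obtain rfl := hu.eq_of_mem_s11 hp hq hb hb'
            exact Or.inr ⟨p, hp, ha, hc⟩ }
  have hR : ∀ p ∈ u, ∀ a ∈ p, {c | c < n ∧ R c a} = p := by
    intro p hp a ha
    ext c
    constructor
    · rintro ⟨hc, rfl | ⟨q, hq, hcq, haq⟩⟩
      · exact ha
      · obtain rfl := hu.eq_of_mem_s11 hp hq ha haq
        exact hcq
    · exact fun hc => ⟨hlt p hp c hc, Or.inr ⟨p, hp, hc, ha⟩⟩
  refine ⟨n, R, ?_, Set.ext fun b => ⟨?_, fun hb => ?_⟩⟩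
  · rintro a ha (rfl | ⟨p, hp, -, hnp⟩)
    · exact lt_irrefl _ ha
    · exact lt_irrefl _ (hlt p hp n hnp)
  · rintro ⟨a, ha, rfl⟩
    obtain ⟨p, hp, hap⟩ : a ∈ pdom u := by rw [hn]; exact ha
    rwa [hR p hp a hap]
  · obtain ⟨a, ha⟩ := hu.1 b hb
    exact ⟨a, hlt b hb a ha, (hR b hb a ha).symm⟩

theorem finBound_part (n : ℕ) (R : Setoid ℕ) : finBound (part n R) = n := by
  have : {k | pdom (part n R) = Set.Iio k} = {n} := by
    ext k
    rw [Set.mem_ofPred_eq, pdom_part, Set.Iio_inj, Set.mem_singleton_iff, eq_comm]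
  rw [finBound, this, csInf_singleton]

theorem sStar_part {n : ℕ} {R : Setoid ℕ} (hn : IsMinRep R n) :
    sStar (part n R) = part (n + 1) R := by
  have hold : ∀ a < n, {c | c < n + 1 ∧ R c a} = {c | c < n ∧ R c a} := by
    intro a ha
    ext c
    refine and_congr_left fun hca => ⟨fun hc => ?_, fun hc => by omega⟩
    refine lt_of_le_of_ne (Nat.lt_succ_iff.1 hc) ?_
    rintro rfl
    exact hn a ha (R.symm hca)
  have hnew : {c | c < n + 1 ∧ R c n} = {n} := by
    ext c
    constructor
    · rintro ⟨hc, hcn⟩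
      by_contra hne
      exact hn c (lt_of_le_of_ne (Nat.lt_succ_iff.1 hc) hne) hcn
    · rintro rfl
      exact ⟨Nat.lt_succ_self _, R.refl _⟩
  rw [sStar, finBound_part]
  ext b
  constructor
  · rintro (rfl | ⟨a, ha, rfl⟩)
    · exact ⟨n, Nat.lt_succ_self n, hnew.symm⟩
    · exact ⟨a, by omega, (hold a ha).symm⟩
  · rintro ⟨a, ha, rfl⟩
    rcases Nat.lt_succ_iff_lt_or_eq.1 ha with ha | rfl
    · exact Or.inr ⟨a, ha, hold a ha⟩
    · exact Or.inl hnew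

theorem segment_part_classes {n : ℕ} {R Q : Setoid ℕ} :
    Segment (part n R) Q.classes ↔ Agree n R Q := by
  rw [(isPartition_part n R).segment_iff (isPartition_classes Q)]
  simp only [pdom_part, pdom_classes, Set.subset_univ, true_and, sameBlock_part,
    sameBlock_classes, Set.mem_Iio]
  exact forall₂_congr fun a ha => forall₂_congr fun b hb => by simp only [ha, hb, true_and]

theorem segment_part_part {m n : ℕ} {R Q : Setoid ℕ} :
    Segment (part m R) (part n Q) ↔ m ≤ n ∧ Agree m R Q := by
  rw [(isPartition_part m R).segment_iff (isPartition_part n Q)]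
  simp only [pdom_part, Set.Iio_subset_Iio_iff, sameBlock_part, Set.mem_Iio]
  refine and_congr_right fun hmn => forall₂_congr fun a ha => forall₂_congr fun b hb => ?_
  simp only [ha, hb, ha.trans_le hmn, hb.trans_le hmn, true_and]

theorem coarser_part_classes {n : ℕ} {R Q : Setoid ℕ} :
    Coarser (part n R) Q.classes ↔ LeBelow n Q R := by
  rw [(isPartition_part n R).coarser_iff (isPartition_classes Q)]
  simp only [pdom_part, sameBlock_part, sameBlock_classes, Set.mem_Iio]
  exact forall₂_congr fun a ha => forall₂_congr fun b hb => by simp only [ha, hb, true_and]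

theorem leBelow_succ_iff {n : ℕ} {R Q : Setoid ℕ} (hR : IsMinRep R n) :
    LeBelow (n + 1) Q R ↔ LeBelow n Q R ∧ IsMinRep Q n := by
  constructor
  · exact fun h => ⟨fun a ha b hb => h a (by omega) b (by omega),
      fun a ha hQ => hR a ha (h a (by omega) n (by omega) hQ)⟩
  · rintro ⟨h, hQ⟩ a ha b hb hab
    rcases Nat.lt_succ_iff_lt_or_eq.1 ha with ha | rfl <;>
      rcases Nat.lt_succ_iff_lt_or_eq.1 hb with hb | rfl
    · exact h a ha b hb hab
    · exact absurd hab (hQ a ha)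
    · exact absurd (Q.symm hab) (hQ b hb)
    · exact R.refl _

/-- The minima of classes below `n`. -/
def minsBelow (n : ℕ) (R : Setoid ℕ) : Set ℕ := {a | a < n ∧ IsMinRep R a}

theorem finite_minsBelow (n : ℕ) (R : Setoid ℕ) : (minsBelow n R).Finite :=
  (Set.finite_Iio n).subset fun _ h => h.1

theorem ncard_part (n : ℕ) (R : Setoid ℕ) : (part n R).ncard = (minsBelow n R).ncard := by
  have himage : part n R = (fun a => {c | c < n ∧ R c a}) '' minsBelow n R := by
    ext b
    constructor
    · rintro ⟨a, ha, rfl⟩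
      refine ⟨minRep R a, ⟨(minRep_le R a).trans_lt ha, isMinRep_minRep R a⟩,
        Set.ext fun x => and_congr_right fun _ => ?_⟩
      exact ⟨fun hx => R.trans hx (minRep_rel R a),
        fun hx => R.trans hx (R.symm (minRep_rel R a))⟩
    · rintro ⟨a, ha, rfl⟩
      exact ⟨a, ha.1, rfl⟩
  rw [himage]
  refine Set.InjOn.ncard_image fun a ha b hb hab => ?_
  have hRab : R a b := ((Set.ext_iff.1 hab a).1 ⟨ha.1, R.refl a⟩).2
  rw [← IsMinRep.minRep_eq ha.2, ← IsMinRep.minRep_eq hb.2, minRep_eq_of_rel hRab]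

theorem reduces_iff_ncard {m n : ℕ} {R : Setoid ℕ} (hmn : m ≤ n) :
    Reduces m n R ↔ (part n R).ncard = (part m R).ncard := by
  rw [ncard_part, ncard_part]
  have hsub : minsBelow m R ⊆ minsBelow n R := fun a ha => ⟨ha.1.trans_le hmn, ha.2⟩
  constructor
  · intro h
    congr 1
    refine Set.Subset.antisymm (fun a ha => ⟨?_, ha.2⟩) hsub
    obtain ⟨b, hb, hab⟩ := h.2 a ha.1
    by_contra hlt
    exact ha.2 b (by omega) (R.symm hab)
  · intro h
    have heq := Set.eq_of_subset_of_ncard_le hsub h.le (finite_minsBelow n R)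
    refine ⟨hmn, fun a ha => ⟨minRep R a, ?_, R.symm (minRep_rel R a)⟩⟩
    have : minRep R a ∈ minsBelow m R := by
      rw [heq]
      exact ⟨(minRep_le R a).trans_lt ha, isMinRep_minRep R a⟩
    exact this.1

theorem ncard_part_succ {n : ℕ} {R : Setoid ℕ} (hn : IsMinRep R n) :
    (part (n + 1) R).ncard = (part n R).ncard + 1 := by
  have : minsBelow (n + 1) R = insert n (minsBelow n R) := by
    ext a
    constructor
    · rintro ⟨ha, hmin⟩
      rcases Nat.lt_succ_iff_lt_or_eq.1 ha with ha | rfl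
      · exact Or.inr ⟨ha, hmin⟩
      · exact Or.inl rfl
    · rintro (rfl | ha)
      · exact ⟨Nat.lt_succ_self _, hn⟩
      · exact ⟨Nat.lt_succ_of_lt ha.1, ha.2⟩
  rw [ncard_part, ncard_part, this,
    Set.ncard_insert_of_notMem (fun h => lt_irrefl _ h.1) (finite_minsBelow n R)]

theorem Agree.part_eq {n : ℕ} {R Q : Setoid ℕ} (h : Agree n R Q) : part n R = part n Q := by
  ext b
  refine exists_congr fun a => and_congr_right fun ha => ?_
  have : {c | c < n ∧ R c a} = {c | c < n ∧ Q c a} :=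
    Set.ext fun c => and_congr_right fun hc => h c hc a ha
  rw [this]

/-! ### Game filters as families of equivalence relations -/

/-- The equivalence relations whose classes form a member of `F`. -/
def relsOf (F : Set (Set (Set ℕ))) : Set (Setoid ℕ) := {R | R.classes ∈ F}

theorem sup_le_glue_top {n : ℕ} {R Y Z : Setoid ℕ}
    (hR : ∀ c d, R c d → Y c d ∨ (∃ a < n, Y a c) ∧ ∃ b < n, Y b d) :
    Z ⊔ R ≤ glue n ⊤ (Z ⊔ Y) fun _ _ _ _ _ => trivial := by
  refine sup_le (le_sup_left.trans (le_glue _)) fun {c d} hcd => ?_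
  rcases hR c d hcd with h | ⟨⟨a, ha, hac⟩, b, hb, hbd⟩
  · exact le_glue _ ((le_sup_right : Y ≤ Z ⊔ Y) h)
  · have hY : ∀ {x y}, Y x y → (Z ⊔ Y) x y := fun h => (le_sup_right : Y ≤ Z ⊔ Y) h
    exact glue_rel.2 (Or.inr ⟨a, ha, b, hb, hY (Y.symm hac), trivial, hY hbd⟩)

theorem IsPUltrafilter.merge {F : Set (Set (Set ℕ))} (hF : IsPUltrafilter F) {Y R : Setoid ℕ}
    {n : ℕ} (hY : Y.classes ∈ F)
    (hR : ∀ c d, R c d → Y c d ∨ (∃ a < n, Y a c) ∧ ∃ b < n, Y b d) : R.classes ∈ F := by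
  obtain ⟨hF, hmax⟩ := hF
  have hinf : ∀ Z : Setoid ℕ, Z.classes ∈ F → InfClasses (Z ⊔ R) := by
    intro Z hZ N
    have hZY := hF.meet_infPart _ hZ _ hY
    rw [pmeet_classes, infPart_classes] at hZY
    obtain ⟨k, hk, hmin⟩ := hZY (max N n)
    exact ⟨k, by omega, (isMinRep_glue _ (by omega) hmin).anti (sup_le_glue_top hR)⟩
  let G : Set (Set (Set ℕ)) :=
    {X | ∃ Q : Setoid ℕ, Q.classes = X ∧ ∃ Z : Setoid ℕ, Z.classes ∈ F ∧ Q ≤ Z ⊔ R}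
  have hanti : ∀ {Q Q' : Setoid ℕ}, InfClasses Q' → Q ≤ Q' → InfClasses Q :=
    fun h hle N => let ⟨k, hk, hmin⟩ := h N; ⟨k, hk, hmin.anti hle⟩
  have hG : ∀ X ∈ G, InfPart X := by
    rintro _ ⟨Q, rfl, Z, hZ, hQ⟩
    exact infPart_classes.2 (hanti (hinf Z hZ) hQ)
  have hmeet : ∀ X ∈ G, ∀ X' ∈ G, pmeet X X' ∈ G := by
    rintro _ ⟨Q, rfl, Z, hZ, hQ⟩ _ ⟨Q', rfl, Z', hZ', hQ'⟩
    refine ⟨Q ⊔ Q', (pmeet_classes Q Q').symm, Z ⊔ Z', ?_, sup_le ?_ ?_⟩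
    · rw [← pmeet_classes]
      exact hF.meet_mem _ hZ _ hZ'
    · exact hQ.trans (sup_le_sup_right le_sup_left R)
    · exact hQ'.trans (sup_le_sup_right le_sup_right R)
  have hGF : IsPFilter G :=
    { mem_infPart := hG
      empty_not_mem := fun h => (hG _ h).2.2 Set.finite_empty
      upward := by
        rintro _ ⟨Q, rfl, Z, hZ, hQ⟩ Y hY hc
        obtain ⟨P, rfl⟩ := hY.exists_classes_eq
        exact ⟨P, rfl, Z, hZ, (coarser_classes.1 hc).trans hQ⟩
      meet_infPart := fun X hX X' hX' => hG _ (hmeet X hX X' hX')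
      meet_mem := hmeet }
  have hsub : F ⊆ G := fun X hX => by
    obtain ⟨Q, rfl⟩ := (hF.mem_infPart X hX).exists_classes_eq
    exact ⟨Q, rfl, Q, hX, le_sup_left⟩
  rw [hmax G hGF hsub]
  exact ⟨R, rfl, Y, hY, le_sup_right⟩

/-- One round of the game: from the position `p` through the answer `X` to the position `q`. -/
def GameStep (p : ℕ × Setoid ℕ) (X : Setoid ℕ) (q : ℕ × Setoid ℕ) : Prop :=
  X ≤ q.2 ∧ Agree (p.1 + 1) X q.2 ∧ IsMinRep q.2 q.1 ∧ Reduces (p.1 + 1) q.1 q.2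

/-- `X` is a legal answer in the position `p`. -/
def GameAnswer (p : ℕ × Setoid ℕ) (X : Setoid ℕ) : Prop :=
  p.2 ≤ X ∧ Agree p.1 p.2 X ∧ IsMinRep X p.1

theorem limit_of_gameSteps {p : ℕ → ℕ × Setoid ℕ} {X : ℕ → Setoid ℕ} {Z : Setoid ℕ}
    (hans : ∀ i, GameAnswer (p i) (X i)) (hstep : ∀ i, GameStep (p i) (X i) (p (i + 1)))
    (hZ : ∀ i, Agree (p i).1 (p i).2 Z) (i : ℕ) :
    (p i).2 ≤ Z ∧ IsMinRep Z (p i).1 ∧ Reduces ((p i).1 + 1) (p (i + 1)).1 Z := by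
  have hlt : ∀ i, (p i).1 < (p (i + 1)).1 := fun i => (hstep i).2.2.2.1
  have hmono : Monotone fun i => (p i).2 :=
    monotone_nat_of_le_succ fun i => (hans i).1.trans (hstep i).1
  have hle : ∀ i, (p i).2 ≤ Z := by
    intro i c d hcd
    have hst := (strictMono_nat_of_lt_succ hlt).id_le
    let j := max i (max c d + 1)
    have hj : max c d + 1 ≤ (p j).1 := (le_max_right _ _).trans (hst j)
    exact (hZ j c (by omega) d (by omega)).1 (hmono (le_max_left i _) hcd)
  refine ⟨hle i, ?_, (hstep i).2.2.2.mono (LeBelow.of_le (hle (i + 1)))⟩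
  exact (hZ (i + 1)).isMinRep (hlt i)
    ((hstep i).2.1.isMinRep (Nat.lt_succ_self _) (hans i).2.2)

theorem gameAnswer_of_mem_ellNbhd {p : ℕ × Setoid ℕ} {X : Setoid ℕ} (hp : IsMinRep p.2 p.1)
    (h : X.classes ∈ EllNbhd (sStar (part p.1 p.2)) p.2.classes) : GameAnswer p X := by
  obtain ⟨-, hseg, hc⟩ := h
  rw [sStar_part hp, segment_part_classes] at hseg
  exact ⟨coarser_classes.1 hc, hseg.mono (Nat.le_succ _),
    hseg.isMinRep (Nat.lt_succ_self _) hp⟩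

theorem GameFilter.fusion {F : Set (Set (Set ℕ))} (hF : GameFilter F)
    (Inv : ℕ → Setoid ℕ → Prop) (n₀ : ℕ) (Y₀ : Setoid ℕ) (hInv₀ : Inv n₀ Y₀)
    (hY₀ : Y₀ ∈ relsOf F) (hn₀ : IsMinRep Y₀ n₀)
    (hstep : ∀ n Y, Inv n Y → ∀ X ∈ relsOf F, Y ≤ X → Agree n Y X → IsMinRep X n →
      ∃ n' Y', Y' ∈ relsOf F ∧ X ≤ Y' ∧ Agree (n + 1) X Y' ∧ IsMinRep Y' n' ∧
        Reduces (n + 1) n' Y' ∧ Inv n' Y') :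
    ∃ Z ∈ relsOf F, ∃ (n : ℕ → ℕ) (Y : ℕ → Setoid ℕ), n 0 = n₀ ∧ Y 0 = Y₀ ∧
      ∀ i, Inv (n i) (Y i) ∧ Y i ≤ Z ∧ Agree (n i) (Y i) Z ∧ IsMinRep Z (n i) ∧
        Reduces (n i + 1) (n (i + 1)) Z := by
  have hnext : ∀ (p : ℕ × Setoid ℕ) (x : Set (Set ℕ)), ∃ p' : ℕ × Setoid ℕ,
      ∀ X ∈ relsOf F, X.classes = x → Inv p.1 p.2 → GameAnswer p X →
        p'.2 ∈ relsOf F ∧ Inv p'.1 p'.2 ∧ GameStep p X p' := by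
    intro p x
    by_cases h : ∃ X ∈ relsOf F, X.classes = x ∧ Inv p.1 p.2 ∧ GameAnswer p X
    · obtain ⟨X, hX, rfl, hInv, h1, h2, h3⟩ := h
      obtain ⟨n', Y', k1, k2, k3, k4, k5, k6⟩ := hstep p.1 p.2 hInv X hX h1 h2 h3
      refine ⟨(n', Y'), fun X' _ hX' _ _ => ?_⟩
      obtain rfl := Setoid.classes_inj.2 hX'
      exact ⟨k1, k6, k2, k3, k4, k5⟩
    · exact ⟨p, fun X hX hx hInv hans => (h ⟨X, hX, hx, hInv, hans⟩).elim⟩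
  choose next hnext using hnext
  by_contra hcon
  refine hF.2 (fun l => (part (l.foldl next (n₀, Y₀)).1 (l.foldl next (n₀, Y₀)).2,
    (l.foldl next (n₀, Y₀)).2.classes)) fun t Y X hfol => ?_
  let p : ℕ → ℕ × Setoid ℕ := fun i => (List.ofFn fun j : Fin i => X j).foldl next (n₀, Y₀)
  have hp0 : p 0 = (n₀, Y₀) := by simp [p]
  have hpsucc : ∀ i, p (i + 1) = next (p i) (X i) := fun i => by
    simp only [p, List.ofFn_succ', List.concat_eq_append, List.foldl_append]
    simp
  have ht : ∀ i, t i = part (p i).1 (p i).2 := fun i => (congrArg Prod.fst (hfol i)).symm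
  have hY : ∀ i, Y i = (p i).2.classes := fun i => (congrArg Prod.snd (hfol i)).symm
  have hround : ∀ i, (p i).2 ∈ relsOf F ∧ Inv (p i).1 (p i).2 ∧ IsMinRep (p i).2 (p i).1 →
      LegalII F t Y X i → ∃ R ∈ relsOf F, R.classes = X i ∧ GameAnswer (p i) R ∧
        (p (i + 1)).2 ∈ relsOf F ∧ Inv (p (i + 1)).1 (p (i + 1)).2 ∧
          GameStep (p i) R (p (i + 1)) := by
    rintro i ⟨-, hInv, hmin⟩ ⟨hXF, hXi⟩
    obtain ⟨R, hR⟩ := hXi.1.exists_classes_eq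
    rw [ht, hY, ← hR] at hXi
    have hans := gameAnswer_of_mem_ellNbhd hmin hXi
    have hRF : R ∈ relsOf F := by rwa [relsOf, Set.mem_ofPred_eq, hR]
    refine ⟨R, hRF, hR, hans, ?_⟩
    rw [hpsucc]
    exact hnext (p i) (X i) R hRF hR hInv hans
  have hgood : ∀ i, (∀ j < i, LegalII F t Y X j) →
      (p i).2 ∈ relsOf F ∧ Inv (p i).1 (p i).2 ∧ IsMinRep (p i).2 (p i).1 := by
    intro i
    induction i with
    | zero =>
      intro _
      rw [hp0]
      exact ⟨hY₀, hInv₀, hn₀⟩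
    | succ i ih =>
      intro hleg
      obtain ⟨R, -, -, -, h1, h2, h3⟩ :=
        hround i (ih fun j hj => hleg j (by omega)) (hleg i (by omega))
      exact ⟨h1, h2, h3.2.2.1⟩
  constructor
  · intro i hleg
    obtain ⟨h1, h2, h3⟩ := hgood i hleg
    refine ⟨ht i ▸ finPart_part _ _, hY i ▸ h1, ⟨Y i, ?_⟩, ?_⟩
    · rw [ht, hY, sStar_part h3]
      exact ⟨hF.1.1.mem_infPart _ h1, segment_part_classes.2 fun _ _ _ _ => Iff.rfl,
        coarser_classes.2 le_rfl⟩
    · rintro j rfl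
      have hgj := hgood j fun k hk => hleg k (by omega)
      obtain ⟨R, -, hR, hans, -, -, hst⟩ := hround j hgj (hleg j (by omega))
      have hag : Agree ((p j).1 + 1) (p j).2 (p (j + 1)).2 :=
        (hans.2.1.succ hgj.2.2 hans.2.2).trans hst.2.1
      rw [ht, ht, sStar_part h3, sStar_part hgj.2.2, ← hR, segment_part_part,
        coarser_part_classes, (reduces_iff_ncard hst.2.2.2.1).1 hst.2.2.2, ← hag.part_eq,
        ncard_part_succ hgj.2.2]
      exact ⟨⟨hst.2.2.2.1.trans (Nat.le_succ _), hag⟩, LeBelow.of_le hst.1, rfl⟩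
  · intro hleg Z hZ hseg hZF
    obtain ⟨Z, rfl⟩ := hZ.exists_classes_eq
    have hgood' := fun i => hgood i fun j _ => hleg j
    choose R _ _ hans _ _ hst using fun i => hround i (hgood' i) (hleg i)
    have hag : ∀ i, Agree (p i).1 (p i).2 Z := fun i =>
      segment_part_classes.1 (ht i ▸ hseg i)
    refine hcon ⟨Z, hZF, fun i => (p i).1, fun i => (p i).2, by simp only [hp0],
      by simp only [hp0], fun i => ?_⟩
    obtain ⟨k1, k2, k3⟩ := limit_of_gameSteps hans hst hag i
    exact ⟨(hgood' i).2.1, k1, hag i, k2, k3⟩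

theorem GameFilter.isGameFamily {F : Set (Set (Set ℕ))} (hF : GameFilter F) :
    IsGameFamily (relsOf F) where
  inf R hR := infPart_classes.1 (hF.1.1.mem_infPart _ hR)
  finer R hR Q hQ := by
    refine hF.1.1.upward _ hR _ (infPart_classes.2 fun N => ?_) (coarser_classes.2 hQ)
    obtain ⟨k, hk, hmin⟩ := infPart_classes.1 (hF.1.1.mem_infPart _ hR) N
    exact ⟨k, hk, hmin.anti hQ⟩
  merge Y hY n R hR := hF.1.merge hY hR
  fusion := hF.fusion

theorem mem_nseg_part_iff {m : ℕ} {S X : Setoid ℕ} {u : Set (Set ℕ)} (hSX : Agree m S X) :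
    u ∈ nseg (part m S) X.classes (part m S).ncard ↔
      ∃ n U, IsMinRep X n ∧ IsRed m n X U ∧ part n U = u := by
  constructor
  · rintro ⟨hu, hcard, hseg, hc⟩
    obtain ⟨n, U, hmin, rfl⟩ := hu.exists_part_eq
    rw [sStar_part hmin, coarser_part_classes, leBelow_succ_iff hmin] at hc
    obtain ⟨hmn, hag⟩ := segment_part_part.1 hseg
    refine ⟨n, U, hc.2, ⟨hc.1, hSX.symm.trans hag, ?_⟩, rfl⟩
    rw [reduces_iff_ncard hmn, hcard, hag.part_eq]
  · rintro ⟨n, U, hmin, ⟨hle, hag, hred⟩, rfl⟩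
    have hSU := hSX.trans hag
    refine ⟨finPart_part n U, ?_, segment_part_part.2 ⟨hred.1, hSU⟩, ?_⟩
    · rw [hSU.part_eq, (reduces_iff_ncard hred.1).1 hred]
    · obtain ⟨n', R, hR, hpart⟩ := (finPart_part n U).exists_part_eq
      obtain rfl : n' = n := by rw [← finBound_part n' R, hpart, finBound_part]
      have hUR : Agree n' U R := (segment_part_part.1
        (hpart ▸ segment_part_part.2 ⟨le_rfl, fun _ _ _ _ => Iff.rfl⟩ :
          Segment (part n' R) (part n' U))).2.symm
      rw [← hpart, sStar_part hR, coarser_part_classes, leBelow_succ_iff hR]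
      exact ⟨fun a ha b hb hab => (hUR a ha b hb).1 (hle a ha b hb hab), hmin⟩

/-- Preliminary Lemma: For a game filter F, s ⪯ X ∈ F and any
colouring π : (X)^{0*}_s → l with l ≥ 1 there is Y ∈ (s,X) ∩ F such that π is
constant on (Y)^{0*}_s. -/
theorem preliminary_lemma (F : Set (Set (Set ℕ))) (hF : GameFilter F)
    (s X : Set (Set ℕ)) (hs : FinPart s) (hX : X ∈ F) (hsX : Segment s X)
    (l : ℕ) (hl : 1 ≤ l) (π : Set (Set ℕ) → ℕ)
    (hπ : ∀ u ∈ nseg s X s.ncard, π u < l) :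
    ∃ Y ∈ EllNbhd s X, Y ∈ F ∧
      ∀ u ∈ nseg s Y s.ncard, ∀ v ∈ nseg s Y s.ncard, π u = π v := by
  obtain ⟨X, rfl⟩ := (hF.1.1.mem_infPart X hX).exists_classes_eq
  obtain ⟨m, S, -, rfl⟩ := hs.exists_part_eq
  have hSX := segment_part_classes.1 hsX
  rcases Nat.eq_zero_or_pos m with rfl | hm
  · have huniq : ∀ u ∈ nseg (part 0 S) X.classes (part 0 S).ncard, u = part 0 X := by
      intro u hu
      obtain ⟨n, U, -, hU, rfl⟩ := (mem_nseg_part_iff hSX).1 hu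
      rcases Nat.eq_zero_or_pos n with rfl | hn
      · exact hU.2.1.part_eq.symm
      · obtain ⟨b, hb, -⟩ := hU.2.2.2 0 hn
        exact absurd hb (Nat.not_lt_zero b)
    refine ⟨X.classes, ⟨hF.1.1.mem_infPart _ hX, hsX, coarser_classes.2 le_rfl⟩, hX,
      fun u hu v hv => ?_⟩
    rw [huniq u hu, huniq v hv]
  · obtain ⟨Z, hZ, hXZ, hag, i, hi⟩ := exists_color_const hF.isGameFamily hm hX l
      (fun n R => π (part n R)) (fun n R Q h => congrArg π h.part_eq)
      (fun n U hn hU => hπ _ ((mem_nseg_part_iff hSX).2 ⟨n, U, hn, hU, rfl⟩))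
    have hSZ := hSX.trans hag
    have hconst : ∀ u ∈ nseg (part m S) Z.classes (part m S).ncard, π u = i := by
      intro u hu
      obtain ⟨n, U, hn, hU, rfl⟩ := (mem_nseg_part_iff hSZ).1 hu
      exact hi n U hn hU
    exact ⟨Z.classes, ⟨hF.1.1.mem_infPart _ hZ, segment_part_classes.2 hSZ,
      coarser_classes.2 hXZ⟩, hZ, fun u hu v hv => (hconst u hu).trans (hconst v hv).symm⟩

end DualRamsey
end
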